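/- Assume in addition that K is a finite extension of ℚ_p with d = [K:ℚ_p] and with exactly q p-power roots of unity, where q ≥ 3 (this forces d to be even), that L contains at least q p-power roots of unity, that n ≥ 2, and that p > n. Let R₁ = 𝒪_L⟦x_1,…,x_{d+2}⟧/((1+x_1)^q − 1). Then: (i) det(I + X̄_1)^q = 1 holds in R, where X̄_1 is the image of the matrix X_1 in Mₙ(R); (ii) the substitution homomorphism 𝒪_L⟦x_1,…,x_{d+2}⟧ → R sending x_k ↦ det(I + X̄_k) − 1 for each k descends to an 𝒪_L-algebra homomorphism δ : R₁ → R (the map induced by taking determinants of deformations); and (iii) for each minimal prime 𝔮 of R[1/p] there is a unique minimal prime 𝔭 of R₁[1/p] contained in the preimage of 𝔮 under the induced map R₁[1/p] → R[1/p], and the assignment 𝔮 ↦ 𝔭 is a bijection from the set of minimal primes of R[1/p] onto the set of minimal primes of R₁[1/p]. (That is, the determinant map induces a bijection between the irreducible components of the framed deformation space of ρ̄ and those of the deformation space of det ρ̄.) -/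

import Mathlib

set_option synthInstance.maxHeartbeats 1000000
set_option maxHeartbeats 1000000

noncomputable section

/-- The ring of integers of `L`: the integral closure of `ℤ_[p]` in `L`. -/
abbrev RingOfIntegers (p : ℕ) [Fact p.Prime] (L : Type*) [Field L] [Algebra ℤ_[p] L] :=
  integralClosure ℤ_[p] L

/-- The matrix of variables `X_k` inside the multivariate power series ring. -/
def varMatrix {A : Type*} [CommRing A] (N n : ℕ) (k : Fin N) :
    Matrix (Fin n) (Fin n) (MvPowerSeries (Fin N × Fin n × Fin n) A) :=
  Matrix.of fun i j => MvPowerSeries.X (k, i, j)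

/-- `X̃_k = I + X_k`. -/
def Xt {A : Type*} [CommRing A] (N n : ℕ) (k : Fin N) :
    Matrix (Fin n) (Fin n) (MvPowerSeries (Fin N × Fin n × Fin n) A) :=
  1 + varMatrix N n k

/-- Commutator `[A, B] = A B A⁻¹ B⁻¹` of square matrices. -/
def matComm {R : Type*} [CommRing R] {n : ℕ} (A B : Matrix (Fin n) (Fin n) R) :
    Matrix (Fin n) (Fin n) R :=
  A * B * A⁻¹ * B⁻¹

/-- The Demuškin relation matrix
`X̃_1^q ⬝ [X̃_1, X̃_2] ⬝ [X̃_3, X̃_4] ⋯ [X̃_{d+1}, X̃_{d+2}]` with `d = 2m`. -/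
def relMatrix {A : Type*} [CommRing A] (q m n : ℕ) :
    Matrix (Fin n) (Fin n) (MvPowerSeries (Fin (2 * m + 2) × Fin n × Fin n) A) :=
  (Xt (2 * m + 2) n ⟨0, by omega⟩) ^ q *
    (List.ofFn (fun i : Fin (m + 1) =>
      matComm (Xt (2 * m + 2) n ⟨2 * i, by have := i.isLt; omega⟩)
        (Xt (2 * m + 2) n ⟨2 * i + 1, by have := i.isLt; omega⟩))).prod

/-- The ideal generated by the `n²` entries of the relation matrix minus the identity. -/
def relIdeal {A : Type*} [CommRing A] (q m n : ℕ) :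
    Ideal (MvPowerSeries (Fin (2 * m + 2) × Fin n × Fin n) A) :=
  Ideal.span (Set.range fun ij : Fin n × Fin n =>
    (relMatrix (A := A) q m n - 1) ij.1 ij.2)

/-- The universal framed deformation ring `R = S / I_rel`. -/
abbrev defRing {A : Type*} [CommRing A] (q m n : ℕ) :=
  MvPowerSeries (Fin (2 * m + 2) × Fin n × Fin n) A ⧸ relIdeal (A := A) q m n

/-- The scheme-theoretic generic fiber `R[1/p]` of the framed deformation space. -/
def genericFiberRing (p : ℕ) (A : Type*) [CommRing A] (q m n : ℕ) : Type _ :=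
  Localization.Away (p : defRing (A := A) q m n)

instance (p : ℕ) (A : Type*) [CommRing A] (q m n : ℕ) :
    CommRing (genericFiberRing p A q m n) :=
  inferInstanceAs (CommRing (Localization _))

instance (p : ℕ) (A : Type*) [CommRing A] (q m n : ℕ) :
    Algebra (defRing (A := A) q m n) (genericFiberRing p A q m n) :=
  inferInstanceAs (Algebra _ (Localization _))

/-- The ideal of `𝒪_L⟦x_1, …, x_{d+2}⟧` generated by `(1 + x_1)^q - 1`. -/
def charIdeal (A : Type*) [CommRing A] (q m : ℕ) :
    Ideal (MvPowerSeries (Fin (2 * m + 2)) A) :=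
  Ideal.span {(1 + MvPowerSeries.X (⟨0, by omega⟩ : Fin (2 * m + 2))) ^ q - 1}

/-- `R₁ = 𝒪_L⟦x_1, …, x_{d+2}⟧ / ((1 + x_1)^q - 1)`:
the universal deformation ring of the trivial character `det ρ̄`. -/
abbrev charDefRing (A : Type*) [CommRing A] (q m : ℕ) :=
  MvPowerSeries (Fin (2 * m + 2)) A ⧸ charIdeal A q m

/-- The generic fiber `R₁[1/p]`. -/
def charGenericFiber (p : ℕ) (A : Type*) [CommRing A] (q m : ℕ) : Type _ :=
  Localization.Away (p : charDefRing A q m)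

instance (p : ℕ) (A : Type*) [CommRing A] (q m : ℕ) :
    CommRing (charGenericFiber p A q m) :=
  inferInstanceAs (CommRing (Localization _))

instance (p : ℕ) (A : Type*) [CommRing A] (q m : ℕ) :
    Algebra (charDefRing A q m) (charGenericFiber p A q m) :=
  inferInstanceAs (Algebra _ (Localization _))

/-- Every linear relation among the `f i` is a consequence of the trivial (Koszul) ones. -/
def KoszulExact {ι S : Type*} [Fintype ι] [CommRing S] (f : ι → S) : Prop :=
  ∀ a : ι → S, ∑ i, a i * f i = 0 →
    ∃ c : ι → ι → S, ∀ i, a i = ∑ j, (c i j - c j i) * f j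

/-- The family `f` extended by one more element `u`. -/
def adjoinElt {ι S : Type*} (u : S) (f : ι → S) : Option ι → S := fun i => i.elim u f

lemma mem_span_range_iff_sum {ι S : Type*} [Fintype ι] [CommRing S] {f : ι → S} {x : S} :
    x ∈ Ideal.span (Set.range f) ↔ ∃ c : ι → S, x = ∑ i, c i * f i := by
  rw [Ideal.mem_span_range_iff_exists_fun]
  exact exists_congr fun c => eq_comm

lemma KoszulExact.mem_of_mul_mem {ι S : Type*} [Fintype ι] [CommRing S] {u : S} {f : ι → S}
    (h : KoszulExact (adjoinElt u f)) {x : S} (hx : u * x ∈ Ideal.span (Set.range f)) :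
    x ∈ Ideal.span (Set.range f) := by
  obtain ⟨c, hc⟩ := mem_span_range_iff_sum.1 hx
  obtain ⟨b, hb⟩ := h (adjoinElt x fun i => -c i) (by
    simp [adjoinElt, Fintype.sum_option, ← hc, mul_comm x])
  refine mem_span_range_iff_sum.2 ⟨fun j => b none (some j) - b (some j) none, ?_⟩
  simpa [adjoinElt, Fintype.sum_option] using hb none

lemma KoszulExact.adjoin {ι S : Type*} [Fintype ι] [CommRing S] {u : S} {f : ι → S}
    (h : KoszulExact f)
    (hu : ∀ x, u * x ∈ Ideal.span (Set.range f) → x ∈ Ideal.span (Set.range f)) :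
    KoszulExact (adjoinElt u f) := by
  intro a ha
  have ha' : a none * u + ∑ i, a (some i) * f i = 0 := by
    simpa [adjoinElt, Fintype.sum_option] using ha
  obtain ⟨c, hc⟩ := mem_span_range_iff_sum.1 (hu (a none) (mem_span_range_iff_sum.2
    ⟨fun i => -a (some i), by simp; linear_combination ha'⟩))
  obtain ⟨b, hb⟩ := h (fun i => a (some i) + c i * u) (by
    rw [← ha', hc]
    simp only [add_mul, Finset.sum_add_distrib, Finset.sum_mul]
    rw [add_comm]
    congr 1
    exact Finset.sum_congr rfl fun i _ => by ring)
  refine ⟨fun i j => i.elim (j.elim 0 c) fun i' => j.elim 0 fun j' => b i' j', ?_⟩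
  rintro (_ | i)
  · simpa [adjoinElt, Fintype.sum_option] using hc
  · simp [adjoinElt, Fintype.sum_option, ← hb i]

/-- Data exhibiting `ρ : S → S₀` as the quotient by a nonzerodivisor `t` for which `S` is
separated and complete. -/
structure IsAdicReduction {S S₀ : Type*} [CommRing S] [CommRing S₀] (ρ : S →+* S₀) (t : S) :
    Prop where
  surj : Function.Surjective ρ
  ker : ∀ x, ρ x = 0 ↔ t ∣ x
  reg : ∀ x, t * x = 0 → x = 0
  sep : ∀ x, (∀ n : ℕ, t ^ n ∣ x) → x = 0
  complete : ∀ a : ℕ → S, ∃ s, ∀ n, t ^ n ∣ s - ∑ k ∈ Finset.range n, t ^ k * a k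

namespace IsAdicReduction

variable {S S₀ ι : Type*} [CommRing S] [CommRing S₀] [Fintype ι] {ρ : S →+* S₀} {t : S}
  (h : IsAdicReduction ρ t)

include h

lemma exists_step {f : ι → S} (hf : KoszulExact (ρ ∘ f)) (a : ι → S)
    (ha : ∑ i, a i * f i = 0) : ∃ (c : ι → ι → S) (a' : ι → S), ∑ i, a' i * f i = 0 ∧
      ∀ i, a i = ∑ j, (c i j - c j i) * f j + t * a' i := by
  obtain ⟨b, hb⟩ := hf (ρ ∘ a) (by simpa using congrArg ρ ha)
  choose c hc using fun i j => h.surj (b i j)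
  have (i : ι) : t ∣ a i - ∑ j, (c i j - c j i) * f j := by
    rw [← h.ker]
    simpa [hc, sub_eq_zero] using hb i
  choose a' ha' using this
  refine ⟨c, a', h.reg _ ?_, fun i => by rw [← ha']; ring⟩
  rw [Finset.mul_sum]
  simp only [← mul_assoc, ← ha', sub_mul, Finset.sum_sub_distrib, ha, Finset.sum_mul]
  rw [zero_sub, neg_eq_zero, sub_eq_zero, Finset.sum_comm]
  exact Finset.sum_congr rfl fun i _ => Finset.sum_congr rfl fun j _ => by ring

lemma koszulExact {f : ι → S} (hf : KoszulExact (ρ ∘ f)) : KoszulExact f := by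
  intro a ha
  let A := {a : ι → S // ∑ i, a i * f i = 0}
  choose c a' h0 h1 using fun a : A => h.exists_step hf a.1 a.2
  let s : ℕ → A := fun n => Nat.rec ⟨a, ha⟩ (fun _ x => ⟨a' x, h0 x⟩) n
  have hs (n) (i) : (s n).1 i = ∑ j, (c (s n) i j - c (s n) j i) * f j + t * (s (n+1)).1 i :=
    h1 (s n) i
  choose C hC using fun i j => h.complete fun n => c (s n) i j
  have key (n : ℕ) (i) : a i = ∑ j, ((∑ k ∈ Finset.range n, t ^ k * c (s k) i j) -
      ∑ k ∈ Finset.range n, t ^ k * c (s k) j i) * f j + t ^ n * (s n).1 i := by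
    induction n with
    | zero => simp [s]
    | succ n ih =>
      rw [ih, hs n i, mul_add, ← add_assoc, Finset.mul_sum, ← Finset.sum_add_distrib, ← mul_assoc,
        ← pow_succ]
      congr 1
      refine Finset.sum_congr rfl fun j _ => ?_
      rw [Finset.sum_range_succ, Finset.sum_range_succ]
      ring
  refine ⟨C, fun i => sub_eq_zero.1 (h.sep _ fun n => ?_)⟩
  nth_rewrite 1 [key n i]
  rw [add_sub_right_comm, ← Finset.sum_sub_distrib]
  refine dvd_add (Finset.dvd_sum fun j _ => ?_) (dvd_mul_right _ _)
  rw [← sub_mul]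
  refine Dvd.dvd.mul_right ?_ _
  have := dvd_sub (hC j i n) (hC i j n)
  convert this using 1
  ring

lemma mem_of_mul_mem {f : ι → S} (hf : KoszulExact (ρ ∘ f)) {x : S}
    (hx : t * x ∈ Ideal.span (Set.range f)) : x ∈ Ideal.span (Set.range f) := by
  obtain ⟨c, hc⟩ := mem_span_range_iff_sum.1 hx
  have h0 : ρ t = 0 := (h.ker t).2 dvd_rfl
  obtain ⟨b, hb⟩ := hf (ρ ∘ c) (by simpa [h0] using (congrArg ρ hc).symm)
  choose b' hb' using fun i j => h.surj (b i j)
  have (i : ι) : t ∣ c i - ∑ j, (b' i j - b' j i) * f j := by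
    rw [← h.ker]
    simpa [hb', sub_eq_zero] using hb i
  choose a' ha' using this
  refine mem_span_range_iff_sum.2 ⟨a', sub_eq_zero.1 (h.reg _ ?_)⟩
  rw [mul_sub, hc, Finset.mul_sum]
  simp only [← mul_assoc, ← ha', sub_mul, Finset.sum_sub_distrib, Finset.sum_mul]
  rw [sub_sub_cancel, sub_eq_zero, Finset.sum_comm]
  exact Finset.sum_congr rfl fun i _ => Finset.sum_congr rfl fun j _ => by ring

lemma mem_of_pow_mul_mem {f : ι → S} (hf : KoszulExact (ρ ∘ f)) (n : ℕ) {x : S}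
    (hx : t ^ n * x ∈ Ideal.span (Set.range f)) : x ∈ Ideal.span (Set.range f) := by
  induction n with
  | zero => simpa using hx
  | succ n ih => exact ih (h.mem_of_mul_mem hf (by rwa [pow_succ', mul_assoc] at hx))

omit h [Fintype ι] in
lemma map_mem {f : ι → S} {x : S} (hx : x ∈ Ideal.span (Set.range f)) :
    ρ x ∈ Ideal.span (Set.range (ρ ∘ f)) := by
  have := Ideal.mem_map_of_mem ρ hx
  rwa [Ideal.map_span, ← Set.range_comp] at this

lemma exists_factor {f : ι → S} {x : S} (hx : x ∉ Ideal.span (Set.range f)) :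
    ∃ (n : ℕ) (y : S), ρ y ∉ Ideal.span (Set.range (ρ ∘ f)) ∧
      x - t ^ n * y ∈ Ideal.span (Set.range f) := by
  by_contra! hbad
  have step (n : ℕ) (y : S) (hy : x - t ^ n * y ∈ Ideal.span (Set.range f)) :
      ∃ (c : ι → S) (z : S), y = ∑ i, c i * f i + t * z ∧
        x - t ^ (n + 1) * z ∈ Ideal.span (Set.range f) := by
    have hy' : ρ y ∈ Ideal.span (Set.range (ρ ∘ f)) := by
      by_contra hy'
      exact hbad n y hy' hy
    obtain ⟨c, hc⟩ := mem_span_range_iff_sum.1 hy'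
    choose c' hc' using fun i => h.surj (c i)
    obtain ⟨z, hz⟩ := (h.ker (y - ∑ i, c' i * f i)).1 (by simp [hc, hc'])
    refine ⟨c', z, by rw [← hz]; ring, ?_⟩
    have : x - t ^ (n + 1) * z = x - t ^ n * y + t ^ n * ∑ i, c' i * f i := by
      rw [pow_succ, mul_assoc, ← hz]; ring
    rw [this]
    exact add_mem hy (Ideal.mul_mem_left _ _ (mem_span_range_iff_sum.2 ⟨c', rfl⟩))
  let A := {y : ℕ × S // x - t ^ y.1 * y.2 ∈ Ideal.span (Set.range f)}
  choose c z h0 h1 using fun a : A => step a.1.1 a.1.2 a.2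
  let s : ℕ → A := fun n => Nat.rec ⟨(0, x), by simp⟩ (fun _ y => ⟨(y.1.1 + 1, z y), h1 y⟩) n
  have hs (n) : (s n).1.2 = ∑ i, c (s n) i * f i + t * (s (n + 1)).1.2 := h0 (s n)
  choose C hC using fun i => h.complete fun n => c (s n) i
  have key (n : ℕ) : x = ∑ i, (∑ k ∈ Finset.range n, t ^ k * c (s k) i) * f i
      + t ^ n * (s n).1.2 := by
    induction n with
    | zero => simp [s]
    | succ n ih =>
      refine ih.trans ?_
      rw [hs n, mul_add, ← add_assoc, Finset.mul_sum, ← Finset.sum_add_distrib, ← mul_assoc,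
        ← pow_succ]
      congr 1
      refine Finset.sum_congr rfl fun j _ => ?_
      rw [Finset.sum_range_succ]
      ring
  refine hx (mem_span_range_iff_sum.2 ⟨C, sub_eq_zero.1 (h.sep _ fun n => ?_)⟩)
  rw [congrArg (· - ∑ i, C i * f i) (key n)]
  rw [add_sub_right_comm, ← Finset.sum_sub_distrib]
  refine dvd_add (Finset.dvd_sum fun j _ => ?_) (dvd_mul_right _ _)
  rw [← sub_mul]
  exact Dvd.dvd.mul_right ((dvd_sub_comm).1 (hC j n)) _

lemma isPrime {f : ι → S} (hf : KoszulExact (ρ ∘ f))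
    (hp : (Ideal.span (Set.range (ρ ∘ f))).IsPrime) : (Ideal.span (Set.range f)).IsPrime := by
  refine ⟨fun htop => hp.ne_top ?_, fun {x y} hxy => ?_⟩
  · rw [Ideal.eq_top_iff_one] at htop ⊢
    simpa using map_mem (ρ := ρ) htop
  · by_contra! hcon
    obtain ⟨n, x', hx', hx⟩ := h.exists_factor hcon.1
    obtain ⟨m, y', hy', hy⟩ := h.exists_factor hcon.2
    have : t ^ (n + m) * (x' * y') ∈ Ideal.span (Set.range f) := by
      have e : t ^ (n + m) * (x' * y') = x * y - (x - t ^ n * x') * y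
          - (t ^ n * x') * (y - t ^ m * y') := by rw [pow_add]; ring
      rw [e]
      exact sub_mem (sub_mem hxy (Ideal.mul_mem_right _ _ hx)) (Ideal.mul_mem_left _ _ hy)
    have := map_mem (ρ := ρ) (h.mem_of_pow_mul_mem hf _ this)
    rw [map_mul] at this
    exact (hp.mem_or_mem this).elim hx' hy'

lemma notMem {f : ι → S} (hf : KoszulExact (ρ ∘ f))
    (hp : (Ideal.span (Set.range (ρ ∘ f))).IsPrime) : t ∉ Ideal.span (Set.range f) := by
  intro ht
  have := h.mem_of_mul_mem hf (x := 1) (by simpa using ht)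
  refine hp.ne_top ?_
  rw [Ideal.eq_top_iff_one]
  simpa using map_mem (ρ := ρ) this

end IsAdicReduction

lemma PowerSeries.isAdicReduction (A : Type*) [CommRing A] :
    IsAdicReduction (PowerSeries.constantCoeff (R := A)) PowerSeries.X where
  surj a := ⟨PowerSeries.C a, by simp⟩
  ker x := PowerSeries.X_dvd_iff.symm
  reg x hx := by
    ext n
    simpa [PowerSeries.coeff_succ_X_mul] using congrArg (PowerSeries.coeff (n + 1)) hx
  sep x hx := by
    ext n
    simpa using PowerSeries.X_pow_dvd_iff.1 (hx (n + 1)) n (by simp)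
  complete a := by
    refine ⟨PowerSeries.mk fun n => ∑ k ∈ Finset.range (n + 1),
      PowerSeries.coeff n (PowerSeries.X ^ k * a k), fun n => PowerSeries.X_pow_dvd_iff.2 ?_⟩
    intro m hm
    rw [map_sub, PowerSeries.coeff_mk, map_sum, sub_eq_zero]
    refine Finset.sum_subset (by simpa using Nat.succ_le_iff.2 hm) fun k _ hk => ?_
    rw [PowerSeries.coeff_X_pow_mul', if_neg]
    simpa using hk

namespace Graded

variable {σ k : Type*} [Finite σ] [Field k] (w : σ → ℕ)

/-- The image of the variable `i` under the grading homomorphism. -/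
def var (i : σ) : MvPowerSeries Unit (MvPolynomial σ k) :=
  (PowerSeries.X ^ w i * PowerSeries.C (MvPolynomial.X i) : PowerSeries (MvPolynomial σ k))

variable {w}

lemma hasSubst_var (hw : ∀ i, w i ≠ 0) : MvPowerSeries.HasSubst (var (k := k) w) := by
  refine MvPowerSeries.hasSubst_of_constantCoeff_zero fun i => ?_
  change PowerSeries.constantCoeff (PowerSeries.X ^ w i * PowerSeries.C (MvPolynomial.X i)) = 0
  simp [hw i]

/-- The homomorphism recording the weight of each monomial as a power of the variable `t`. -/
def hom (hw : ∀ i, w i ≠ 0) : MvPowerSeries σ k →+* PowerSeries (MvPolynomial σ k) :=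
  (MvPowerSeries.substAlgHom (R := k) (hasSubst_var (k := k) hw)).toRingHom

lemma hom_X (hw : ∀ i, w i ≠ 0) (i : σ) : hom (k := k) hw (MvPowerSeries.X i) =
    PowerSeries.X ^ w i * PowerSeries.C (MvPolynomial.X i) :=
  MvPowerSeries.substAlgHom_X (hasSubst_var hw) i

lemma hom_C (hw : ∀ i, w i ≠ 0) (a : k) : hom (k := k) hw (MvPowerSeries.C a) =
    PowerSeries.C (MvPolynomial.C a) := by
  refine ((MvPowerSeries.substAlgHom (R := k) (hasSubst_var (k := k) hw)).commutes a).trans ?_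
  rw [MvPowerSeries.algebraMap_apply]
  rfl

omit [Finite σ] in
lemma prod_var (d : σ →₀ ℕ) : (d.prod fun i e => var (k := k) w i ^ e) =
    (PowerSeries.X ^ (Finsupp.weight w d) * PowerSeries.C (MvPolynomial.monomial d 1) :
      PowerSeries (MvPolynomial σ k)) := by
  have e1 : (PowerSeries.X ^ (Finsupp.weight w d) : PowerSeries (MvPolynomial σ k)) =
      d.prod fun i e => (PowerSeries.X ^ w i) ^ e := by
    rw [Finsupp.weight_apply, Finsupp.prod, Finsupp.sum, ← Finset.prod_pow_eq_pow_sum]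
    refine Finset.prod_congr rfl fun i _ => ?_
    rw [← pow_mul, smul_eq_mul, mul_comm]
  have e2 : (PowerSeries.C (MvPolynomial.monomial d 1) : PowerSeries (MvPolynomial σ k)) =
      d.prod fun i e => (PowerSeries.C (MvPolynomial.X i)) ^ e := by
    rw [MvPolynomial.monomial_eq, map_one, one_mul, Finsupp.prod, Finsupp.prod, map_prod]
    simp
  rw [e1, e2, ← Finsupp.prod_mul]
  exact Finset.prod_congr rfl fun i _ => mul_pow _ _ _

lemma coeff_hom (hw : ∀ i, w i ≠ 0) (g : MvPowerSeries σ k) (j : ℕ) (m : σ →₀ ℕ) :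
    (PowerSeries.coeff j (hom hw g)).coeff m =
      if Finsupp.weight w m = j then MvPowerSeries.coeff m g else 0 := by
  classical
  have h1 : PowerSeries.coeff j (hom hw g) = finsum (fun d ↦ MvPowerSeries.coeff d g •
      (MvPowerSeries.coeff (Finsupp.single () j) (d.prod fun s e => (var w s) ^ e))) := by
    rw [← MvPowerSeries.coeff_subst (hasSubst_var hw), ← MvPowerSeries.coe_substAlgHom]
    rfl
  have h2 (d : σ →₀ ℕ) : MvPowerSeries.coeff (Finsupp.single () j)
      (d.prod fun s e => (var (k := k) w s) ^ e) =
      if Finsupp.weight w d = j then MvPolynomial.monomial d 1 else 0 := by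
    rw [prod_var]
    change PowerSeries.coeff j _ = _
    rw [PowerSeries.coeff_X_pow_mul']
    split_ifs with h h' h'
    · simp [h']
    · rw [PowerSeries.coeff_C, if_neg (by omega)]
    · omega
    · rfl
  rw [h1]
  have := AddMonoidHom.map_finsum (MvPolynomial.lcoeff k m).toAddMonoidHom
    (MvPowerSeries.coeff_subst_finite (hasSubst_var (k := k) hw) g (Finsupp.single () j))
  refine Eq.trans this ?_
  rw [finsum_eq_single _ m]
  · rw [h2]
    split_ifs <;> simp
  · intro d hd
    rw [h2]
    split_ifs <;> simp [MvPolynomial.coeff_monomial, hd]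

/-- Recovers a power series from its image under `hom` multiplied by `t ^ E`. -/
def retract (w : σ → ℕ) (E : ℕ) : PowerSeries (MvPolynomial σ k) →+ MvPowerSeries σ k where
  toFun s := fun m => (PowerSeries.coeff (Finsupp.weight w m + E) s).coeff m
  map_zero' := by ext m; rfl
  map_add' a b := by ext m; rfl

omit [Finite σ] in
lemma coeff_retract (E : ℕ) (s : PowerSeries (MvPolynomial σ k)) (m : σ →₀ ℕ) :
    MvPowerSeries.coeff m (retract w E s) =
      (PowerSeries.coeff (Finsupp.weight w m + E) s).coeff m := rfl

lemma retract_X_pow_mul (hw : ∀ i, w i ≠ 0) (E : ℕ) (g : MvPowerSeries σ k) :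
    retract w E (PowerSeries.X ^ E * hom hw g) = g := by
  ext m
  rw [coeff_retract, PowerSeries.coeff_X_pow_mul, coeff_hom, if_pos rfl]

lemma retract_mul_hom (hw : ∀ i, w i ≠ 0) (E : ℕ) (s : PowerSeries (MvPolynomial σ k))
    (g : MvPowerSeries σ k) : retract w E (s * hom hw g) = retract w E s * g := by
  classical
  ext m
  rw [coeff_retract, MvPowerSeries.coeff_mul, PowerSeries.coeff_mul, MvPolynomial.coeff_sum]
  simp only [MvPolynomial.coeff_mul, coeff_hom]
  rw [Finset.sum_comm]
  refine Finset.sum_congr rfl fun ab hab => ?_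
  obtain ⟨a, b⟩ := ab
  have hab : a + b = m := by simpa using hab
  have hwt : Finsupp.weight w a + Finsupp.weight w b = Finsupp.weight w m := by
    rw [← hab, map_add]
  rw [Finset.sum_eq_single (Finsupp.weight w a + E, Finsupp.weight w b)]
  · simp [coeff_retract]
  · rintro ⟨i, j⟩ hij hne
    have hij : i + j = Finsupp.weight w m + E := by simpa using hij
    rw [if_neg, mul_zero]
    rintro h
    apply hne
    simp only [Prod.mk.injEq]
    have h : Finsupp.weight w b = j := h
    omega
  · intro h
    refine absurd ?_ h
    simp
    omega

/-- `H` is the lowest graded piece, sitting in weight `d`, of the power series `g` (or zero if the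
weight `d` does not occur). -/
def HasInitial (hw : ∀ i, w i ≠ 0) (d : ℕ) (g : MvPowerSeries σ k) (H : MvPolynomial σ k) : Prop :=
  ∃ G, hom hw g = PowerSeries.X ^ d * G ∧ PowerSeries.constantCoeff G = H

section transfer

variable {ι : Type*} [Fintype ι] {hw : ∀ i, w i ≠ 0} {d : ι → ℕ} {f : ι → MvPowerSeries σ k}
  {H : ι → MvPolynomial σ k}

lemma exists_shift (d : ι → ℕ) : ∃ E, ∀ i j, d i + d j ≤ E :=
  ⟨2 * ∑ i, d i, fun i j => by
    have h1 := Finset.single_le_sum (f := d) (fun _ _ => Nat.zero_le _) (Finset.mem_univ i)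
    have h2 := Finset.single_le_sum (f := d) (fun _ _ => Nat.zero_le _) (Finset.mem_univ j)
    omega⟩

lemma koszulExact_of_initial (hf : ∀ i, HasInitial hw (d i) (f i) (H i)) (hH : KoszulExact H) :
    KoszulExact f := by
  choose G hG hGH using hf
  obtain ⟨E, hE⟩ := exists_shift d
  have hK : KoszulExact G := (PowerSeries.isAdicReduction _).koszulExact
    (by convert hH using 1; exact funext hGH)
  intro a ha
  obtain ⟨b, hb⟩ := hK (fun i => hom hw (a i) * PowerSeries.X ^ d i) (by
    have := congrArg (hom hw) ha
    simpa [hG, mul_assoc] using this)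
  refine ⟨fun i j => retract w E (PowerSeries.X ^ (E - d i - d j) * b i j), fun i => ?_⟩
  have e : PowerSeries.X ^ E * hom hw (a i) = ∑ j, (PowerSeries.X ^ (E - d i - d j) * b i j -
      PowerSeries.X ^ (E - d j - d i) * b j i) * hom hw (f j) := by
    have e0 : PowerSeries.X ^ E * hom hw (a i) =
        PowerSeries.X ^ (E - d i) * (hom hw (a i) * PowerSeries.X ^ d i) := by
      rw [mul_comm (hom hw (a i)), ← mul_assoc, ← pow_add,
        Nat.sub_add_cancel (by have := hE i i; omega)]
    rw [e0, hb i, Finset.mul_sum]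
    refine Finset.sum_congr rfl fun j _ => ?_
    have hij := hE i j
    rw [hG, show E - d j - d i = E - d i - d j by omega,
      show E - d i = E - d i - d j + d j by omega, pow_add, show E - d i - d j + d j - d j =
      E - d i - d j by omega]
    ring
  have := congrArg (retract w E) e
  rw [retract_X_pow_mul, map_sum] at this
  rw [this]
  refine Finset.sum_congr rfl fun j _ => ?_
  rw [retract_mul_hom, map_sub]

lemma isPrime_of_initial (hf : ∀ i, HasInitial hw (d i) (f i) (H i)) (hH : KoszulExact H)
    (hp : (Ideal.span (Set.range H)).IsPrime) : (Ideal.span (Set.range f)).IsPrime := by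
  choose G hG hGH using hf
  obtain ⟨E, hE⟩ := exists_shift d
  have hGH' : PowerSeries.constantCoeff ∘ G = H := funext hGH
  rw [← hGH'] at hp hH
  have hr := PowerSeries.isAdicReduction (MvPolynomial σ k)
  have hGp := hr.isPrime hH hp
  have key (x : MvPowerSeries σ k) (hx : hom hw x ∈ Ideal.span (Set.range G)) :
      x ∈ Ideal.span (Set.range f) := by
    obtain ⟨c, hc⟩ := mem_span_range_iff_sum.1 hx
    refine mem_span_range_iff_sum.2
      ⟨fun j => retract w E (PowerSeries.X ^ (E - d j) * c j), ?_⟩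
    rw [← retract_X_pow_mul hw E x, hc, Finset.mul_sum, map_sum]
    refine Finset.sum_congr rfl fun j _ => ?_
    rw [← retract_mul_hom hw, hG]
    refine congrArg (retract w E) ?_
    have hj : (PowerSeries.X : PowerSeries (MvPolynomial σ k)) ^ E =
        PowerSeries.X ^ (E - d j) * PowerSeries.X ^ d j := by
      rw [← pow_add, Nat.sub_add_cancel (by have := hE j j; omega)]
    rw [hj]
    ring
  have key' (x : MvPowerSeries σ k) (hx : x ∈ Ideal.span (Set.range f)) :
      hom hw x ∈ Ideal.span (Set.range G) := by
    obtain ⟨c, hc⟩ := mem_span_range_iff_sum.1 hx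
    refine mem_span_range_iff_sum.2 ⟨fun j => hom hw (c j) * PowerSeries.X ^ d j, ?_⟩
    simp [hc, hG, mul_assoc]
  refine ⟨fun htop => hGp.ne_top ?_, fun {x y} hxy => ?_⟩
  · rw [Ideal.eq_top_iff_one] at htop ⊢
    simpa using key' 1 htop
  · have := key' _ hxy
    rw [map_mul] at this
    exact (hGp.mem_or_mem this).imp (key x) (key y)

end transfer

section truncation

variable {ι : Type*} [Fintype ι]

lemma hom_coe_of_isHomogeneous {H : MvPolynomial σ k} {d : ℕ} (hH : H.IsHomogeneous d) :
    hom (w := fun _ => 1) (fun _ => one_ne_zero) (H : MvPowerSeries σ k) =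
      PowerSeries.X ^ d * PowerSeries.C H := by
  ext j m
  rw [coeff_hom, PowerSeries.coeff_X_pow_mul', MvPolynomial.coeff_coe]
  by_cases hm : H.coeff m = 0
  · rw [hm]
    split_ifs <;> simp only [PowerSeries.coeff_C, MvPolynomial.coeff_zero]
    all_goals split_ifs <;> simp [hm]
  · have : Finsupp.weight (fun _ => 1) m = d := hH hm
    rw [this]
    split_ifs with h h1 h1
    · simp [h]
    · omega
    · rw [PowerSeries.coeff_C, if_neg (by omega)]
      simp
    · simp

/-- The sum of the coefficients of `t ^ l` for `l ≤ E`. -/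
def partialSum (E : ℕ) : PowerSeries (MvPolynomial σ k) →ₗ[MvPolynomial σ k] MvPolynomial σ k :=
  ∑ l ∈ Finset.range E, PowerSeries.coeff l

omit [Finite σ] in
lemma partialSum_mul_C (E : ℕ) (s : PowerSeries (MvPolynomial σ k)) (a : MvPolynomial σ k) :
    partialSum E (s * PowerSeries.C a) = partialSum E s * a := by
  rw [mul_comm, ← PowerSeries.smul_eq_C_mul, map_smul, smul_eq_mul, mul_comm]

lemma exists_partialSum_hom (a : MvPolynomial σ k) (d : ℕ) : ∃ E₀, ∀ E ≥ E₀,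
    partialSum E (hom (w := fun _ => 1) (fun _ => one_ne_zero) (a : MvPowerSeries σ k) *
      PowerSeries.X ^ d) = a := by
  refine ⟨a.totalDegree + d + 1, fun E hE => ?_⟩
  ext m
  rw [partialSum, LinearMap.sum_apply, MvPolynomial.coeff_sum]
  have (l : ℕ) : (PowerSeries.coeff l (hom (w := fun _ => 1) (fun _ => one_ne_zero)
      (a : MvPowerSeries σ k) * PowerSeries.X ^ d)).coeff m =
      if l = Finsupp.weight (fun _ => 1) m + d then a.coeff m else 0 := by
    rw [PowerSeries.coeff_mul_X_pow']
    split_ifs with h h1 h1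
    · rw [coeff_hom, if_pos (by omega), MvPolynomial.coeff_coe]
    · rw [coeff_hom, if_neg (by omega)]
    · omega
    · simp
  simp only [this, Finset.sum_ite_eq', Finset.mem_range, ite_eq_left_iff]
  intro h
  by_contra hm
  have h1 := MvPolynomial.le_totalDegree (MvPolynomial.mem_support_iff.2 (Ne.symm hm))
  have h2 : Finsupp.weight (fun _ => 1) m = m.sum fun _ e => e := by
    rw [Finsupp.weight_apply]
    simp
  omega

lemma koszulExact_of_coe {H : ι → MvPolynomial σ k} {d : ι → ℕ}
    (hH : ∀ i, (H i).IsHomogeneous (d i))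
    (hK : KoszulExact fun i => (H i : MvPowerSeries σ k)) : KoszulExact H := by
  intro a ha
  obtain ⟨b, hb⟩ := hK (fun i => (a i : MvPowerSeries σ k)) (by
    simpa using congrArg (MvPolynomial.coeToMvPowerSeries.ringHom (σ := σ) (R := k)) ha)
  choose E₀ hE₀ using fun i => exists_partialSum_hom (a i) (d i)
  let E := ∑ i, E₀ i
  have hE (i) : E₀ i ≤ E :=
    Finset.single_le_sum (f := E₀) (fun _ _ => Nat.zero_le _) (Finset.mem_univ i)
  refine ⟨fun i j => partialSum E (hom (w := fun _ => 1) (fun _ => one_ne_zero) (b i j) *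
    PowerSeries.X ^ (d i + d j)), fun i => ?_⟩
  rw [← hE₀ i E (hE i), hb i, map_sum, Finset.sum_mul, map_sum]
  refine Finset.sum_congr rfl fun j _ => ?_
  beta_reduce
  rw [RingHom.map_mul, hom_coe_of_isHomogeneous (hH j), add_comm (d j), ← map_sub, ← sub_mul,
    ← partialSum_mul_C, RingHom.map_sub]
  refine congrArg (partialSum E) ?_
  rw [pow_add]
  ring

end truncation

namespace HasInitial

variable {hw : ∀ i, w i ≠ 0} {d e : ℕ} {g g' : MvPowerSeries σ k} {H H' : MvPolynomial σ k}

lemma add (h : HasInitial hw d g H) (h' : HasInitial hw d g' H') :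
    HasInitial hw d (g + g') (H + H') := by
  obtain ⟨G, hG, hc⟩ := h
  obtain ⟨G', hG', hc'⟩ := h'
  exact ⟨G + G', by rw [map_add, hG, hG', mul_add], by rw [map_add, hc, hc']⟩

lemma neg (h : HasInitial hw d g H) : HasInitial hw d (-g) (-H) := by
  obtain ⟨G, hG, hc⟩ := h
  exact ⟨-G, by rw [map_neg, hG, mul_neg], by rw [map_neg, hc]⟩

lemma sub (h : HasInitial hw d g H) (h' : HasInitial hw d g' H') :
    HasInitial hw d (g - g') (H - H') := by
  simpa only [sub_eq_add_neg] using h.add h'.neg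

lemma mul (h : HasInitial hw d g H) (h' : HasInitial hw e g' H') :
    HasInitial hw (d + e) (g * g') (H * H') := by
  obtain ⟨G, hG, hc⟩ := h
  obtain ⟨G', hG', hc'⟩ := h'
  exact ⟨G * G', by rw [map_mul, hG, hG', pow_add]; ring, by rw [map_mul, hc, hc']⟩

lemma zero (d : ℕ) : HasInitial hw d (0 : MvPowerSeries σ k) 0 := ⟨0, by simp, by simp⟩

lemma C (a : k) : HasInitial hw 0 (MvPowerSeries.C a) (MvPolynomial.C a) :=
  ⟨PowerSeries.C (MvPolynomial.C a), by simp [hom_C], by simp⟩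

lemma X (i : σ) : HasInitial hw (w i) (MvPowerSeries.X i : MvPowerSeries σ k)
    (MvPolynomial.X i) :=
  ⟨PowerSeries.C (MvPolynomial.X i), hom_X hw i, by simp⟩

lemma weaken (h : HasInitial hw d g H) (hd : e < d) : HasInitial hw e g 0 := by
  obtain ⟨G, hG, hc⟩ := h
  refine ⟨PowerSeries.X ^ (d - e) * G, ?_, ?_⟩
  · rw [hG, ← mul_assoc, ← pow_add, Nat.add_sub_cancel' hd.le]
  · simp [Nat.sub_ne_zero_of_lt hd]

lemma sum {α : Type*} (s : Finset α) {g : α → MvPowerSeries σ k} {H : α → MvPolynomial σ k}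
    (h : ∀ i ∈ s, HasInitial hw d (g i) (H i)) :
    HasInitial hw d (∑ i ∈ s, g i) (∑ i ∈ s, H i) := by
  classical
  induction s using Finset.induction_on with
  | empty => exact zero d
  | insert i s hi ih =>
    rw [Finset.sum_insert hi, Finset.sum_insert hi]
    exact (h i (by simp)).add (ih fun j hj => h j (by simp [hj]))

lemma det {n : Type*} [Fintype n] [DecidableEq n] (r : n → ℕ)
    {M : Matrix n n (MvPowerSeries σ k)} {N : Matrix n n (MvPolynomial σ k)}
    (h : ∀ i j, HasInitial hw (r i) (M i j) (N i j)) :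
    HasInitial hw (∑ i, r i) M.det N.det := by
  choose G hG hc using h
  refine ⟨(Matrix.of G).det, ?_, ?_⟩
  · rw [RingHom.map_det, ← Finset.prod_pow_eq_pow_sum, ← Matrix.det_mul_column]
    congr 1
    ext1 i j
    simp [hG]
  · rw [RingHom.map_det]
    congr 1
    ext1 i j
    simp [hc]

end HasInitial

end Graded

lemma KoszulExact.of_equiv {ι ι' S : Type*} [Fintype ι] [Fintype ι'] [CommRing S] {f : ι' → S}
    (e : ι ≃ ι') (h : KoszulExact (f ∘ e)) : KoszulExact f := by
  intro a ha
  obtain ⟨c, hc⟩ := h (a ∘ e) (by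
    rw [← ha]; exact e.sum_comp (fun i => a i * f i))
  refine ⟨fun i j => c (e.symm i) (e.symm j), fun i => ?_⟩
  rw [← e.sum_comp]
  simpa using hc (e.symm i)

lemma KoszulExact.unit_mul {ι S : Type*} [Fintype ι] [CommRing S] {f : ι → S} (v : ι → Sˣ)
    (h : KoszulExact f) : KoszulExact fun i => (v i : S) * f i := by
  intro a ha
  obtain ⟨c, hc⟩ := h (fun i => a i * v i) (by simpa [mul_assoc] using ha)
  refine ⟨fun i j => ↑(v i)⁻¹ * ↑(v j)⁻¹ * c i j, fun i => ?_⟩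
  have : a i = (a i * v i) * ↑(v i)⁻¹ := by simp [mul_assoc]
  rw [this, hc i, Finset.sum_mul]
  refine Finset.sum_congr rfl fun j _ => ?_
  linear_combination (-1 : S) * (↑(v i)⁻¹ * (c i j - c j i) * f j) * Units.inv_mul (v j)

lemma KoszulExact.of_option {ι S : Type*} [Fintype ι] [CommRing S] {f : Option ι → S}
    (h : KoszulExact (fun i => f (some i)))
    (hu : ∀ x, f none * x ∈ Ideal.span (Set.range fun i => f (some i)) →
      x ∈ Ideal.span (Set.range fun i => f (some i))) :
    KoszulExact f := by
  have := h.adjoin hu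
  convert this using 1
  funext i
  cases i <;> rfl

lemma MvPolynomial.koszulExact_monomial {σ k ι : Type*} [Fintype ι] [Field k] (s : ι → σ →₀ ℕ)
    (hs : ∀ i j, i ≠ j → Disjoint (s i).support (s j).support) :
    KoszulExact fun i => MvPolynomial.monomial (s i) (1 : k) := by
  classical
  revert s
  refine Fintype.induction_empty_option (P := fun ι _ => ∀ s : ι → σ →₀ ℕ,
    (∀ i j, i ≠ j → Disjoint (s i).support (s j).support) →
    KoszulExact fun i => MvPolynomial.monomial (s i) (1 : k)) ?_ ?_ ?_ ι
  · intro α β _ e ih s hs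
    let := Fintype.ofEquiv β e.symm
    refine KoszulExact.of_equiv e ?_
    exact ih (s ∘ e) fun i j hij => hs _ _ (e.injective.ne hij)
  · exact fun s _ a _ => ⟨fun _ => 0, fun i => i.elim⟩
  · intro α _ ih s hs
    refine KoszulExact.of_option (ih (fun i => s (some i)) fun i j hij => hs _ _ (by simpa)) ?_
    intro x hx
    have hr : Set.range (fun i : α => MvPolynomial.monomial (s (some i)) (1 : k)) =
        (fun s => MvPolynomial.monomial s (1 : k)) '' (Set.range fun i : α => s (some i)) := by
      rw [← Set.range_comp]; rfl
    rw [hr, MvPolynomial.mem_ideal_span_monomial_image] at hx ⊢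
    intro m hm
    obtain ⟨_, ⟨i, rfl⟩, hi⟩ := hx (s none + m) (by
      rw [MvPolynomial.mem_support_iff, MvPolynomial.coeff_monomial_mul, one_mul]
      exact MvPolynomial.mem_support_iff.1 hm)
    refine ⟨_, ⟨i, rfl⟩, fun a => ?_⟩
    have h1 := hi a
    by_cases ha : a ∈ (s (some i)).support
    · have h2 := Finset.disjoint_left.1 (hs (some i) none (by simp)) ha
      simpa [Finsupp.notMem_support_iff.1 h2] using h1
    · rw [Finsupp.notMem_support_iff.1 ha]
      exact Nat.zero_le _

section

/-- The matrix of variables with index `i` in the polynomial ring. -/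
def polyMatrix (k : Type*) [CommRing k] {N n : ℕ} (i : Fin N) :
    Matrix (Fin n) (Fin n) (MvPolynomial (Fin N × Fin n × Fin n) k) :=
  Matrix.of fun a c => MvPolynomial.X (i, a, c)

/-- The quadratic (and one linear) forms to which the equations of the deformation ring of fixed
determinant degenerate. -/
def leadForm {R : Type*} [CommRing R] {l : ℕ} (X Y Z W : Matrix (Fin (l + 1)) (Fin (l + 1)) R)
    (p : Fin (l + 1) × Fin (l + 1)) : R :=
  if p.1 < p.2 then (X * Y) p.1 p.2
  else if p.2 < p.1 then (Z * W) p.1 p.2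
  else if p.1 = Fin.last l then ((l + 1 : ℕ) : R) * X p.1 p.1
  else (X * Y - Y * X + Z * W - W * Z) p.1 p.1

lemma map_leadForm {R S : Type*} [CommRing R] [CommRing S] {l : ℕ} (f : R →+* S)
    (X Y Z W : Matrix (Fin (l + 1)) (Fin (l + 1)) R) (p : Fin (l + 1) × Fin (l + 1)) :
    f (leadForm X Y Z W p) = leadForm (X.map f) (Y.map f) (Z.map f) (W.map f) p := by
  simp only [leadForm, apply_ite f, Matrix.mul_apply, Matrix.sub_apply, Matrix.add_apply,
    map_sum, map_mul, map_sub, map_add, Matrix.map_apply, map_natCast]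

variable {k : Type*} [Field k] {N l : ℕ}

/-- The forms `leadForm` in the generic matrices. -/
def genericForm (k : Type*) [Field k] (hN : 4 ≤ N) (l : ℕ) (p : Fin (l + 1) × Fin (l + 1)) :
    MvPolynomial (Fin N × Fin (l + 1) × Fin (l + 1)) k :=
  leadForm (polyMatrix k ⟨0, by omega⟩) (polyMatrix k ⟨1, by omega⟩)
    (polyMatrix k ⟨2, by omega⟩) (polyMatrix k ⟨3, by omega⟩) p

lemma MvPolynomial.IsHomogeneous.det {σ n : Type*} [Fintype n] [DecidableEq n] (r : n → ℕ)
    {M : Matrix n n (MvPolynomial σ k)} (h : ∀ i j, (M i j).IsHomogeneous (r i)) :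
    M.det.IsHomogeneous (∑ i, r i) := by
  rw [Matrix.det_apply']
  refine MvPolynomial.IsHomogeneous.sum _ _ _ fun s _ => ?_
  rw [← map_intCast (MvPolynomial.C (σ := σ) (R := k)), ← Equiv.sum_comp s r]
  exact (MvPolynomial.IsHomogeneous.prod _ _ _ fun i _ => h (s i) i).C_mul _

lemma isHomogeneous_polyMatrix_mul (i j : Fin N) {n : ℕ} (a b : Fin n) :
    ((polyMatrix (n := n) k i * polyMatrix (n := n) k j) a b).IsHomogeneous 2 := by
  rw [Matrix.mul_apply]
  exact MvPolynomial.IsHomogeneous.sum _ _ _ fun c _ =>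
    (MvPolynomial.isHomogeneous_X k _).mul (MvPolynomial.isHomogeneous_X k _)

lemma isHomogeneous_genericForm (hN : 4 ≤ N) (p : Fin (l + 1) × Fin (l + 1)) :
    (genericForm k hN l p).IsHomogeneous
      (if p.1 = Fin.last l ∧ p.2 = Fin.last l then 1 else 2) := by
  unfold genericForm leadForm
  have h4 := fun (i j : Fin N) (a b : Fin (l + 1)) => isHomogeneous_polyMatrix_mul (k := k) i j a b
  rcases lt_trichotomy p.1 p.2 with h | h | h
  · rw [if_pos h, if_neg fun h' => by rw [h'.1, h'.2] at h; exact lt_irrefl _ h]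
    exact h4 _ _ _ _
  · rw [if_neg h.not_lt, if_neg h.not_gt]
    by_cases hl : p.1 = Fin.last l
    · rw [if_pos hl, if_pos ⟨hl, h ▸ hl⟩, ← map_natCast (MvPolynomial.C (R := k))]
      exact (MvPolynomial.isHomogeneous_X k _).C_mul _
    · rw [if_neg hl, if_neg fun h' => hl h'.1]
      exact (((h4 _ _ _ _).sub (h4 _ _ _ _)).add (h4 _ _ _ _)).sub (h4 _ _ _ _)
  · rw [if_neg h.not_gt, if_pos h, if_neg fun h' => by rw [h'.1, h'.2] at h; exact lt_irrefl _ h]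
    exact h4 _ _ _ _

namespace Graded

variable {σ : Type*} [Finite σ] {w : σ → ℕ} {hw : ∀ i, w i ≠ 0}

lemma HasInitial.sum_X_mul_X {n : Type*} [Fintype n] (i j : n → σ) {d : ℕ} (c : n)
    (hc : w (i c) + w (j c) = d) (hlt : ∀ c' : n, c' ≠ c → d < w (i c') + w (j c')) :
    HasInitial hw d (∑ c, MvPowerSeries.X (i c) * MvPowerSeries.X (j c) : MvPowerSeries σ k)
      (MvPolynomial.X (i c) * MvPolynomial.X (j c)) := by
  classical
  have : (MvPolynomial.X (i c) * MvPolynomial.X (j c) : MvPolynomial σ k) =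
      ∑ c', if c' = c then MvPolynomial.X (i c') * MvPolynomial.X (j c') else 0 := by simp
  rw [this]
  refine HasInitial.sum _ fun c' _ => ?_
  split_ifs with h
  · subst h
    rw [← hc]
    exact (HasInitial.X _).mul (HasInitial.X _)
  · exact ((HasInitial.X _).mul (HasInitial.X _)).weaken (hlt c' h)

lemma HasInitial.sum_X_mul_X_zero {n : Type*} [Fintype n] (i j : n → σ) {d : ℕ}
    (hlt : ∀ c', d < w (i c') + w (j c')) :
    HasInitial hw d (∑ c, MvPowerSeries.X (i c) * MvPowerSeries.X (j c) : MvPowerSeries σ k)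
      0 := by
  rw [← Finset.sum_const_zero (s := (Finset.univ : Finset n))]
  exact HasInitial.sum _ fun c' _ =>
    ((HasInitial.X _).mul (HasInitial.X _)).weaken (hlt c')

end Graded

lemma coe_polyMatrix_mul (i j : Fin N) {n : ℕ} (a b : Fin n) :
    (((polyMatrix (n := n) k i * polyMatrix (n := n) k j) a b : MvPolynomial _ k) :
        MvPowerSeries _ k) =
      ∑ c, MvPowerSeries.X (i, a, c) * MvPowerSeries.X (j, c, b) := by
  rw [Matrix.mul_apply, ← MvPolynomial.coeToMvPowerSeries.ringHom_apply, map_sum]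
  simp [polyMatrix]

/-- A weight function on the variables depending only on the first four matrices. -/
def weightOf (F : Fin 4 → ℤ → ℤ → ℤ) (v : Fin N × Fin (l + 1) × Fin (l + 1)) : ℕ :=
  1 + (if h : v.1.val < 4 then (F ⟨v.1.val, h⟩ v.2.1.val v.2.2.val).toNat else 0)

lemma weightOf_ne_zero (F : Fin 4 → ℤ → ℤ → ℤ) (v : Fin N × Fin (l + 1) × Fin (l + 1)) :
    weightOf F v ≠ 0 := by simp [weightOf]

lemma weightOf_eq {F : Fin 4 → ℤ → ℤ → ℤ}
    (hF : ∀ i, ∀ a b : Fin (l + 1), 0 ≤ F i a.val b.val) (i : Fin 4) (hi : i.val < N)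
    (a b : Fin (l + 1)) :
    (weightOf F ((⟨i.val, hi⟩, a, b) : Fin N × Fin (l + 1) × Fin (l + 1)) : ℤ) =
      1 + F i a.val b.val := by
  simp only [weightOf, Fin.is_lt, dite_true]
  push_cast
  rw [Int.toNat_of_nonneg (hF _ _ _)]

/-- The exponent of the leading monomial of `genericForm`. -/
def leadExp (hN : 4 ≤ N) (xy : Fin (l + 1) × Fin (l + 1) → Prop) [DecidablePred xy]
    (c : Fin (l + 1) × Fin (l + 1) → Fin (l + 1)) (p : Fin (l + 1) × Fin (l + 1)) :
    Fin N × Fin (l + 1) × Fin (l + 1) →₀ ℕ :=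
  if p.1 = Fin.last l ∧ p.2 = Fin.last l then Finsupp.single (⟨0, by omega⟩, p.1, p.1) 1
  else if xy p then
    Finsupp.single (⟨0, by omega⟩, p.1, c p) 1 + Finsupp.single (⟨1, by omega⟩, c p, p.2) 1
  else Finsupp.single (⟨2, by omega⟩, p.1, c p) 1 + Finsupp.single (⟨3, by omega⟩, c p, p.2) 1

lemma mem_support_leadExp {hN : 4 ≤ N} {xy : Fin (l + 1) × Fin (l + 1) → Prop} [DecidablePred xy]
    {c : Fin (l + 1) × Fin (l + 1) → Fin (l + 1)} {p : Fin (l + 1) × Fin (l + 1)}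
    {v : Fin N × Fin (l + 1) × Fin (l + 1)} (h : v ∈ (leadExp hN xy c p).support) :
    ((p.1.val = l ∧ p.2.val = l) ∧ v.1.val = 0 ∧ v.2.1.val = l ∧ v.2.2.val = l) ∨
    (¬ (p.1.val = l ∧ p.2.val = l) ∧ xy p ∧
      ((v.1.val = 0 ∧ v.2.1.val = p.1.val ∧ v.2.2.val = (c p).val) ∨
        (v.1.val = 1 ∧ v.2.1.val = (c p).val ∧ v.2.2.val = p.2.val))) ∨
    (¬ (p.1.val = l ∧ p.2.val = l) ∧ ¬ xy p ∧
      ((v.1.val = 2 ∧ v.2.1.val = p.1.val ∧ v.2.2.val = (c p).val) ∨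
        (v.1.val = 3 ∧ v.2.1.val = (c p).val ∧ v.2.2.val = p.2.val))) := by
  classical
  have hs (x y : Fin N × Fin (l + 1) × Fin (l + 1))
      (hv : v ∈ (Finsupp.single x 1 + Finsupp.single y 1 : _ →₀ ℕ).support) : v = x ∨ v = y := by
    have := Finsupp.support_add hv
    rw [Finset.mem_union] at this
    exact this.imp (fun h => by simpa using Finsupp.support_single_subset h)
      (fun h => by simpa using Finsupp.support_single_subset h)
  unfold leadExp at h
  split_ifs at h with h1 h2
  · have := Finset.mem_singleton.1 (Finsupp.support_single_subset h)
    simp [this, h1]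
  · simp only [Fin.ext_iff, Fin.val_last] at h1
    refine Or.inr (Or.inl ⟨h1, h2, ?_⟩)
    exact (hs _ _ h).imp (fun e => by simp [e]) fun e => by simp [e]
  · simp only [Fin.ext_iff, Fin.val_last] at h1
    refine Or.inr (Or.inr ⟨h1, h2, ?_⟩)
    exact (hs _ _ h).imp (fun e => by simp [e]) fun e => by simp [e]

open Graded in
lemma hasInitial_genericForm (hN : 4 ≤ N) {F : Fin 4 → ℤ → ℤ → ℤ}
    (hF : ∀ i, ∀ a b : Fin (l + 1), 0 ≤ F i a.val b.val)
    (xy : Fin (l + 1) × Fin (l + 1) → Prop) [DecidablePred xy]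
    (c : Fin (l + 1) × Fin (l + 1) → Fin (l + 1))
    (hxy : ∀ a b : Fin (l + 1), ¬ (a = Fin.last l ∧ b = Fin.last l) → xy (a, b) →
      a ≤ b ∧ ∀ c' : Fin (l + 1), c' ≠ c (a, b) →
      F 0 a.val (c (a, b)).val + F 1 (c (a, b)).val b.val < F 0 a.val c'.val + F 1 c'.val b.val)
    (hzw : ∀ a b : Fin (l + 1), ¬ (a = Fin.last l ∧ b = Fin.last l) → ¬ xy (a, b) →
      b ≤ a ∧ ∀ c' : Fin (l + 1), c' ≠ c (a, b) →
      F 2 a.val (c (a, b)).val + F 3 (c (a, b)).val b.val < F 2 a.val c'.val + F 3 c'.val b.val)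
    (hxy' : ∀ a : Fin (l + 1), a ≠ Fin.last l → xy (a, a) → ∀ c' : Fin (l + 1),
      F 0 a.val (c (a, a)).val + F 1 (c (a, a)).val a.val < F 1 a.val c'.val + F 0 c'.val a.val ∧
      F 0 a.val (c (a, a)).val + F 1 (c (a, a)).val a.val < F 2 a.val c'.val + F 3 c'.val a.val ∧
      F 0 a.val (c (a, a)).val + F 1 (c (a, a)).val a.val < F 3 a.val c'.val + F 2 c'.val a.val)
    (hzw' : ∀ a : Fin (l + 1), a ≠ Fin.last l → ¬ xy (a, a) → ∀ c' : Fin (l + 1),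
      F 2 a.val (c (a, a)).val + F 3 (c (a, a)).val a.val < F 0 a.val c'.val + F 1 c'.val a.val ∧
      F 2 a.val (c (a, a)).val + F 3 (c (a, a)).val a.val < F 1 a.val c'.val + F 0 c'.val a.val ∧
      F 2 a.val (c (a, a)).val + F 3 (c (a, a)).val a.val < F 3 a.val c'.val + F 2 c'.val a.val)
    (p : Fin (l + 1) × Fin (l + 1)) : ∃ d, HasInitial (weightOf_ne_zero F) d
      (genericForm k hN l p : MvPowerSeries _ k)
      ((if p.1 = Fin.last l ∧ p.2 = Fin.last l then ((l + 1 : ℕ) : MvPolynomial _ k) else 1) *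
        MvPolynomial.monomial (leadExp hN xy c p) 1) := by
  obtain ⟨a, b⟩ := p
  have e0 := weightOf_eq (N := N) hF 0 (show 0 < N by omega)
  have e1 := weightOf_eq (N := N) hF 1 (show 1 < N by omega)
  have e2 := weightOf_eq (N := N) hF 2 (show 2 < N by omega)
  have e3 := weightOf_eq (N := N) hF 3 (show 3 < N by omega)
  simp only [Fin.val_zero, Fin.val_one, Fin.val_two, show ((3 : Fin 4) : ℕ) = 3 from rfl]
    at e0 e1 e2 e3
  by_cases hl : a = Fin.last l ∧ b = Fin.last l
  · obtain ⟨rfl, rfl⟩ := hl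
    have e : (genericForm k hN l (Fin.last l, Fin.last l) : MvPowerSeries _ k) =
        MvPowerSeries.C ((l + 1 : ℕ) : k) *
          MvPowerSeries.X ((⟨0, by omega⟩ : Fin N), Fin.last l, Fin.last l) := by
      rw [← MvPolynomial.coe_X, ← MvPolynomial.coe_C, ← MvPolynomial.coe_mul]
      simp [genericForm, leadForm, polyMatrix]
    rw [e]
    have := (HasInitial.C (hw := weightOf_ne_zero (N := N) (l := l) F) ((l + 1 : ℕ) : k)).mul
      (HasInitial.X (⟨0, by omega⟩, Fin.last l, Fin.last l))
    refine ⟨0 + weightOf F ((⟨0, by omega⟩ : Fin N), Fin.last l, Fin.last l), ?_⟩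
    convert this using 1
    simp [leadExp, MvPolynomial.X]
  · rw [if_neg hl, one_mul]
    by_cases hp : xy (a, b)
    · obtain ⟨hab, hlt⟩ := hxy a b hl hp
      refine ⟨weightOf F ((⟨0, by omega⟩, a, c (a, b)) : Fin N × Fin (l + 1) × Fin (l + 1)) +
        weightOf F ((⟨1, by omega⟩, c (a, b), b) : Fin N × Fin (l + 1) × Fin (l + 1)), ?_⟩
      have h0 := HasInitial.sum_X_mul_X (k := k) (hw := weightOf_ne_zero (N := N) (l := l) F)
        (fun c => (⟨0, by omega⟩, a, c)) (fun c => (⟨1, by omega⟩, c, b)) (c (a, b)) rfl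
        fun c' hc' => by have := hlt c' hc'; zify; simp only [e0, e1]; linarith
      have hlead : (MvPolynomial.monomial (leadExp hN xy c (a, b)) 1 : MvPolynomial _ k) =
          MvPolynomial.X (⟨0, by omega⟩, a, c (a, b)) *
            MvPolynomial.X (⟨1, by omega⟩, c (a, b), b) := by
        simp [leadExp, hl, hp, MvPolynomial.X, MvPolynomial.monomial_mul]
      rw [hlead]
      rcases hab.lt_or_eq with hab | rfl
      · have e : genericForm k hN l (a, b) = (polyMatrix (N := N) (n := l + 1) k ⟨0, by omega⟩ *
          polyMatrix (N := N) (n := l + 1) k ⟨1, by omega⟩) a b := by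
          simp [genericForm, leadForm, hab]
        rw [e, coe_polyMatrix_mul]
        exact h0
      · have hal : a ≠ Fin.last l := by simpa using hl
        have e : genericForm k hN l (a, a) =
            (polyMatrix (N := N) (n := l + 1) k ⟨0, by omega⟩ *
              polyMatrix (N := N) (n := l + 1) k ⟨1, by omega⟩) a a -
            (polyMatrix (N := N) (n := l + 1) k ⟨1, by omega⟩ *
              polyMatrix (N := N) (n := l + 1) k ⟨0, by omega⟩) a a +
            (polyMatrix (N := N) (n := l + 1) k ⟨2, by omega⟩ *
              polyMatrix (N := N) (n := l + 1) k ⟨3, by omega⟩) a a -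
            (polyMatrix (N := N) (n := l + 1) k ⟨3, by omega⟩ *
              polyMatrix (N := N) (n := l + 1) k ⟨2, by omega⟩) a a := by
          simp [genericForm, leadForm, hal]
        rw [e, ← MvPolynomial.coeToMvPowerSeries.ringHom_apply, map_sub, map_add, map_sub]
        simp only [MvPolynomial.coeToMvPowerSeries.ringHom_apply, coe_polyMatrix_mul]
        have h := ((h0.sub (HasInitial.sum_X_mul_X_zero (fun c => (⟨1, by omega⟩, a, c))
          (fun c => (⟨0, by omega⟩, c, a)) ?_)).add (HasInitial.sum_X_mul_X_zero
          (fun c => (⟨2, by omega⟩, a, c)) (fun c => (⟨3, by omega⟩, c, a)) ?_)).sub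
          (HasInitial.sum_X_mul_X_zero (fun c => (⟨3, by omega⟩, a, c))
          (fun c => (⟨2, by omega⟩, c, a)) ?_)
        · simpa using h
        all_goals
          intro c'
          have := hxy' a hal hp c'
          zify
          simp only [e0, e1, e2, e3]
          linarith
    · obtain ⟨hab, hlt⟩ := hzw a b hl hp
      refine ⟨weightOf F ((⟨2, by omega⟩, a, c (a, b)) : Fin N × Fin (l + 1) × Fin (l + 1)) +
        weightOf F ((⟨3, by omega⟩, c (a, b), b) : Fin N × Fin (l + 1) × Fin (l + 1)), ?_⟩
      have h0 := HasInitial.sum_X_mul_X (k := k) (hw := weightOf_ne_zero (N := N) (l := l) F)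
        (fun c => (⟨2, by omega⟩, a, c)) (fun c => (⟨3, by omega⟩, c, b)) (c (a, b)) rfl
        fun c' hc' => by have := hlt c' hc'; zify; simp only [e2, e3]; linarith
      have hlead : (MvPolynomial.monomial (leadExp hN xy c (a, b)) 1 : MvPolynomial _ k) =
          MvPolynomial.X (⟨2, by omega⟩, a, c (a, b)) *
            MvPolynomial.X (⟨3, by omega⟩, c (a, b), b) := by
        simp [leadExp, hl, hp, MvPolynomial.X, MvPolynomial.monomial_mul]
      rw [hlead]
      rcases hab.lt_or_eq with hab | rfl
      · have e : genericForm k hN l (a, b) = (polyMatrix (N := N) (n := l + 1) k ⟨2, by omega⟩ *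
          polyMatrix (N := N) (n := l + 1) k ⟨3, by omega⟩) a b := by
          simp [genericForm, leadForm, hab, hab.le]
        rw [e, coe_polyMatrix_mul]
        exact h0
      · have hal : b ≠ Fin.last l := by simpa using hl
        have e : genericForm k hN l (b, b) =
            (polyMatrix (N := N) (n := l + 1) k ⟨0, by omega⟩ *
              polyMatrix (N := N) (n := l + 1) k ⟨1, by omega⟩) b b -
            (polyMatrix (N := N) (n := l + 1) k ⟨1, by omega⟩ *
              polyMatrix (N := N) (n := l + 1) k ⟨0, by omega⟩) b b +
            (polyMatrix (N := N) (n := l + 1) k ⟨2, by omega⟩ *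
              polyMatrix (N := N) (n := l + 1) k ⟨3, by omega⟩) b b -
            (polyMatrix (N := N) (n := l + 1) k ⟨3, by omega⟩ *
              polyMatrix (N := N) (n := l + 1) k ⟨2, by omega⟩) b b := by
          simp [genericForm, leadForm, hal]
        rw [e, ← MvPolynomial.coeToMvPowerSeries.ringHom_apply, map_sub, map_add, map_sub]
        simp only [MvPolynomial.coeToMvPowerSeries.ringHom_apply, coe_polyMatrix_mul]
        have h := (((HasInitial.sum_X_mul_X_zero (fun c => (⟨0, by omega⟩, b, c))
          (fun c => (⟨1, by omega⟩, c, b)) ?_).sub (HasInitial.sum_X_mul_X_zero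
          (fun c => (⟨1, by omega⟩, b, c))
          (fun c => (⟨0, by omega⟩, c, b)) ?_)).add h0).sub
          (HasInitial.sum_X_mul_X_zero (fun c => (⟨3, by omega⟩, b, c))
          (fun c => (⟨2, by omega⟩, c, b)) ?_)
        · simpa using h
        all_goals
          intro c'
          have := hzw' b hal hp c'
          zify
          simp only [e0, e1, e2, e3]
          linarith

open Graded in
lemma koszulExact_genericForm_of_hasInitial (hN : 4 ≤ N) (hl : ((l + 1 : ℕ) : k) ≠ 0)
    {F : Fin 4 → ℤ → ℤ → ℤ} {xy : Fin (l + 1) × Fin (l + 1) → Prop} [DecidablePred xy]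
    {c : Fin (l + 1) × Fin (l + 1) → Fin (l + 1)}
    (hH : ∀ p, ∃ d, HasInitial (weightOf_ne_zero F) d
      (genericForm k hN l p : MvPowerSeries _ k)
      ((if p.1 = Fin.last l ∧ p.2 = Fin.last l then ((l + 1 : ℕ) : MvPolynomial _ k) else 1) *
        MvPolynomial.monomial (leadExp hN xy c p) 1))
    (hdis : ∀ p p', p ≠ p' → Disjoint (leadExp hN xy c p).support (leadExp hN xy c p').support) :
    KoszulExact (genericForm k hN l) := by
  choose d' hd' using hH
  refine koszulExact_of_coe (isHomogeneous_genericForm hN)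
    (koszulExact_of_initial (hw := weightOf_ne_zero F) hd' ?_)
  have hun : IsUnit ((l + 1 : ℕ) : MvPolynomial (Fin N × Fin (l + 1) × Fin (l + 1)) k) := by
    rw [← map_natCast (MvPolynomial.C (R := k))]
    exact (isUnit_iff_ne_zero.2 hl).map _
  have := (MvPolynomial.koszulExact_monomial (k := k) (leadExp hN xy c) hdis).unit_mul
    fun p => if p.1 = Fin.last l ∧ p.2 = Fin.last l then hun.unit else 1
  convert this using 1
  funext p
  split_ifs <;> simp

open Graded in
lemma koszulExact_adjoinElt_genericForm (hN : 4 ≤ N) (hl : ((l + 1 : ℕ) : k) ≠ 0)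
    {F : Fin 4 → ℤ → ℤ → ℤ} {xy : Fin (l + 1) × Fin (l + 1) → Prop} [DecidablePred xy]
    {c : Fin (l + 1) × Fin (l + 1) → Fin (l + 1)}
    (hH : ∀ p, ∃ d, HasInitial (weightOf_ne_zero F) d
      (genericForm k hN l p : MvPowerSeries _ k)
      ((if p.1 = Fin.last l ∧ p.2 = Fin.last l then ((l + 1 : ℕ) : MvPolynomial _ k) else 1) *
        MvPolynomial.monomial (leadExp hN xy c p) 1))
    {u : MvPolynomial (Fin N × Fin (l + 1) × Fin (l + 1)) k} {e : ℕ} (hu : u.IsHomogeneous e)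
    {d : ℕ} {s : Fin N × Fin (l + 1) × Fin (l + 1) →₀ ℕ}
    (hu' : HasInitial (weightOf_ne_zero F) d (u : MvPowerSeries _ k) (MvPolynomial.monomial s 1))
    (hdis : ∀ p p', p ≠ p' → Disjoint (leadExp hN xy c p).support (leadExp hN xy c p').support)
    (hdis' : ∀ p, Disjoint s.support (leadExp hN xy c p).support) :
    KoszulExact (adjoinElt u (genericForm k hN l)) := by
  choose d' hd' using hH
  refine koszulExact_of_coe (d := fun i => i.elim e fun p =>
    if p.1 = Fin.last l ∧ p.2 = Fin.last l then 1 else 2) ?_ ?_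
  · rintro (_ | p)
    · exact hu
    · exact isHomogeneous_genericForm hN p
  refine koszulExact_of_initial (hw := weightOf_ne_zero F) (d := fun i => i.elim d d')
    (H := fun i => i.elim (MvPolynomial.monomial s 1) fun p =>
      (if p.1 = Fin.last l ∧ p.2 = Fin.last l then ((l + 1 : ℕ) : MvPolynomial _ k) else 1) *
        MvPolynomial.monomial (leadExp hN xy c p) 1) ?_ ?_
  · rintro (_ | p)
    · exact hu'
    · exact hd' p
  have hun : IsUnit ((l + 1 : ℕ) : MvPolynomial (Fin N × Fin (l + 1) × Fin (l + 1)) k) := by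
    rw [← map_natCast (MvPolynomial.C (R := k))]
    exact (isUnit_iff_ne_zero.2 hl).map _
  have := (MvPolynomial.koszulExact_monomial (k := k) (ι := Option (Fin (l + 1) × Fin (l + 1)))
    (fun i => i.elim s (leadExp hN xy c)) ?_).unit_mul (fun i => i.elim 1 fun p =>
      if p.1 = Fin.last l ∧ p.2 = Fin.last l then hun.unit else 1)
  · convert this using 1
    funext i
    rcases i with _ | p
    · simp
    · dsimp only [Option.elim]
      split_ifs <;> simp
  · rintro (_ | p) (_ | p') h
    · exact absurd rfl h
    · exact hdis' p'
    · exact (hdis' p).symm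
    · exact hdis p p' (by simpa using h)

end

/-- The first row-degenerate version of the generic matrix. -/
def lastRowOne {R : Type*} [CommRing R] {l : ℕ} (X : Matrix (Fin (l + 1)) (Fin (l + 1)) R) :
    Matrix (Fin (l + 1)) (Fin (l + 1)) R :=
  X.updateRow (Fin.last l) (Pi.single (Fin.last l) 1)

section Weights

variable {k : Type*} [Field k] {N l : ℕ}

/-- A weight making a generic choice of monomials in `X * Y` above the diagonal and in `Z * W` on
and below the diagonal leading. -/
def weightBelow (l j : ℕ) : Fin 4 → ℤ → ℤ → ℤ :=
  ![fun a c => (a + (if (j : ℤ) ≤ a then 1 else 0) - c) ^ 2,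
    fun c b => 2 * (l - c) * ((if j ≤ l then (l : ℤ) else l + 1) - b) + (l + 1) ^ 2,
    fun a c => 2 * (l - c) * (l - a),
    fun c b => (b - c) ^ 2 + if b = l then 1 else 0]

/-- A weight making a generic choice of monomials in `X * Y` on and above the diagonal and in
`Z * W` below the diagonal leading. -/
def weightAbove (l : ℕ) : Fin 4 → ℤ → ℤ → ℤ :=
  ![fun a c => (a - c) ^ 2 + if a = l then 1 else 0,
    fun c b => 2 * (l - c) * (l - b),
    fun a c => (a - c) ^ 2,
    fun c b => 2 * c * (b + 1) + (l + 1) ^ 2]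

lemma weightBelow_nonneg (j : ℕ) (i : Fin 4) (a b : Fin (l + 1)) :
    0 ≤ weightBelow l j i a.val b.val := by
  have ha : (a.val : ℤ) ≤ l := by have := a.isLt; omega
  have hb : (b.val : ℤ) ≤ l := by have := b.isLt; omega
  have ha' : (0 : ℤ) ≤ l - a.val := by omega
  have hb' : (0 : ℤ) ≤ l - b.val := by omega
  fin_cases i <;> simp [weightBelow]
  · positivity
  · have : (0 : ℤ) ≤ (if j ≤ l then (l : ℤ) else l + 1) - b.val := by split_ifs <;> omega
    positivity
  · positivity
  · split_ifs <;> positivity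

lemma weightAbove_nonneg (i : Fin 4) (a b : Fin (l + 1)) :
    0 ≤ weightAbove l i a.val b.val := by
  have ha : (a.val : ℤ) ≤ l := by have := a.isLt; omega
  have hb : (b.val : ℤ) ≤ l := by have := b.isLt; omega
  have ha' : (0 : ℤ) ≤ l - a.val := by omega
  have hb' : (0 : ℤ) ≤ l - b.val := by omega
  fin_cases i <;> simp [weightAbove]
  · split_ifs <;> positivity
  · positivity
  · positivity
  · positivity

open Graded in
lemma exists_koszulExact_weightBelow (hN : 4 ≤ N) (hl : ((l + 1 : ℕ) : k) ≠ 0) (j : ℕ)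
    {u : MvPolynomial (Fin N × Fin (l + 1) × Fin (l + 1)) k} {e : ℕ} (hu : u.IsHomogeneous e)
    {d : ℕ} {s : Fin N × Fin (l + 1) × Fin (l + 1) →₀ ℕ}
    (hu' : HasInitial (weightOf_ne_zero (weightBelow l j)) d (u : MvPowerSeries _ k)
      (MvPolynomial.monomial s 1))
    (hs : ∀ v ∈ s.support, (l < j ∧ v.1.val = 0 ∧ v.2.1.val < l ∧ v.2.2.val = v.2.1.val) ∨
      (j < l ∧ v.1.val = 1 ∧ v.2.1.val = j ∧ v.2.2.val = l)) :
    KoszulExact (adjoinElt u (genericForm k hN l)) := by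
  have hc : ∀ p : Fin (l + 1) × Fin (l + 1), ∃ c : Fin (l + 1),
      (p.1 < p.2 → (c.val : ℤ) = p.1.val + (if j ≤ p.1.val then 1 else 0) +
        (if j ≤ l then (l : ℤ) else l + 1) - p.2.val) ∧
      (p.2 ≤ p.1 → (c.val : ℤ) = p.2.val + l - p.1.val) := by
    rintro ⟨a, b⟩
    have := a.isLt
    have := b.isLt
    rcases lt_or_ge a b with h | h
    · have h' : a.val < b.val := h
      refine ⟨⟨a.val + (if j ≤ a.val then 1 else 0) + (if j ≤ l then l else l + 1) - b.val, ?_⟩,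
        fun _ => ?_, fun h' => absurd h h'.not_gt⟩
      · split_ifs <;> omega
      · dsimp only
        split_ifs <;> omega
    · have h' : b.val ≤ a.val := h
      refine ⟨⟨b.val + l - a.val, by omega⟩, fun h' => absurd h h'.not_ge, fun _ => ?_⟩
      dsimp only
      omega
  choose c hc1 hc2 using hc
  refine koszulExact_adjoinElt_genericForm (F := weightBelow l j) (xy := fun p => p.1 < p.2)
    (c := c) hN hl (hasInitial_genericForm hN (weightBelow_nonneg j) _ _ ?_ ?_ ?_ ?_) hu hu' ?_ ?_
  · intro a b _ hab
    refine ⟨hab.le, fun c' hc' => ?_⟩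
    have h := hc1 (a, b) hab
    have hne : (c'.val : ℤ) - (c (a, b)).val ≠ 0 := by
      rw [sub_ne_zero]; exact fun h => hc' (Fin.ext (by exact_mod_cast h))
    have := pow_pos (abs_pos.2 hne) 2
    rw [sq_abs] at this
    simp only [weightBelow, Matrix.cons_val_zero, Matrix.cons_val_one, Nat.cast_le]
    dsimp only at h
    generalize (if j ≤ l then (l : ℤ) else l + 1) = h1 at *
    generalize (if j ≤ a.val then (1 : ℤ) else 0) = h2 at *
    rw [h] at this ⊢
    nlinarith
  · intro a b _ hab
    have hab := not_lt.1 hab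
    refine ⟨hab, fun c' hc' => ?_⟩
    have h := hc2 (a, b) hab
    have hne : (c'.val : ℤ) - (c (a, b)).val ≠ 0 := by
      rw [sub_ne_zero]; exact fun h => hc' (Fin.ext (by exact_mod_cast h))
    have := pow_pos (abs_pos.2 hne) 2
    rw [sq_abs] at this
    simp only [weightBelow, Matrix.cons_val]
    dsimp only at h
    rw [h] at this ⊢
    nlinarith
  · intro a _ h
    exact absurd h (lt_irrefl a)
  · intro a ha _ c'
    have h := hc2 (a, a) le_rfl
    dsimp only at h
    have h : ((c (a, a)).val : ℤ) = l := by omega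
    have ha' : (a.val : ℤ) < l := by have := Fin.val_lt_last ha; omega
    have hc' : (c'.val : ℤ) ≤ l := by have := c'.isLt; omega
    have h0 := weightBelow_nonneg j 0 a c'
    have h0' := weightBelow_nonneg j 0 c' a
    have h1 : ∀ x y : Fin (l + 1), ((l : ℤ) + 1) ^ 2 ≤ weightBelow l j 1 x.val y.val := by
      intro x y
      have hx : (0 : ℤ) ≤ l - x.val := by have := x.isLt; omega
      have : (0 : ℤ) ≤ (if j ≤ l then (l : ℤ) else l + 1) - y.val := by
        have := y.isLt; split_ifs <;> omega
      simp only [weightBelow, Matrix.cons_val_one, Matrix.cons_val_zero]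
      have := mul_nonneg (mul_nonneg zero_le_two hx) this
      linarith
    have e : weightBelow l j 2 a.val (c (a, a)).val + weightBelow l j 3 (c (a, a)).val a.val =
        (l - a.val) ^ 2 := by
      simp only [weightBelow, Matrix.cons_val]
      rw [h, if_neg ha'.ne]; ring
    rw [e]
    have hpos : (0 : ℤ) ≤ a.val := by positivity
    have h1a := h1 a c'
    have h1b := h1 c' a
    refine ⟨by nlinarith, by nlinarith, ?_⟩
    simp only [weightBelow, Matrix.cons_val]
    split_ifs with h5
    · rw [h5]; nlinarith
    · have : (c'.val : ℤ) < l := lt_of_le_of_ne hc' h5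
      nlinarith
  · rintro ⟨a, b⟩ ⟨a', b'⟩ hne
    rw [Finset.disjoint_left]
    intro v hv hv'
    have hne' : ¬ (a.val = a'.val ∧ b.val = b'.val) := fun h =>
      hne (Prod.ext (Fin.ext h.1) (Fin.ext h.2))
    have h1 := hc1 (a, b)
    have h2 := hc2 (a, b)
    have h1' := hc1 (a', b')
    have h2' := hc2 (a', b')
    have hv := mem_support_leadExp hv
    have hv' := mem_support_leadExp hv'
    simp only [Fin.lt_def, Fin.le_def] at *
    split_ifs at * <;> omega
  · rintro ⟨a, b⟩
    rw [Finset.disjoint_left]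
    intro v hv hv'
    have h1 := hc1 (a, b)
    have h2 := hc2 (a, b)
    have hv := hs v hv
    have hv' := mem_support_leadExp hv'
    simp only [Fin.lt_def, Fin.le_def] at *
    split_ifs at * <;> omega

open Graded in
lemma exists_koszulExact_weightAbove (hN : 4 ≤ N) (hl : ((l + 1 : ℕ) : k) ≠ 0)
    {u : MvPolynomial (Fin N × Fin (l + 1) × Fin (l + 1)) k} {e : ℕ} (hu : u.IsHomogeneous e)
    {d : ℕ} {s : Fin N × Fin (l + 1) × Fin (l + 1) →₀ ℕ}
    (hu' : HasInitial (weightOf_ne_zero (weightAbove l)) d (u : MvPowerSeries _ k)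
      (MvPolynomial.monomial s 1))
    (hs : ∀ v ∈ s.support, v.1.val = 2 ∧ v.2.2.val = v.2.1.val) :
    KoszulExact (adjoinElt u (genericForm k hN l)) ∧ KoszulExact (genericForm k hN l) := by
  have hc : ∀ p : Fin (l + 1) × Fin (l + 1), ∃ c : Fin (l + 1),
      (p.1 ≤ p.2 → (c.val : ℤ) = p.1.val + l - p.2.val) ∧
      (p.2 < p.1 → (c.val : ℤ) = p.1.val - p.2.val - 1) := by
    rintro ⟨a, b⟩
    have := a.isLt
    have := b.isLt
    rcases lt_or_ge b a with h | h
    · have h' : b.val < a.val := h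
      refine ⟨⟨a.val - b.val - 1, by omega⟩,
        fun h' => absurd h h'.not_gt, fun _ => ?_⟩
      dsimp only
      omega
    · have h' : a.val ≤ b.val := h
      refine ⟨⟨a.val + l - b.val, by omega⟩, fun _ => ?_, fun h' => absurd h h'.not_ge⟩
      dsimp only
      omega
  choose c hc1 hc2 using hc
  suffices h : (∀ p, ∃ d, HasInitial (weightOf_ne_zero (weightAbove l)) d
      (genericForm k hN l p : MvPowerSeries _ k)
      ((if p.1 = Fin.last l ∧ p.2 = Fin.last l then ((l + 1 : ℕ) : MvPolynomial _ k) else 1) *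
        MvPolynomial.monomial (leadExp hN (fun p => p.1 ≤ p.2) c p) 1)) ∧
      (∀ p p', p ≠ p' → Disjoint (leadExp hN (fun p => p.1 ≤ p.2) c p).support
        (leadExp hN (fun p => p.1 ≤ p.2) c p').support) ∧
      ∀ p, Disjoint s.support (leadExp hN (fun p => p.1 ≤ p.2) c p).support from
    ⟨koszulExact_adjoinElt_genericForm hN hl h.1 hu hu' h.2.1 h.2.2,
      koszulExact_genericForm_of_hasInitial hN hl h.1 h.2.1⟩
  refine ⟨hasInitial_genericForm hN weightAbove_nonneg _ _ ?_ ?_ ?_ ?_, ?_, ?_⟩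
  · intro a b _ hab
    refine ⟨hab, fun c' hc' => ?_⟩
    have h := hc1 (a, b) hab
    have hne : (c'.val : ℤ) - (c (a, b)).val ≠ 0 := by
      rw [sub_ne_zero]; exact fun h => hc' (Fin.ext (by exact_mod_cast h))
    have := pow_pos (abs_pos.2 hne) 2
    rw [sq_abs] at this
    simp only [weightAbove, Matrix.cons_val_zero, Matrix.cons_val_one]
    dsimp only at h
    rw [h] at this ⊢
    nlinarith
  · intro a b _ hab
    have hab : b < a := not_le.1 hab
    refine ⟨hab.le, fun c' hc' => ?_⟩
    have h := hc2 (a, b) hab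
    have hne : (c'.val : ℤ) - (c (a, b)).val ≠ 0 := by
      rw [sub_ne_zero]; exact fun h => hc' (Fin.ext (by exact_mod_cast h))
    have := pow_pos (abs_pos.2 hne) 2
    rw [sq_abs] at this
    simp only [weightAbove, Matrix.cons_val]
    dsimp only at h
    rw [h] at this ⊢
    nlinarith
  · intro a ha _ c'
    have h := hc1 (a, a) le_rfl
    dsimp only at h
    have h : ((c (a, a)).val : ℤ) = l := by omega
    have ha' : (a.val : ℤ) < l := by have := Fin.val_lt_last ha; omega
    have hc' : (c'.val : ℤ) ≤ l := by have := c'.isLt; omega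
    have h2 := weightAbove_nonneg 2 a c'
    have h2' := weightAbove_nonneg 2 c' a
    have h3 : ∀ x y : Fin (l + 1), ((l : ℤ) + 1) ^ 2 ≤ weightAbove l 3 x.val y.val := by
      intro x y
      simp only [weightAbove, Matrix.cons_val]
      have : (0 : ℤ) ≤ 2 * x.val * (y.val + 1) := by positivity
      linarith
    have e : weightAbove l 0 a.val (c (a, a)).val + weightAbove l 1 (c (a, a)).val a.val =
        (l - a.val) ^ 2 := by
      simp only [weightAbove, Matrix.cons_val_zero, Matrix.cons_val_one]
      rw [h, if_neg ha'.ne]; ring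
    rw [e]
    have hpos : (0 : ℤ) ≤ a.val := by positivity
    have h1a := h3 a c'
    have h1b := h3 c' a
    refine ⟨?_, by nlinarith, by nlinarith⟩
    simp only [weightAbove, Matrix.cons_val_zero, Matrix.cons_val_one]
    split_ifs with h5
    · rw [h5]; nlinarith
    · have : (c'.val : ℤ) < l := lt_of_le_of_ne hc' h5
      nlinarith
  · intro a _ h
    exact absurd le_rfl h
  · rintro ⟨a, b⟩ ⟨a', b'⟩ hne
    rw [Finset.disjoint_left]
    intro v hv hv'
    have hne' : ¬ (a.val = a'.val ∧ b.val = b'.val) := fun h =>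
      hne (Prod.ext (Fin.ext h.1) (Fin.ext h.2))
    have h1 := hc1 (a, b)
    have h2 := hc2 (a, b)
    have h1' := hc1 (a', b')
    have h2' := hc2 (a', b')
    have hv := mem_support_leadExp hv
    have hv' := mem_support_leadExp hv'
    simp only [Fin.lt_def, Fin.le_def] at *
    omega
  · rintro ⟨a, b⟩
    rw [Finset.disjoint_left]
    intro v hv hv'
    have h1 := hc1 (a, b)
    have h2 := hc2 (a, b)
    have hv := hs v hv
    have hv' := mem_support_leadExp hv'
    simp only [Fin.lt_def, Fin.le_def] at *
    omega

open Graded in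
lemma koszulExact_genericForm (hN : 4 ≤ N) (hl : ((l + 1 : ℕ) : k) ≠ 0) :
    KoszulExact (genericForm k hN l) := by
  refine (exists_koszulExact_weightAbove hN hl (u := 1) (MvPolynomial.isHomogeneous_one _ _)
    (s := 0) (d := 0) ?_ (by simp)).2
  simpa using HasInitial.C (hw := weightOf_ne_zero (N := N) (l := l) (weightAbove l)) (1 : k)

open Graded in
lemma koszulExact_adjoinElt_X (hN : 4 ≤ N) (hl : ((l + 1 : ℕ) : k) ≠ 0) (j : Fin (l + 1))
    (hj : j ≠ Fin.last l) :
    KoszulExact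
      (adjoinElt (MvPolynomial.X (⟨1, by omega⟩, j, Fin.last l)) (genericForm k hN l)) := by
  have hj' := Fin.val_lt_last hj
  refine exists_koszulExact_weightBelow hN hl j.val (MvPolynomial.isHomogeneous_X k _)
    (s := Finsupp.single (⟨1, by omega⟩, j, Fin.last l) 1)
    (d := weightOf (weightBelow l j) ((⟨1, by omega⟩ : Fin N), j, Fin.last l)) ?_ ?_
  · rw [MvPolynomial.coe_X]
    exact HasInitial.X _
  · intro v hv
    have := Finset.mem_singleton.1 (Finsupp.support_single_subset hv)
    rw [this]
    exact Or.inr ⟨hj', rfl, rfl, rfl⟩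

lemma MvPolynomial.monomial_sum_single {σ ι : Type*} (s : Finset ι) (v : ι → σ) :
    (MvPolynomial.monomial (∑ i ∈ s, Finsupp.single (v i) 1) 1 : MvPolynomial σ k) =
      ∏ i ∈ s, MvPolynomial.X (v i) := by
  rw [MvPolynomial.monomial_sum_one]
  rfl

open Graded in
lemma koszulExact_adjoinElt_det (hN : 4 ≤ N) (hl : ((l + 1 : ℕ) : k) ≠ 0) :
    KoszulExact (adjoinElt (polyMatrix k ⟨2, by omega⟩).det (genericForm k hN l)) := by
  refine (exists_koszulExact_weightAbove hN hl (u := (polyMatrix k ⟨2, by omega⟩).det)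
    (e := ∑ i : Fin (l + 1), 1)
    (MvPolynomial.IsHomogeneous.det _ fun i j => MvPolynomial.isHomogeneous_X k _)
    (s := ∑ i : Fin (l + 1), Finsupp.single (⟨2, by omega⟩, i, i) 1)
    (d := ∑ i : Fin (l + 1), 1) ?_ ?_).1
  · have hdet : (((polyMatrix (N := N) (n := l + 1) k ⟨2, by omega⟩).det : MvPolynomial _ k) :
        MvPowerSeries _ k) = (Matrix.of fun a c : Fin (l + 1) =>
          (MvPowerSeries.X ((⟨2, by omega⟩ : Fin N), a, c) : MvPowerSeries _ k)).det := by
      rw [← MvPolynomial.coeToMvPowerSeries.ringHom_apply, RingHom.map_det]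
      congr 1
      ext a c : 2
      simp [polyMatrix]
    rw [hdet, MvPolynomial.monomial_sum_single, ← Matrix.det_diagonal]
    refine HasInitial.det _ fun a c => ?_
    have e : (weightOf (weightAbove l) ((⟨2, by omega⟩ : Fin N), a, c) : ℤ) =
        1 + (a.val - c.val) ^ 2 := weightOf_eq weightAbove_nonneg 2 (show 2 < N by omega) a c
    rw [Matrix.of_apply]
    rcases eq_or_ne a c with rfl | hne
    · rw [Matrix.diagonal_apply_eq]
      have : weightOf (weightAbove l) ((⟨2, by omega⟩ : Fin N), a, a) = 1 := by
        zify; rw [e]; ring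
      have h := HasInitial.X (k := k) (hw := weightOf_ne_zero (N := N) (l := l) (weightAbove l))
        ((⟨2, by omega⟩ : Fin N), a, a)
      rwa [this] at h
    · rw [Matrix.diagonal_apply_ne _ hne]
      refine HasInitial.weaken (HasInitial.X _) ?_
      zify
      rw [e]
      have : (a.val : ℤ) - c.val ≠ 0 := by
        rw [sub_ne_zero]; exact fun h => hne (Fin.ext (by exact_mod_cast h))
      have := pow_pos (abs_pos.2 this) 2
      rw [sq_abs] at this
      linarith
  · intro v hv
    obtain ⟨i, -, hi⟩ := Finset.mem_biUnion.1 (Finsupp.support_finsetSum hv)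
    have := Finset.mem_singleton.1 (Finsupp.support_single_subset hi)
    rw [this]
    exact ⟨rfl, rfl⟩

open Graded in
lemma koszulExact_adjoinElt_det_lastRowOne (hN : 4 ≤ N) (hl : ((l + 1 : ℕ) : k) ≠ 0) :
    KoszulExact (adjoinElt (lastRowOne (polyMatrix k ⟨0, by omega⟩)).det (genericForm k hN l)) := by
  classical
  set r : Fin (l + 1) → ℕ := fun i => if i = Fin.last l then 0 else 1
  set D : Fin (l + 1) → (Fin N × Fin (l + 1) × Fin (l + 1) →₀ ℕ) := fun i =>
    if i = Fin.last l then 0 else Finsupp.single (⟨0, by omega⟩, i, i) 1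
  refine exists_koszulExact_weightBelow hN hl (l + 1) (e := ∑ i : Fin (l + 1), r i)
    (MvPolynomial.IsHomogeneous.det _ fun i j => ?_)
    (s := ∑ i : Fin (l + 1), D i)
    (d := ∑ i : Fin (l + 1), r i) ?_ ?_
  · rcases eq_or_ne i (Fin.last l) with rfl | hi
    · simp only [lastRowOne, Matrix.updateRow_self, r, if_true]
      rcases eq_or_ne j (Fin.last l) with rfl | hj
      · rw [Pi.single_eq_same]; exact MvPolynomial.isHomogeneous_one _ _
      · rw [Pi.single_eq_of_ne hj]; exact MvPolynomial.isHomogeneous_zero _ _ _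
    · simp only [lastRowOne, Matrix.updateRow_ne hi, r, if_neg hi]
      exact MvPolynomial.isHomogeneous_X k _
  · have hdet : (((lastRowOne (polyMatrix (N := N) (n := l + 1) k ⟨0, by omega⟩)).det :
        MvPolynomial _ k) : MvPowerSeries _ k) = (lastRowOne (Matrix.of fun a c : Fin (l + 1) =>
          (MvPowerSeries.X ((⟨0, by omega⟩ : Fin N), a, c) : MvPowerSeries _ k))).det := by
      rw [← MvPolynomial.coeToMvPowerSeries.ringHom_apply, RingHom.map_det]
      congr 1
      ext a c : 2
      rcases eq_or_ne a (Fin.last l) with rfl | ha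
      · simp only [lastRowOne, RingHom.mapMatrix_apply, Matrix.map_apply, Matrix.updateRow_self]
        rcases eq_or_ne c (Fin.last l) with rfl | hj
        · simp
        · simp [hj]
      · simp [lastRowOne, Matrix.updateRow_ne ha, polyMatrix]
    rw [hdet, MvPolynomial.monomial_sum_one, ← Matrix.det_diagonal]
    refine HasInitial.det _ fun a c => ?_
    have e : (weightOf (weightBelow l (l + 1)) ((⟨0, by omega⟩ : Fin N), a, c) : ℤ) =
        1 + (a.val + (if ((l + 1 : ℕ) : ℤ) ≤ a.val then 1 else 0) - c.val) ^ 2 :=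
      weightOf_eq (weightBelow_nonneg (l + 1)) 0 (show 0 < N by omega) a c
    rw [if_neg (by have := a.isLt; omega), add_zero] at e
    rcases eq_or_ne a (Fin.last l) with rfl | ha
    · simp only [lastRowOne, Matrix.updateRow_self, r, D, if_true]
      rcases eq_or_ne c (Fin.last l) with rfl | hc
      · rw [Pi.single_eq_same, Matrix.diagonal_apply_eq, if_pos rfl]
        have := HasInitial.C
          (hw := weightOf_ne_zero (N := N) (l := l) (weightBelow l (l + 1))) (1 : k)
        simpa using this
      · rw [Pi.single_eq_of_ne hc, Matrix.diagonal_apply_ne _ hc.symm]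
        exact HasInitial.zero _
    · simp only [lastRowOne, Matrix.updateRow_ne ha, r, D, if_neg ha, Matrix.of_apply]
      rcases eq_or_ne a c with rfl | hne
      · rw [Matrix.diagonal_apply_eq, if_neg ha]
        have : weightOf (weightBelow l (l + 1)) ((⟨0, by omega⟩ : Fin N), a, a) = 1 := by
          zify; rw [e]; ring
        have h := HasInitial.X (k := k)
          (hw := weightOf_ne_zero (N := N) (l := l) (weightBelow l (l + 1)))
          ((⟨0, by omega⟩ : Fin N), a, a)
        rwa [this] at h
      · rw [Matrix.diagonal_apply_ne _ hne]
        refine HasInitial.weaken (HasInitial.X _) ?_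
        zify
        rw [e]
        have : (a.val : ℤ) - c.val ≠ 0 := by
          rw [sub_ne_zero]; exact fun h => hne (Fin.ext (by exact_mod_cast h))
        have := pow_pos (abs_pos.2 this) 2
        rw [sq_abs] at this
        linarith
  · intro v hv
    obtain ⟨i, -, hi⟩ := Finset.mem_biUnion.1 (Finsupp.support_finsetSum hv)
    rcases eq_or_ne i (Fin.last l) with rfl | hil
    · simp [D] at hi
    · simp only [D, if_neg hil] at hi
      have := Finset.mem_singleton.1 (Finsupp.support_single_subset hi)
      rw [this]
      exact Or.inl ⟨Nat.lt_succ_self l, rfl, Fin.val_lt_last hil, rfl⟩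

end Weights

section Denominators

variable {D Q : Type*} [CommRing D] [CommRing Q]

/-- The elements of `Q` which are fractions of elements in the image of `s : D →+* Q`. -/
def fractionSubring (s : D →+* Q) : Subring Q where
  carrier := {q | ∃ d b, s d ∈ nonZeroDivisors Q ∧ s d * q = s b}
  mul_mem' := by
    rintro x y ⟨d, b, hd, h⟩ ⟨d', b', hd', h'⟩
    refine ⟨d * d', b * b', by rw [map_mul]; exact mul_mem hd hd', ?_⟩
    rw [map_mul, map_mul, ← h, ← h']; ring
  one_mem' := ⟨1, 1, by rw [map_one]; exact one_mem _, by simp⟩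
  add_mem' := by
    rintro x y ⟨d, b, hd, h⟩ ⟨d', b', hd', h'⟩
    refine ⟨d * d', b * d' + d * b', by rw [map_mul]; exact mul_mem hd hd', ?_⟩
    rw [map_mul, map_add, map_mul, map_mul, ← h, ← h']; ring
  zero_mem' := ⟨1, 0, by rw [map_one]; exact one_mem _, by simp⟩
  neg_mem' := by
    rintro x ⟨d, b, hd, h⟩
    exact ⟨d, -b, hd, by rw [map_neg, ← h]; ring⟩

lemma map_mem_fractionSubring (s : D →+* Q) (d : D) : s d ∈ fractionSubring s :=
  ⟨1, d, by rw [map_one]; exact one_mem _, by simp⟩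

lemma mem_fractionSubring_of_mul_mem {s : D →+* Q} {x y : Q} (hy : y ∈ fractionSubring s)
    (hy' : y ∈ nonZeroDivisors Q) (h : y * x ∈ fractionSubring s) : x ∈ fractionSubring s := by
  obtain ⟨d, b, hd, hb⟩ := hy
  obtain ⟨d', b', hd', hb'⟩ := h
  refine ⟨d' * b, d * b', ?_, ?_⟩
  · rw [map_mul, ← hb]
    exact mul_mem hd' (mul_mem hd hy')
  · rw [map_mul, map_mul, ← hb, ← hb']; ring

lemma isDomain_of_fractionSubring_eq_top {E : Type*} [CommRing E] [IsDomain E] (s : D →+* Q)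
    (e : Q →+* E) (he : ∀ d, e (s d) = 0 → s d = 0) (hs : fractionSubring s = ⊤) : IsDomain Q := by
  have : Nontrivial Q := e.domain_nontrivial
  have : NoZeroDivisors Q := by
    refine ⟨fun {x y} hxy => ?_⟩
    obtain ⟨d, b, hd, hb⟩ : x ∈ fractionSubring s := hs ▸ Subring.mem_top x
    obtain ⟨d', b', hd', hb'⟩ : y ∈ fractionSubring s := hs ▸ Subring.mem_top y
    have h0 : e (s b) * e (s b') = 0 := by
      rw [← map_mul, ← hb, ← hb', show s d * x * (s d' * y) = s d * s d' * (x * y) by ring, hxy,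
        mul_zero, map_zero]
    rcases mul_eq_zero.1 h0 with h | h
    · rw [he _ h] at hb
      exact Or.inl ((mul_left_mem_nonZeroDivisors_eq_zero_iff hd).1 hb)
    · rw [he _ h] at hb'
      exact Or.inr ((mul_left_mem_nonZeroDivisors_eq_zero_iff hd').1 hb')
  exact NoZeroDivisors.to_isDomain Q

end Denominators

lemma map_lastRowOne {R S : Type*} [CommRing R] [CommRing S] {l : ℕ} (f : R →+* S)
    (X : Matrix (Fin (l + 1)) (Fin (l + 1)) R) :
    (lastRowOne X).map f = lastRowOne (X.map f) := by
  ext a c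
  rcases eq_or_ne a (Fin.last l) with rfl | ha
  · simp only [lastRowOne, Matrix.map_apply, Matrix.updateRow_self]
    rcases eq_or_ne c (Fin.last l) with rfl | hc
    · simp
    · simp [hc]
  · simp [lastRowOne, Matrix.updateRow_ne ha]

lemma lastRowOne_mul_of_ne {R : Type*} [CommRing R] {l : ℕ}
    (X Y : Matrix (Fin (l + 1)) (Fin (l + 1)) R) {a : Fin (l + 1)} (ha : a ≠ Fin.last l)
    (b : Fin (l + 1)) : (lastRowOne X * Y) a b = (X * Y) a b := by
  simp [Matrix.mul_apply, lastRowOne, Matrix.updateRow_ne ha]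

section Assemble

variable {k R : Type*} [CommRing k] [CommRing R] [Algebra k R] {N n : ℕ}

/-- A point given by four matrices and arbitrary further coordinates. -/
def assemble (X Y Z W : Matrix (Fin n) (Fin n) R) (f : Fin N × Fin n × Fin n → R)
    (v : Fin N × Fin n × Fin n) : R :=
  if v.1.val = 0 then X v.2.1 v.2.2 else if v.1.val = 1 then Y v.2.1 v.2.2 else
  if v.1.val = 2 then Z v.2.1 v.2.2 else if v.1.val = 3 then W v.2.1 v.2.2 else f v

variable (X Y Z W : Matrix (Fin n) (Fin n) R) (f : Fin N × Fin n × Fin n → R)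

lemma map_polyMatrix_assemble₀ (h : 0 < N) :
    (polyMatrix k ⟨0, h⟩).map (MvPolynomial.aeval (R := k) (assemble X Y Z W f)) = X := by
  ext a b; simp [polyMatrix, assemble]

lemma map_polyMatrix_assemble₁ (h : 1 < N) :
    (polyMatrix k ⟨1, h⟩).map (MvPolynomial.aeval (R := k) (assemble X Y Z W f)) = Y := by
  ext a b; simp [polyMatrix, assemble]

lemma map_polyMatrix_assemble₂ (h : 2 < N) :
    (polyMatrix k ⟨2, h⟩).map (MvPolynomial.aeval (R := k) (assemble X Y Z W f)) = Z := by
  ext a b; simp [polyMatrix, assemble]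

lemma map_polyMatrix_assemble₃ (h : 3 < N) :
    (polyMatrix k ⟨3, h⟩).map (MvPolynomial.aeval (R := k) (assemble X Y Z W f)) = W := by
  ext a b; simp [polyMatrix, assemble]

lemma aeval_assemble_X {v : Fin N × Fin n × Fin n} (h : 4 ≤ v.1.val) :
    MvPolynomial.aeval (R := k) (assemble X Y Z W f) (MvPolynomial.X v) = f v := by
  rw [MvPolynomial.aeval_X, assemble, if_neg (by omega), if_neg (by omega), if_neg (by omega),
    if_neg (by omega)]

lemma forall_index (hN : 4 ≤ N) {P : Fin N → Prop} (h0 : P ⟨0, by omega⟩) (h1 : P ⟨1, by omega⟩)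
    (h2 : P ⟨2, by omega⟩) (h3 : P ⟨3, by omega⟩) (h4 : ∀ i : Fin N, 4 ≤ i.val → P i) (i : Fin N) :
    P i := by
  rcases i with ⟨i, hi⟩
  match i, hi with
  | 0, _ => exact h0
  | 1, _ => exact h1
  | 2, _ => exact h2
  | 3, _ => exact h3
  | i + 4, hi => exact h4 ⟨i + 4, hi⟩ (by simp)

end Assemble

section Prime

variable {k : Type*} [Field k] {N l : ℕ}

/-- A section up to birational equivalence of the quotient by the forms `leadForm`: its image is
a polynomial ring over which the quotient is birational. -/
def rationalSection {Q : Type*} [CommRing Q] [Algebra k Q]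
    (X Y Z W : Matrix (Fin (l + 1)) (Fin (l + 1)) Q) (f : Fin N × Fin (l + 1) × Fin (l + 1) → Q) :
    MvPolynomial (Fin N × Fin (l + 1) × Fin (l + 1)) k →ₐ[k] Q :=
  MvPolynomial.aeval (assemble (X.updateRow (Fin.last l) 0) (lastRowOne X * Y) Z (Z * W) f)

lemma lastRowOne_updateRow {R : Type*} [CommRing R] (X : Matrix (Fin (l + 1)) (Fin (l + 1)) R)
    (v : Fin (l + 1) → R) : lastRowOne (X.updateRow (Fin.last l) v) = lastRowOne X := by
  simp [lastRowOne]

lemma leadForm_of_lt {R : Type*} [CommRing R] {X Y Z W : Matrix (Fin (l + 1)) (Fin (l + 1)) R}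
    {a b : Fin (l + 1)} (h : a < b) : leadForm X Y Z W (a, b) = (X * Y) a b := by
  simp [leadForm, h]

lemma leadForm_of_gt {R : Type*} [CommRing R] {X Y Z W : Matrix (Fin (l + 1)) (Fin (l + 1)) R}
    {a b : Fin (l + 1)} (h : b < a) : leadForm X Y Z W (a, b) = (Z * W) a b := by
  simp [leadForm, h, h.le]

lemma leadForm_last {R : Type*} [CommRing R] {X Y Z W : Matrix (Fin (l + 1)) (Fin (l + 1)) R} :
    leadForm X Y Z W (Fin.last l, Fin.last l) =
      ((l + 1 : ℕ) : R) * X (Fin.last l) (Fin.last l) := by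
  simp [leadForm]

lemma leadForm_diag {R : Type*} [CommRing R] {X Y Z W : Matrix (Fin (l + 1)) (Fin (l + 1)) R}
    {a : Fin (l + 1)} (h : a ≠ Fin.last l) : leadForm X Y Z W (a, a) =
      (X * Y) a a + (Z * W - W * Z) a a -
        ∑ c ∈ Finset.univ.erase (Fin.last l), Y a c * X c a -
        Y a (Fin.last l) * X (Fin.last l) a := by
  have : (Y * X) a a = Y a (Fin.last l) * X (Fin.last l) a +
      ∑ c ∈ Finset.univ.erase (Fin.last l), Y a c * X c a := by
    rw [Matrix.mul_apply]
    exact (Finset.add_sum_erase _ (fun c => Y a c * X c a) (Finset.mem_univ _)).symm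
  simp only [leadForm, lt_irrefl, if_false, h, Matrix.add_apply, Matrix.sub_apply, this]
  ring

lemma fractionSubring_rationalSection (hN : 4 ≤ N) (hl : ((l + 1 : ℕ) : k) ≠ 0)
    {Q : Type*} [CommRing Q] [Algebra k Q]
    {X Y Z W : Matrix (Fin (l + 1)) (Fin (l + 1)) Q} {f : Fin N × Fin (l + 1) × Fin (l + 1) → Q}
    (hf : Function.Surjective (MvPolynomial.aeval (R := k) (assemble X Y Z W f)))
    (h : ∀ p, leadForm X Y Z W p = 0)
    (hX : (lastRowOne X).det ∈ nonZeroDivisors Q) (hZ : Z.det ∈ nonZeroDivisors Q)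
    (hY : ∀ j, j ≠ Fin.last l → Y j (Fin.last l) ∈ nonZeroDivisors Q) :
    fractionSubring (rationalSection (k := k) X Y Z W f).toRingHom = ⊤ := by
  set s := rationalSection (k := k) X Y Z W f with hs
  set G := fractionSubring s.toRingHom with hG
  have hsG : ∀ d, s d ∈ G := map_mem_fractionSubring s.toRingHom
  have hM : ∀ (i : Fin N) a b, ((polyMatrix k i).map s) a b ∈ G := fun i a b => hsG _
  have s0 : (polyMatrix k ⟨0, by omega⟩).map s = X.updateRow (Fin.last l) 0 :=
    map_polyMatrix_assemble₀ (N := N) ..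
  have s1 : (polyMatrix k ⟨1, by omega⟩).map s = lastRowOne X * Y :=
    map_polyMatrix_assemble₁ (N := N) ..
  have s2 : (polyMatrix k ⟨2, by omega⟩).map s = Z := map_polyMatrix_assemble₂ (N := N) ..
  have s3 : (polyMatrix k ⟨3, by omega⟩).map s = Z * W := map_polyMatrix_assemble₃ (N := N) ..
  have hXG : ∀ a b, a ≠ Fin.last l → X a b ∈ G := by
    intro a b ha
    have := hM ⟨0, by omega⟩ a b
    rwa [s0, Matrix.updateRow_ne ha] at this
  have hZG : ∀ a b, Z a b ∈ G := by
    intro a b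
    have := hM ⟨2, by omega⟩ a b
    rwa [s2] at this
  have hT : (lastRowOne (polyMatrix (N := N) k ⟨0, by omega⟩)).map s.toRingHom = lastRowOne X := by
    rw [map_lastRowOne]
    exact (congrArg lastRowOne s0).trans (lastRowOne_updateRow _ _)
  have hdiv : ∀ (P : Matrix (Fin (l + 1)) (Fin (l + 1))
      (MvPolynomial (Fin N × Fin (l + 1) × Fin (l + 1)) k))
      (V : Matrix (Fin (l + 1)) (Fin (l + 1)) Q),
      (P.map s.toRingHom).det ∈ nonZeroDivisors Q →
      (∀ a b, (P.map s.toRingHom * V) a b ∈ G) → ∀ a b, V a b ∈ G := by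
    intro P V hP hV a b
    have hdet : (P.map s.toRingHom).det = s P.det :=
      (RingHom.map_det s.toRingHom P).symm
    refine mem_fractionSubring_of_mul_mem (y := (P.map s.toRingHom).det) ?_ hP ?_
    · rw [hdet]; exact hsG _
    · have : (P.map s.toRingHom).det * V a b =
          (P.adjugate.map s.toRingHom * (P.map s.toRingHom * V)) a b := by
        have h1 : P.adjugate.map s.toRingHom = (P.map s.toRingHom).adjugate :=
          RingHom.map_adjugate s.toRingHom P
        rw [h1, ← Matrix.mul_assoc, Matrix.adjugate_mul, Matrix.smul_mul, Matrix.one_mul,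
          Matrix.smul_apply, smul_eq_mul]
      rw [this, Matrix.mul_apply]
      exact sum_mem fun c _ => mul_mem (hsG _) (hV c b)
  have hYG : ∀ a b, Y a b ∈ G := by
    refine hdiv (lastRowOne (polyMatrix k ⟨0, by omega⟩)) Y (by rwa [hT]) ?_
    rw [hT, ← s1]
    exact hM _
  have hWG : ∀ a b, W a b ∈ G := by
    have e : (polyMatrix k ⟨2, by omega⟩).map s.toRingHom = Z := s2
    refine hdiv (polyMatrix k ⟨2, by omega⟩) W (by rwa [e]) ?_
    rw [e, ← s3]
    exact hM _
  have hXG' : ∀ a b, X a b ∈ G := by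
    intro a b
    rcases eq_or_ne a (Fin.last l) with rfl | ha
    swap
    · exact hXG a b ha
    rcases eq_or_ne b (Fin.last l) with rfl | hb
    · have h0 := h (Fin.last l, Fin.last l)
      rw [leadForm_last] at h0
      have hun : IsUnit ((l + 1 : ℕ) : Q) := by
        rw [← map_natCast (algebraMap k Q)]
        exact (isUnit_iff_ne_zero.2 hl).map _
      rw [(hun.mul_right_eq_zero).1 h0]
      exact zero_mem _
    · have h0 := h (b, b)
      rw [leadForm_diag hb, sub_eq_zero] at h0
      refine mem_fractionSubring_of_mul_mem (hYG b (Fin.last l)) (hY b hb) ?_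
      rw [← h0]
      refine sub_mem (add_mem ?_ ?_) (sum_mem fun c hc => mul_mem (hYG _ _)
        (hXG _ _ (Finset.ne_of_mem_erase hc)))
      · rw [Matrix.mul_apply]
        exact sum_mem fun c _ => mul_mem (hXG _ _ hb) (hYG _ _)
      · rw [Matrix.sub_apply, Matrix.mul_apply, Matrix.mul_apply]
        exact sub_mem (sum_mem fun c _ => mul_mem (hZG _ _) (hWG _ _))
          (sum_mem fun c _ => mul_mem (hWG _ _) (hZG _ _))
  rw [eq_top_iff]
  rintro q -
  obtain ⟨d, rfl⟩ := hf q
  induction d using MvPolynomial.induction_on with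
  | C c =>
    have := hsG (MvPolynomial.C c)
    rw [hs, rationalSection, MvPolynomial.aeval_C] at this
    rwa [MvPolynomial.aeval_C]
  | add p q hp hq => rw [map_add]; exact add_mem hp hq
  | mul_X p v hp =>
    rw [map_mul]
    refine mul_mem hp ?_
    obtain ⟨i, a, b⟩ := v
    revert i
    refine forall_index hN ?_ ?_ ?_ ?_ fun i hi => ?_
    · rw [MvPolynomial.aeval_X]; exact hXG' a b
    · rw [MvPolynomial.aeval_X]; exact hYG a b
    · rw [MvPolynomial.aeval_X]; exact hZG a b
    · rw [MvPolynomial.aeval_X]; exact hWG a b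
    · have := hsG (MvPolynomial.X (i, a, b))
      rw [hs, rationalSection, aeval_assemble_X _ _ _ _ _ hi] at this
      rwa [aeval_assemble_X _ _ _ _ _ hi]

/-- The polynomial ring endomorphism killing the pivot variables. -/
def killPivots (k : Type*) [Field k] (hN : 4 ≤ N) (l : ℕ) :
    MvPolynomial (Fin N × Fin (l + 1) × Fin (l + 1)) k →ₐ[k]
      MvPolynomial (Fin N × Fin (l + 1) × Fin (l + 1)) k :=
  MvPolynomial.aeval (assemble ((polyMatrix k ⟨0, by omega⟩).updateRow (Fin.last l) 0)
    (Matrix.of fun a b => if b ≤ a then polyMatrix k ⟨1, by omega⟩ a b else 0)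
    (polyMatrix k ⟨2, by omega⟩)
    (Matrix.of fun a b => if a ≤ b then polyMatrix k ⟨3, by omega⟩ a b else 0)
    MvPolynomial.X)

lemma rationalSection_comp_killPivots (hN : 4 ≤ N)
    {Q : Type*} [CommRing Q] [Algebra k Q]
    {X Y Z W : Matrix (Fin (l + 1)) (Fin (l + 1)) Q} {f : Fin N × Fin (l + 1) × Fin (l + 1) → Q}
    (h : ∀ p, leadForm X Y Z W p = 0) :
    (rationalSection (k := k) X Y Z W f).comp (killPivots k hN l) =
      rationalSection (k := k) X Y Z W f := by
  set s := rationalSection (k := k) X Y Z W f with hs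
  have s1 : (polyMatrix k ⟨1, by omega⟩).map s = lastRowOne X * Y :=
    map_polyMatrix_assemble₁ (N := N) ..
  have s3 : (polyMatrix k ⟨3, by omega⟩).map s = Z * W := map_polyMatrix_assemble₃ (N := N) ..
  refine MvPolynomial.algHom_ext fun v => ?_
  rw [AlgHom.comp_apply, killPivots, MvPolynomial.aeval_X]
  obtain ⟨i, a, b⟩ := v
  revert i
  refine forall_index hN ?_ ?_ ?_ ?_ fun i hi => ?_
  · rcases eq_or_ne a (Fin.last l) with rfl | ha
    · simp [assemble, hs, rationalSection]
    · simp [assemble, Matrix.updateRow_ne ha, polyMatrix]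
  · simp only [assemble, one_ne_zero, if_false, if_true, Matrix.of_apply]
    split_ifs with hab
    · rfl
    · have := congrFun (congrFun s1 a) b
      rw [map_zero]
      refine (Eq.trans this ?_).symm
      have hab := not_le.1 hab
      rw [lastRowOne_mul_of_ne _ _ (hab.trans_le (Fin.le_last b)).ne, ← leadForm_of_lt hab, h]
  · simp [assemble, polyMatrix]
  · simp only [assemble, show (3 : ℕ) ≠ 0 by decide, show (3 : ℕ) ≠ 1 by decide,
      show (3 : ℕ) ≠ 2 by decide, if_false, if_true, Matrix.of_apply]
    split_ifs with hab
    · rfl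
    · have := congrFun (congrFun s3 a) b
      rw [map_zero]
      refine (Eq.trans this ?_).symm
      rw [← leadForm_of_gt (not_le.1 hab), h]
  · simp only [assemble]
    rw [if_neg (by omega), if_neg (by omega), if_neg (by omega), if_neg (by omega)]


lemma eval_det_ne_zero {R S n : Type*} [CommRing R] [CommRing S] [Fintype n] [DecidableEq n]
    (f : R →+* S) {M : Matrix n n R} (h : (M.map f).det ≠ 0) : M.det ≠ 0 := by
  intro h0
  exact h (by rw [← RingHom.mapMatrix_apply, ← RingHom.map_det, h0, map_zero])

lemma det_polyMatrix_ne_zero (i : Fin N) : (polyMatrix (n := l + 1) k i).det ≠ 0 := by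
  refine eval_det_ne_zero (MvPolynomial.eval fun v => (1 : Matrix _ _ k) v.2.1 v.2.2) ?_
  have : (polyMatrix (n := l + 1) k i).map
      (MvPolynomial.eval fun v => (1 : Matrix _ _ k) v.2.1 v.2.2) = 1 := by
    ext a b; simp [polyMatrix]
  rw [this, Matrix.det_one]
  exact one_ne_zero

lemma map_eval_lastRowOne (i : Fin N) (M : Matrix (Fin (l + 1)) (Fin (l + 1)) k)
    (hM : lastRowOne M = M) : (lastRowOne (polyMatrix (n := l + 1) k i)).map
      (MvPolynomial.eval fun v => M v.2.1 v.2.2) = M := by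
  rw [map_lastRowOne]
  conv_rhs => rw [← hM]
  congr 1
  ext a b; simp [polyMatrix]

lemma lastRowOne_transvection {R : Type*} [CommRing R] {a : Fin (l + 1)} (ha : a ≠ Fin.last l)
    (c : R) : lastRowOne (Matrix.transvection a (Fin.last l) c) =
      Matrix.transvection a (Fin.last l) c := by
  ext i j
  rcases eq_or_ne i (Fin.last l) with rfl | hi
  · simp [lastRowOne, Matrix.transvection, Matrix.single, ha, Matrix.one_apply, Pi.single_apply,
      eq_comm]
  · simp [lastRowOne, Matrix.updateRow_ne hi]

lemma adjugate_lastRowOne_ne_zero (i : Fin N) {a : Fin (l + 1)} (ha : a ≠ Fin.last l) :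
    (lastRowOne (polyMatrix (n := l + 1) k i)).adjugate a (Fin.last l) ≠ 0 := by
  intro h
  set M := Matrix.transvection a (Fin.last l) (1 : k)
  have h1 := map_eval_lastRowOne i M (lastRowOne_transvection ha _)
  have h2 : M.adjugate a (Fin.last l) = 0 := by
    rw [← h1, ← RingHom.mapMatrix_apply, ← RingHom.map_adjugate, RingHom.mapMatrix_apply,
      Matrix.map_apply, h, map_zero]
  have h3 : M.adjugate = Matrix.transvection a (Fin.last l) (-1) := by
    have hd : M.det = 1 := Matrix.det_transvection_of_ne _ _ ha _
    have := M.adjugate_mul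
    rw [hd, one_smul] at this
    calc M.adjugate = M.adjugate * (M * Matrix.transvection a (Fin.last l) (-1)) := by
          rw [Matrix.transvection_mul_transvection_same (h := ha)]; simp
      _ = _ := by rw [← Matrix.mul_assoc, this, Matrix.one_mul]
  rw [h3] at h2
  simp [Matrix.transvection, ha] at h2

lemma det_lastRowOne_ne_zero (i : Fin N) :
    (lastRowOne (polyMatrix (n := l + 1) k i)).det ≠ 0 := by
  refine eval_det_ne_zero (MvPolynomial.eval fun v => (1 : Matrix _ _ k) v.2.1 v.2.2) ?_
  rw [map_eval_lastRowOne, Matrix.det_one]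
  · exact one_ne_zero
  · ext i j
    rcases eq_or_ne i (Fin.last l) with rfl | hi
    · simp [lastRowOne, Matrix.one_apply, Pi.single_apply, eq_comm]
    · simp [lastRowOne, Matrix.updateRow_ne hi]

/-- A generic point of the scheme defined by the forms `leadForm`. -/
lemma exists_generic_point (hN : 4 ≤ N) {E : Type*} [Field E] [Algebra k E]
    (j : MvPolynomial (Fin N × Fin (l + 1) × Fin (l + 1)) k →ₐ[k] E)
    (hj : Function.Injective j) :
    ∃ X Y Z W : Matrix (Fin (l + 1)) (Fin (l + 1)) E, (∀ p, leadForm X Y Z W p = 0) ∧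
      rationalSection (k := k) X Y Z W (fun v => j (MvPolynomial.X v)) =
        j.comp (killPivots k hN l) := by
  have hj0 : ∀ {x}, x ≠ 0 → j x ≠ 0 := fun h => (map_ne_zero_iff j hj).2 h
  have hdet : ∀ M : Matrix (Fin (l + 1)) (Fin (l + 1))
      (MvPolynomial (Fin N × Fin (l + 1) × Fin (l + 1)) k), (M.map j).det = j M.det := fun M =>
    (RingHom.map_det j.toRingHom M).symm
  set P : Fin N → Matrix (Fin (l + 1)) (Fin (l + 1)) E := fun i => (polyMatrix k i).map j with hP
  set T := (lastRowOne (polyMatrix k ⟨0, by omega⟩)).map j with hTdef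
  have hTP : T = lastRowOne (P ⟨0, by omega⟩) := map_lastRowOne j.toRingHom _
  have hT : T.det ≠ 0 := by rw [hTdef, hdet]; exact hj0 (det_lastRowOne_ne_zero _)
  set Z := P ⟨2, by omega⟩ with hZdef
  have hZ : Z.det ≠ 0 := by rw [hZdef, hP, hdet]; exact hj0 (det_polyMatrix_ne_zero _)
  set A : Matrix (Fin (l + 1)) (Fin (l + 1)) E :=
    Matrix.of fun a b => if b ≤ a then P ⟨1, by omega⟩ a b else 0 with hA
  set B : Matrix (Fin (l + 1)) (Fin (l + 1)) E :=
    Matrix.of fun a b => if a ≤ b then P ⟨3, by omega⟩ a b else 0 with hB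
  set Y := T⁻¹ * A with hY
  set W := Z⁻¹ * B with hW
  have hTY : T * Y = A := Matrix.mul_nonsing_inv_cancel_left _ _ (isUnit_iff_ne_zero.2 hT)
  have hZW : Z * W = B := Matrix.mul_nonsing_inv_cancel_left _ _ (isUnit_iff_ne_zero.2 hZ)
  have hYne : ∀ a, a ≠ Fin.last l → Y a (Fin.last l) ≠ 0 := by
    intro a ha
    have : Y a (Fin.last l) =
        T⁻¹ a (Fin.last l) * P ⟨1, by omega⟩ (Fin.last l) (Fin.last l) := by
      rw [hY, Matrix.mul_apply, Finset.sum_eq_single (Fin.last l)]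
      · simp [hA]
      · intro c _ hc
        rw [hA, Matrix.of_apply, if_neg, mul_zero]
        exact fun h => hc (le_antisymm (Fin.le_last c) h)
      · simp
    rw [this]
    refine mul_ne_zero ?_ (hj0 (MvPolynomial.X_ne_zero _))
    rw [Matrix.inv_def, Matrix.smul_apply, smul_eq_mul, Ring.inverse_eq_inv]
    refine mul_ne_zero (inv_ne_zero hT) ?_
    have : T.adjugate = (lastRowOne (polyMatrix k ⟨0, by omega⟩)).adjugate.map j :=
      (RingHom.map_adjugate j.toRingHom _).symm
    rw [this]
    exact hj0 (adjugate_lastRowOne_ne_zero _ ha)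
  set S : Fin (l + 1) → E := fun a => ((T * Y) a a + (Z * W - W * Z) a a -
        ∑ c ∈ Finset.univ.erase (Fin.last l), Y a c * P ⟨0, by omega⟩ c a) with hS
  set X := (P ⟨0, by omega⟩).updateRow (Fin.last l)
    (fun a => if a = Fin.last l then 0 else S a / Y a (Fin.last l)) with hX
  have hXT : lastRowOne X = T := by rw [hX, lastRowOne_updateRow, hTP]
  refine ⟨X, Y, Z, W, ?_, ?_⟩
  · rintro ⟨a, b⟩
    rcases lt_trichotomy a b with h | rfl | h
    · rw [leadForm_of_lt h, ← lastRowOne_mul_of_ne _ _ (h.trans_le (Fin.le_last b)).ne, hXT, hTY,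
        hA, Matrix.of_apply, if_neg h.not_ge]
    · rcases eq_or_ne a (Fin.last l) with rfl | ha
      · rw [leadForm_last, hX, Matrix.updateRow_self, if_pos rfl, mul_zero]
      · rw [leadForm_diag ha, ← lastRowOne_mul_of_ne _ _ ha, hXT]
        have h1 : X (Fin.last l) a = S a / Y a (Fin.last l) := by
          rw [hX, Matrix.updateRow_self, if_neg ha]
        have h2 : ∑ c ∈ Finset.univ.erase (Fin.last l), Y a c * X c a =
            ∑ c ∈ Finset.univ.erase (Fin.last l), Y a c * P ⟨0, by omega⟩ c a :=
          Finset.sum_congr rfl fun c hc => by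
            rw [hX, Matrix.updateRow_ne (Finset.ne_of_mem_erase hc)]
        rw [h1, h2, mul_div_cancel₀ _ (hYne a ha), hS, sub_self]
    · rw [leadForm_of_gt h, hZW, hB, Matrix.of_apply, if_neg h.not_ge]
  · refine MvPolynomial.algHom_ext fun v => ?_
    rw [AlgHom.comp_apply, killPivots, MvPolynomial.aeval_X, rationalSection, MvPolynomial.aeval_X,
      hXT, hTY, hZW]
    simp only [assemble, apply_ite j]
    split_ifs with h0 h1 h2 h3
    · rcases eq_or_ne v.2.1 (Fin.last l) with h | h
      · simp [h]
      · have : v.1 = ⟨0, by omega⟩ := Fin.ext h0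
        simp [Matrix.updateRow_ne h, hX, hP]
    · simp [hA, hP, apply_ite j]
    · simp [hZdef, hP]
    · simp [hB, hP, apply_ite j]
    · rfl

lemma leadForm_congr {R : Type*} [CommRing R]
    {X Y Z W X' Y' Z' W' : Matrix (Fin (l + 1)) (Fin (l + 1)) R} (hX : X = X') (hY : Y = Y')
    (hZ : Z = Z') (hW : W = W') (p : Fin (l + 1) × Fin (l + 1)) :
    leadForm X Y Z W p = leadForm X' Y' Z' W' p := by
  rw [hX, hY, hZ, hW]

lemma comp_rationalSection {Q Q' : Type*} [CommRing Q] [Algebra k Q] [CommRing Q'] [Algebra k Q']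
    (e : Q →ₐ[k] Q') (X Y Z W : Matrix (Fin (l + 1)) (Fin (l + 1)) Q)
    (f : Fin N × Fin (l + 1) × Fin (l + 1) → Q) :
    e.comp (rationalSection (k := k) X Y Z W f) =
      rationalSection (X.map e) (Y.map e) (Z.map e) (W.map e) (fun v => e (f v)) := by
  refine MvPolynomial.algHom_ext fun v => ?_
  have h1 : lastRowOne (X.map e) = (lastRowOne X).map e := (map_lastRowOne e.toRingHom X).symm
  rw [AlgHom.comp_apply, rationalSection, rationalSection, MvPolynomial.aeval_X,
    MvPolynomial.aeval_X, h1]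
  simp only [assemble, apply_ite e, Matrix.mul_apply, Matrix.map_apply, map_sum, map_mul]
  congr 1
  rcases eq_or_ne v.2.1 (Fin.last l) with h | h
  · simp [h]
  · simp [Matrix.updateRow_ne h]

theorem isPrime_span_genericForm (hN : 4 ≤ N) (hl : ((l + 1 : ℕ) : k) ≠ 0) :
    (Ideal.span (Set.range (genericForm k hN l))).IsPrime := by
  set J := Ideal.span (Set.range (genericForm k hN l)) with hJ
  set π := Ideal.Quotient.mkₐ k J with hπ
  have hreg : ∀ u, KoszulExact (adjoinElt u (genericForm k hN l)) →
      π u ∈ nonZeroDivisors (_ ⧸ J) := by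
    intro u hu
    rw [mem_nonZeroDivisors_iff_right]
    intro x hx
    obtain ⟨x, rfl⟩ := Ideal.Quotient.mkₐ_surjective k J x
    rw [← map_mul] at hx
    refine (Ideal.Quotient.eq_zero_iff_mem).2 (hu.mem_of_mul_mem ?_)
    rw [mul_comm]
    exact Ideal.Quotient.eq_zero_iff_mem.1 hx
  set P : Fin N → Matrix (Fin (l + 1)) (Fin (l + 1)) (_ ⧸ J) := fun i => (polyMatrix k i).map π
    with hP
  have hrel : ∀ p, leadForm (P ⟨0, by omega⟩) (P ⟨1, by omega⟩) (P ⟨2, by omega⟩)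
      (P ⟨3, by omega⟩) p = 0 := fun p =>
    (map_leadForm π.toRingHom _ _ _ _ p).symm.trans
      (Ideal.Quotient.eq_zero_iff_mem.2 (Ideal.subset_span ⟨p, rfl⟩))
  have hπa : MvPolynomial.aeval (assemble (P ⟨0, by omega⟩) (P ⟨1, by omega⟩) (P ⟨2, by omega⟩)
      (P ⟨3, by omega⟩) fun v => π (MvPolynomial.X v)) = π := by
    refine MvPolynomial.algHom_ext fun v => ?_
    rw [MvPolynomial.aeval_X]
    obtain ⟨i, a, b⟩ := v
    revert i
    refine forall_index hN rfl rfl rfl rfl fun i hi => ?_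
    rw [assemble, if_neg (show ¬ i.val = 0 by omega), if_neg (show ¬ i.val = 1 by omega),
      if_neg (show ¬ i.val = 2 by omega), if_neg (show ¬ i.val = 3 by omega)]
  have hdet : ∀ M : Matrix (Fin (l + 1)) (Fin (l + 1))
      (MvPolynomial (Fin N × Fin (l + 1) × Fin (l + 1)) k), (M.map π).det = π M.det := fun M =>
    (RingHom.map_det π.toRingHom M).symm
  have htop := fractionSubring_rationalSection (k := k) hN hl (f := fun v => π (MvPolynomial.X v))
    (by rw [hπa]; exact Ideal.Quotient.mkₐ_surjective k J) hrel ?_ ?_ ?_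
  rotate_left
  · have : lastRowOne (P ⟨0, by omega⟩) = (lastRowOne (polyMatrix k ⟨0, by omega⟩)).map π :=
      (map_lastRowOne π.toRingHom _).symm
    rw [this, hdet]
    exact hreg _ (koszulExact_adjoinElt_det_lastRowOne hN hl)
  · rw [hP, hdet]
    exact hreg _ (koszulExact_adjoinElt_det hN hl)
  · exact fun j hj => hreg _ (koszulExact_adjoinElt_X hN hl j hj)
  set D := MvPolynomial (Fin N × Fin (l + 1) × Fin (l + 1)) k
  set j : D →ₐ[k] FractionRing D := IsScalarTower.toAlgHom k D (FractionRing D)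
  have hj : Function.Injective j := IsFractionRing.injective D (FractionRing D)
  obtain ⟨X, Y, Z, W, hXYZW, hcomp⟩ := exists_generic_point hN j hj
  set φ : D →ₐ[k] FractionRing D :=
    MvPolynomial.aeval (assemble X Y Z W fun v => j (MvPolynomial.X v)) with hφ
  have e0 : (polyMatrix k ⟨0, by omega⟩).map φ = X := map_polyMatrix_assemble₀ (N := N) ..
  have e1 : (polyMatrix k ⟨1, by omega⟩).map φ = Y := map_polyMatrix_assemble₁ (N := N) ..
  have e2 : (polyMatrix k ⟨2, by omega⟩).map φ = Z := map_polyMatrix_assemble₂ (N := N) ..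
  have e3 : (polyMatrix k ⟨3, by omega⟩).map φ = W := map_polyMatrix_assemble₃ (N := N) ..
  have hφJ : J ≤ RingHom.ker φ := by
    rw [hJ, Ideal.span_le]
    rintro _ ⟨p, rfl⟩
    exact (map_leadForm φ.toRingHom _ _ _ _ p).trans
      ((leadForm_congr e0 e1 e2 e3 p).trans (hXYZW p))
  set e := Ideal.Quotient.liftₐ J φ fun x hx => hφJ hx
  set s := rationalSection (k := k) (P ⟨0, by omega⟩) (P ⟨1, by omega⟩) (P ⟨2, by omega⟩)
      (P ⟨3, by omega⟩) fun v => π (MvPolynomial.X v) with hs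
  have hes : e.comp s = j.comp (killPivots k hN l) := by
    rw [← hcomp, hs, comp_rationalSection]
    have h0 : (P ⟨0, by omega⟩).map e = X := e0
    have h1 : (P ⟨1, by omega⟩).map e = Y := e1
    have h2 : (P ⟨2, by omega⟩).map e = Z := e2
    have h3 : (P ⟨3, by omega⟩).map e = W := e3
    rw [h0, h1, h2, h3]
    refine MvPolynomial.algHom_ext fun v => ?_
    rw [rationalSection, rationalSection, MvPolynomial.aeval_X, MvPolynomial.aeval_X]
    obtain ⟨i, a, b⟩ := v
    revert i
    refine forall_index hN rfl rfl rfl rfl fun i hi => ?_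
    simp only [assemble]
    rw [if_neg (show ¬ i.val = 0 by omega), if_neg (show ¬ i.val = 1 by omega),
      if_neg (show ¬ i.val = 2 by omega), if_neg (show ¬ i.val = 3 by omega),
      if_neg (show ¬ i.val = 0 by omega), if_neg (show ¬ i.val = 1 by omega),
      if_neg (show ¬ i.val = 2 by omega), if_neg (show ¬ i.val = 3 by omega)]
    change φ (MvPolynomial.X (i, a, b)) = _
    rw [hφ, aeval_assemble_X _ _ _ _ _ hi]
  have hdom := isDomain_of_fractionSubring_eq_top s.toRingHom e.toRingHom ?_ htop
  · exact (Ideal.Quotient.isDomain_iff_prime J).1 hdom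
  · intro d hd
    have h1 : j (killPivots k hN l d) = 0 := (DFunLike.congr_fun hes d).symm.trans hd
    have h2 : killPivots k hN l d = 0 := hj (h1.trans (map_zero j).symm)
    have h3 := DFunLike.congr_fun (rationalSection_comp_killPivots hN hrel
      (f := fun v => π (MvPolynomial.X v))) d
    rw [AlgHom.comp_apply, h2, map_zero] at h3
    exact h3.symm

end Prime

section MatrixExpansion

variable {T : Type*} [CommRing T] {n : ℕ}

/-- The matrix `M` agrees with `1 + τ ^ 2 • C` modulo `τ ^ 3`. -/
def ModCube (τ : T) (M C : Matrix (Fin n) (Fin n) T) : Prop :=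
  ∃ E : Matrix (Fin n) (Fin n) T, M = 1 + τ ^ 2 • C + τ ^ 3 • E

lemma ModCube.one (τ : T) : ModCube τ (1 : Matrix (Fin n) (Fin n) T) 0 := ⟨0, by simp⟩

lemma ModCube.mul {τ : T} {M M' C C' : Matrix (Fin n) (Fin n) T} (h : ModCube τ M C)
    (h' : ModCube τ M' C') : ModCube τ (M * M') (C + C') := by
  obtain ⟨E, rfl⟩ := h
  obtain ⟨E', rfl⟩ := h'
  refine ⟨E + E' + τ • (C * C') + τ ^ 2 • (C * E' + E * C') + τ ^ 3 • (E * E'), ?_⟩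
  simp only [mul_add, add_mul, smul_mul_assoc, mul_smul_comm, smul_smul, one_mul, mul_one, smul_add]
  module

lemma ModCube.prod_ofFn {τ : T} {m : ℕ} {M C : Fin m → Matrix (Fin n) (Fin n) T}
    (h : ∀ i, ModCube τ (M i) (C i)) : ModCube τ (List.ofFn M).prod (∑ i, C i) := by
  induction m with
  | zero => simpa using ModCube.one τ
  | succ m ih =>
    rw [List.ofFn_succ, List.prod_cons, Fin.sum_univ_succ]
    exact (h 0).mul (ih fun i => h i.succ)

lemma modCube_matComm {τ : T} {A B : Matrix (Fin n) (Fin n) T} (hA : IsUnit (1 + τ • A).det)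
    (hB : IsUnit (1 + τ • B).det) :
    ModCube τ (matComm (1 + τ • A) (1 + τ • B)) (A * B - B * A) := by
  have h1 : (1 + τ • A)⁻¹ = 1 - τ • (A * (1 + τ • A)⁻¹) := by
    have := Matrix.mul_nonsing_inv _ hA
    rw [add_mul, one_mul, smul_mul_assoc] at this
    exact eq_sub_of_add_eq this
  have h2 : (1 + τ • B)⁻¹ = 1 - τ • (B * (1 + τ • B)⁻¹) := by
    have := Matrix.mul_nonsing_inv _ hB
    rw [add_mul, one_mul, smul_mul_assoc] at this
    exact eq_sub_of_add_eq this
  have h3 : (1 + τ • A)⁻¹ * (1 + τ • B)⁻¹ = 1 - τ • (B * (1 + τ • B)⁻¹ +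
      A * ((1 + τ • A)⁻¹ * (1 + τ • B)⁻¹)) := by
    nth_rewrite 1 [h1]
    rw [sub_mul, one_mul, smul_mul_assoc, Matrix.mul_assoc]
    nth_rewrite 1 [h2]
    module
  have h4 : (1 + τ • A) * (1 + τ • B) = (1 + τ • B) * (1 + τ • A) + τ ^ 2 • (A * B - B * A) := by
    simp only [mul_add, add_mul, smul_mul_assoc, mul_smul_comm, one_mul, mul_one]
    module
  refine ⟨-((A * B - B * A) * (B * (1 + τ • B)⁻¹ + A * ((1 + τ • A)⁻¹ * (1 + τ • B)⁻¹))), ?_⟩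
  have h5 : (1 + τ • B) * (1 + τ • A) * ((1 + τ • A)⁻¹ * (1 + τ • B)⁻¹) = 1 := by
    rw [Matrix.mul_assoc, ← Matrix.mul_assoc (1 + τ • A), Matrix.mul_nonsing_inv _ hA,
      Matrix.one_mul, Matrix.mul_nonsing_inv _ hB]
  rw [matComm, Matrix.mul_assoc, h4, add_mul, h5, smul_mul_assoc]
  nth_rewrite 1 [h3]
  rw [mul_sub, mul_one, mul_smul_comm]
  module

lemma modCube_pow {p : ℕ} [Fact p.Prime] [CharP T p] {l s : ℕ} (hs : 3 ≤ p ^ s) (τ : T)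
    (A : Matrix (Fin (l + 1)) (Fin (l + 1)) T) : ModCube τ ((1 + τ • A) ^ p ^ s) 0 := by
  refine ⟨τ ^ (p ^ s - 3) • A ^ p ^ s, ?_⟩
  rw [add_pow_char_pow_of_commute _ _ (Commute.one_left _), one_pow, smul_pow, smul_zero, add_zero,
    smul_smul, ← pow_add, Nat.add_sub_cancel' hs]

lemma map_nonsing_inv_of_isUnit_det {R : Type*} [CommRing R] (f : R →+* T)
    {A : Matrix (Fin n) (Fin n) R} (hA : IsUnit A.det) : A⁻¹.map f = (A.map f)⁻¹ := by
  refine (Matrix.inv_eq_right_inv ?_).symm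
  rw [← Matrix.map_mul, Matrix.mul_nonsing_inv _ hA, Matrix.map_one _ (map_zero f) (map_one f)]

lemma map_matComm {R : Type*} [CommRing R] (f : R →+* T) {A B : Matrix (Fin n) (Fin n) R}
    (hA : IsUnit A.det) (hB : IsUnit B.det) :
    (matComm A B).map f = matComm (A.map f) (B.map f) := by
  simp only [matComm, Matrix.map_mul, map_nonsing_inv_of_isUnit_det f hA,
    map_nonsing_inv_of_isUnit_det f hB]

lemma det_matComm {A B : Matrix (Fin n) (Fin n) T} (hA : IsUnit A.det) (hB : IsUnit B.det) :
    (matComm A B).det = 1 := by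
  have h1 : A.det * A⁻¹.det = 1 := by
    rw [← Matrix.det_mul, Matrix.mul_nonsing_inv _ hA, Matrix.det_one]
  have h2 : B.det * B⁻¹.det = 1 := by
    rw [← Matrix.det_mul, Matrix.mul_nonsing_inv _ hB, Matrix.det_one]
  rw [matComm, Matrix.det_mul, Matrix.det_mul, Matrix.det_mul]
  linear_combination B.det * B⁻¹.det * h1 + h2

variable {R : Type*} [CommRing R]

lemma isUnit_det_Xt (N n : ℕ) (i : Fin N) : IsUnit (Xt (A := R) N n i).det := by
  rw [MvPowerSeries.isUnit_iff_constantCoeff, RingHom.map_det]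
  have : (MvPowerSeries.constantCoeff (R := R)).mapMatrix (Xt (A := R) N n i) = 1 := by
    ext a b
    rcases eq_or_ne a b with rfl | h
    · simp [Xt, varMatrix]
    · simp [Xt, varMatrix, h]
  rw [this, Matrix.det_one]
  exact isUnit_one

lemma map_relMatrix {q m n : ℕ}
    (f : MvPowerSeries (Fin (2 * m + 2) × Fin n × Fin n) R →+* T) :
    (relMatrix q m n).map f = ((Xt (2 * m + 2) n ⟨0, by omega⟩).map f) ^ q *
    (List.ofFn (fun i : Fin (m + 1) =>
      matComm ((Xt (2 * m + 2) n ⟨2 * i, by have := i.isLt; omega⟩).map f)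
        ((Xt (2 * m + 2) n ⟨2 * i + 1, by have := i.isLt; omega⟩).map f))).prod := by
  simp only [← RingHom.mapMatrix_apply]
  rw [relMatrix, map_mul, map_pow, map_list_prod, List.map_ofFn]
  refine congrArg _ (congrArg _ (congrArg _ (funext fun i => ?_)))
  exact map_matComm f (isUnit_det_Xt _ _ _) (isUnit_det_Xt _ _ _)

lemma det_relMatrix (q m n : ℕ) :
    (relMatrix (A := R) q m n).det = (Xt (2 * m + 2) n ⟨0, by omega⟩).det ^ q := by
  rw [relMatrix, Matrix.det_mul, Matrix.det_pow, ← Matrix.coe_detMonoidHom, map_list_prod,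
    List.map_ofFn, List.prod_eq_one, mul_one]
  intro x hx
  obtain ⟨i, rfl⟩ := (List.mem_ofFn' _ _).1 hx
  exact det_matComm (isUnit_det_Xt _ _ _) (isUnit_det_Xt _ _ _)

lemma modCube_relMatrix {p : ℕ} [Fact p.Prime] [CharP T p] {l s m : ℕ} (hs : 3 ≤ p ^ s)
    (f : MvPowerSeries (Fin (2 * m + 2) × Fin (l + 1) × Fin (l + 1)) R →+* T) (τ : T)
    (B : Fin (2 * m + 2) → Matrix (Fin (l + 1)) (Fin (l + 1)) T)
    (hB : ∀ i, (Xt (2 * m + 2) (l + 1) i).map f = 1 + τ • B i) :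
    ModCube τ ((relMatrix (p ^ s) m (l + 1)).map f)
      (∑ i : Fin (m + 1),
        (B ⟨2 * i, by have := i.isLt; omega⟩ * B ⟨2 * i + 1, by have := i.isLt; omega⟩ -
        B ⟨2 * i + 1, by have := i.isLt; omega⟩ * B ⟨2 * i, by have := i.isLt; omega⟩)) := by
  have hdet (i) : IsUnit (1 + τ • B i).det := by
    rw [← hB, ← RingHom.mapMatrix_apply, ← RingHom.map_det]
    exact (isUnit_det_Xt _ _ _).map f
  rw [map_relMatrix, ← zero_add (∑ i : Fin (m + 1), _)]
  simp only [hB]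
  exact (modCube_pow hs τ _).mul (ModCube.prod_ofFn fun i => modCube_matComm (hdet _) (hdet _))

end MatrixExpansion

section Transport

variable {ι S S' : Type*} [CommRing S] [CommRing S']

lemma KoszulExact.of_ringEquiv [Fintype ι] (e : S ≃+* S') {f : ι → S} (h : KoszulExact (e ∘ f)) :
    KoszulExact f := by
  intro a ha
  obtain ⟨c, hc⟩ := h (e ∘ a) (by simpa using congrArg e ha)
  refine ⟨fun i j => e.symm (c i j), fun i => e.injective ?_⟩
  simpa using hc i

lemma isPrime_span_of_ringEquiv (e : S ≃+* S') {f : ι → S}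
    (h : (Ideal.span (Set.range (e ∘ f))).IsPrime) : (Ideal.span (Set.range f)).IsPrime := by
  have : Ideal.span (Set.range f) = (Ideal.span (Set.range (e ∘ f))).comap e := by
    rw [Set.range_comp, ← Ideal.map_span, Ideal.comap_map_of_bijective e e.bijective]
  rw [this]
  exact Ideal.IsPrime.comap e

end Transport

namespace PowerSeries

variable {P : Type*} [CommRing P]

/-- The power series `g` is divisible by `X ^ d` with coefficient `H` in degree `d`. -/
def HasLead (d : ℕ) (g : PowerSeries P) (H : P) : Prop := ∃ G, g = X ^ d * G ∧ constantCoeff G = H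

variable {d : ℕ} {g g' : PowerSeries P} {H H' : P}

lemma HasLead.add (h : HasLead d g H) (h' : HasLead d g' H') : HasLead d (g + g') (H + H') := by
  obtain ⟨G, rfl, rfl⟩ := h
  obtain ⟨G', rfl, rfl⟩ := h'
  exact ⟨G + G', by rw [mul_add], map_add _ _ _⟩

lemma HasLead.sub (h : HasLead d g H) (h' : HasLead d g' H') : HasLead d (g - g') (H - H') := by
  obtain ⟨G, rfl, rfl⟩ := h
  obtain ⟨G', rfl, rfl⟩ := h'
  exact ⟨G - G', by rw [mul_sub], map_sub _ _ _⟩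

lemma HasLead.zero (d : ℕ) : HasLead d (0 : PowerSeries P) 0 := ⟨0, by simp, by simp⟩

lemma HasLead.sum {α : Type*} (s : Finset α) {g : α → PowerSeries P} {H : α → P}
    (h : ∀ i ∈ s, HasLead d (g i) (H i)) : HasLead d (∑ i ∈ s, g i) (∑ i ∈ s, H i) := by
  classical
  induction s using Finset.induction_on with
  | empty => exact HasLead.zero d
  | insert i s hi ih =>
    rw [Finset.sum_insert hi, Finset.sum_insert hi]
    exact (h i (by simp)).add (ih fun j hj => h j (by simp [hj]))

lemma hasLead_X_pow_mul_C (d : ℕ) (a : P) : HasLead d (X ^ d * C a) a := ⟨C a, rfl, by simp⟩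

lemma hasLead_zero_X_pow_mul {e : ℕ} (hd : d < e) (G : PowerSeries P) : HasLead d (X ^ e * G) 0 :=
  ⟨X ^ (e - d) * G, by rw [← mul_assoc, ← pow_add, Nat.add_sub_cancel' hd.le],
    by simp [Nat.sub_ne_zero_of_lt hd]⟩

variable {n : Type*}

/-- The matrix `M` with entries scaled by powers of the variable. -/
def scaleMatrix (u : n → n → ℕ) (M : Matrix n n P) : Matrix n n (PowerSeries P) :=
  Matrix.of fun a c => X ^ u a c * C (M a c)

variable [Fintype n] {M M' : Matrix n n P} {u v : n → n → ℕ} {e : ℕ}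

lemma hasLead_mul_of_eq {a b : n} (h : ∀ c, e + u a c + v c b = d) :
    HasLead d (X ^ e * (scaleMatrix u M * scaleMatrix v M') a b) ((M * M') a b) := by
  rw [Matrix.mul_apply, Matrix.mul_apply, Finset.mul_sum]
  refine HasLead.sum _ fun c _ => ?_
  rw [← h c]
  convert hasLead_X_pow_mul_C (e + u a c + v c b) (M a c * M' c b) using 1
  simp only [scaleMatrix, Matrix.of_apply, map_mul, pow_add]
  ring

lemma hasLead_mul_of_lt {a b : n} (h : ∀ c, d < e + u a c + v c b) :
    HasLead d (X ^ e * (scaleMatrix u M * scaleMatrix v M') a b) 0 := by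
  rw [Matrix.mul_apply, Finset.mul_sum, ← Finset.sum_const_zero (s := (Finset.univ : Finset n))]
  refine HasLead.sum _ fun c _ => ?_
  convert hasLead_zero_X_pow_mul (h c) (C (M a c * M' c b)) using 1
  simp only [scaleMatrix, Matrix.of_apply, map_mul, pow_add]
  ring

end PowerSeries

section Shear

variable {k : Type*} [CommRing k] {N l : ℕ}

/-- The substitution translating the diagonal entries of the first matrix by `r` times its last
diagonal entry. -/
def shearVar (hN : 0 < N) (l : ℕ) (r : k) (v : Fin N × Fin (l + 1) × Fin (l + 1)) :
    MvPowerSeries (Fin N × Fin (l + 1) × Fin (l + 1)) k :=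
  MvPowerSeries.X v + if v.1 = ⟨0, hN⟩ ∧ v.2.1 = v.2.2 ∧ v.2.1 ≠ Fin.last l then
    r • MvPowerSeries.X (⟨0, hN⟩, Fin.last l, Fin.last l) else 0

lemma hasSubst_shearVar (hN : 0 < N) (r : k) : MvPowerSeries.HasSubst (shearVar hN l r) := by
  refine MvPowerSeries.hasSubst_of_constantCoeff_zero fun v => ?_
  unfold shearVar
  split_ifs <;> simp

lemma substAlgHom_shearVar_comp (hN : 0 < N) (r : k)
    (g : MvPowerSeries (Fin N × Fin (l + 1) × Fin (l + 1)) k) :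
    MvPowerSeries.substAlgHom (R := k) (hasSubst_shearVar (l := l) hN (-r))
      (MvPowerSeries.substAlgHom (R := k) (hasSubst_shearVar (l := l) hN r) g) = g := by
  rw [MvPowerSeries.substAlgHom_apply, MvPowerSeries.substAlgHom_apply,
    MvPowerSeries.subst_comp_subst_apply (hasSubst_shearVar hN r) (hasSubst_shearVar hN (-r))]
  have : (fun v => MvPowerSeries.subst (R := k) (shearVar hN l (-r)) (shearVar hN l r v)) =
      MvPowerSeries.X := by
    funext v
    rw [← MvPowerSeries.substAlgHom_apply (hasSubst_shearVar hN (-r))]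
    simp only [shearVar, map_add, MvPowerSeries.substAlgHom_X]
    split_ifs
    · rw [map_smul, MvPowerSeries.substAlgHom_X, shearVar]
      simp
    · rw [map_zero, add_zero, add_zero]
  rw [this, MvPowerSeries.subst_self, id]

/-- The automorphism `shearVar 1` of the power series ring. -/
def shear (hN : 0 < N) (l : ℕ) (k : Type*) [CommRing k] :
    MvPowerSeries (Fin N × Fin (l + 1) × Fin (l + 1)) k ≃+*
      MvPowerSeries (Fin N × Fin (l + 1) × Fin (l + 1)) k :=
  RingEquiv.ofRingHom
    (MvPowerSeries.substAlgHom (R := k) (hasSubst_shearVar (l := l) hN 1)).toRingHom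
    (MvPowerSeries.substAlgHom (R := k) (hasSubst_shearVar (l := l) hN (-1))).toRingHom
    (RingHom.ext fun g => by
      have := substAlgHom_shearVar_comp hN (-1) g
      simp only [neg_neg] at this
      exact this)
    (RingHom.ext fun g => substAlgHom_shearVar_comp hN 1 g)

lemma shear_X (hN : 0 < N) (v : Fin N × Fin (l + 1) × Fin (l + 1)) :
    shear hN l k (MvPowerSeries.X v) =
      MvPowerSeries.X v + if v.1 = ⟨0, hN⟩ ∧ v.2.1 = v.2.2 ∧ v.2.1 ≠ Fin.last l then
        MvPowerSeries.X (⟨0, hN⟩, Fin.last l, Fin.last l) else 0 := by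
  refine (MvPowerSeries.substAlgHom_X (hasSubst_shearVar (k := k) (l := l) hN 1) v).trans ?_
  simp [shearVar]

end Shear

/-- The equations of the locus in the framed deformation space on which the determinant of the
first matrix equals `ζ`. -/
def fixedDetEqn {A : Type*} [CommRing A] (q m l : ℕ) (ζ : A) (p : Fin (l + 1) × Fin (l + 1)) :
    MvPowerSeries (Fin (2 * m + 2) × Fin (l + 1) × Fin (l + 1)) A :=
  if p.1 = Fin.last l ∧ p.2 = Fin.last l then
    (Xt (2 * m + 2) (l + 1) ⟨0, by omega⟩).det - MvPowerSeries.C ζ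
  else (relMatrix (A := A) q m (l + 1) - 1) p.1 p.2

section Degeneration

open PowerSeries

variable {k : Type*} [Field k] {N l : ℕ}

/-- The exponents in the degeneration of the relation to its quadratic part. -/
def scaleExp (l : ℕ) (i a c : ℕ) : ℕ :=
  match i with
  | 0 => l + 2 + a
  | 1 => l - c
  | 2 => l - a
  | 3 => l + 2 + c
  | _ => 2 * (l + 1)

/-- The weights in the degeneration of the relation to its quadratic part. -/
def coarseWeight (N l : ℕ) (v : Fin N × Fin (l + 1) × Fin (l + 1)) : ℕ :=
  if v.1.val = 0 ∧ v.2.1 = Fin.last l ∧ v.2.2 = Fin.last l then 4 * (l + 1)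
  else 3 * (l + 1) + scaleExp l v.1.val v.2.1.val v.2.2.val

lemma coarseWeight_ne_zero (v : Fin N × Fin (l + 1) × Fin (l + 1)) : coarseWeight N l v ≠ 0 := by
  unfold coarseWeight
  split_ifs <;> omega

/-- The generic matrix, with the last diagonal entry of the first matrix replaced by zero. -/
def tracelessMatrix (k : Type*) [Field k] (i : Fin N) :
    Matrix (Fin (l + 1)) (Fin (l + 1)) (MvPolynomial (Fin N × Fin (l + 1) × Fin (l + 1)) k) :=
  Matrix.of fun a c => if i.val = 0 ∧ a = Fin.last l ∧ c = Fin.last l then 0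
    else MvPolynomial.X (i, a, c)

/-- `tracelessMatrix` with entries scaled. -/
def scaledMatrix (k : Type*) [Field k] (l : ℕ) (i : Fin N) : Matrix (Fin (l + 1)) (Fin (l + 1))
    (PowerSeries (MvPolynomial (Fin N × Fin (l + 1) × Fin (l + 1)) k)) :=
  scaleMatrix (fun a c => scaleExp l i.val a.val c.val) (tracelessMatrix k i)

/-- The common scalar part of the image of the first matrix under `degenerate`. -/
def scalarPart (k : Type*) [Field k] (l : ℕ) (i : Fin N) :
    PowerSeries (MvPolynomial (Fin N × Fin (l + 1) × Fin (l + 1)) k) :=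
  if i.val = 0 then X ^ (l + 1) * C (MvPolynomial.X (i, Fin.last l, Fin.last l)) else 0

/-- The shear automorphism followed by the grading homomorphism for `coarseWeight`. -/
def degenerate (k : Type*) [Field k] (hN : 0 < N) (l : ℕ) :
    MvPowerSeries (Fin N × Fin (l + 1) × Fin (l + 1)) k →+*
      PowerSeries (MvPolynomial (Fin N × Fin (l + 1) × Fin (l + 1)) k) :=
  (Graded.hom coarseWeight_ne_zero).comp (shear hN l k).toRingHom

/-- The matrix `(X_i) / X ^ (3 * (l + 1))` after degeneration. -/
def degenerateMatrix (k : Type*) [Field k] (l : ℕ) (i : Fin N) : Matrix (Fin (l + 1)) (Fin (l + 1))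
    (PowerSeries (MvPolynomial (Fin N × Fin (l + 1) × Fin (l + 1)) k)) :=
  scaledMatrix k l i + scalarPart k l i • 1

lemma degenerate_X (hN : 0 < N) (i : Fin N) (a c : Fin (l + 1)) :
    degenerate k hN l (MvPowerSeries.X (i, a, c)) =
      X ^ (3 * (l + 1)) * degenerateMatrix k l i a c := by
  have h1 : degenerate k hN l (MvPowerSeries.X (i, a, c)) =
      Graded.hom coarseWeight_ne_zero (shear hN l k (MvPowerSeries.X (i, a, c))) := rfl
  rw [h1, shear_X, map_add, Graded.hom_X]
  dsimp only
  rw [apply_ite (Graded.hom coarseWeight_ne_zero), Graded.hom_X, map_zero]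
  simp only [degenerateMatrix, scaledMatrix, scaleMatrix, scalarPart, tracelessMatrix,
    Matrix.add_apply, Matrix.smul_apply, Matrix.of_apply, smul_eq_mul, Matrix.one_apply]
  by_cases hi0 : i = ⟨0, hN⟩
  · subst hi0
    by_cases hac : a = c
    · subst hac
      by_cases hl : a = Fin.last l
      · subst hl
        simp only [coarseWeight, if_true, ne_eq, not_true_eq_false, and_false, if_false,
          map_zero, mul_zero, zero_add, mul_one, and_self, add_zero]
        rw [← mul_assoc, ← pow_add]
        ring
      · simp only [coarseWeight, hl, true_and, if_true, ne_eq, not_false_eq_true,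
          if_false, mul_one, and_self]
        ring
    · have : ¬ (a = Fin.last l ∧ c = Fin.last l) := fun h => hac (h.1.trans h.2.symm)
      simp only [coarseWeight, hac, this, true_and, if_false, mul_zero, add_zero,
        false_and]
      ring
  · have hi : ¬ i.val = 0 := fun h => hi0 (Fin.ext h)
    simp only [coarseWeight, hi0, hi, false_and, if_false, zero_mul, add_zero]
    ring

lemma map_degenerate_Xt (hN : 0 < N) (i : Fin N) :
    (Xt N (l + 1) i).map (degenerate k hN l) =
      1 + (X ^ (3 * (l + 1)) : PowerSeries (MvPolynomial (Fin N × Fin (l + 1) × Fin (l + 1)) k)) •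
        degenerateMatrix k l i := by
  rw [Xt, Matrix.map_add _ (map_add _), Matrix.map_one _ (map_zero _) (map_one _)]
  refine congrArg _ (Matrix.ext fun a c => ?_)
  exact degenerate_X hN i a c

lemma commutator_add_smul_one {R n : Type*} [CommRing R] [Fintype n] [DecidableEq n]
    (A B : Matrix n n R) (x y : R) :
    (A + x • 1) * (B + y • 1) - (B + y • 1) * (A + x • 1) = A * B - B * A := by
  simp only [mul_add, add_mul, smul_mul_assoc, mul_smul_comm, one_mul, mul_one]
  module

lemma tracelessMatrix_mul_apply (i j : Fin N) {a b : Fin (l + 1)} (ha : a ≠ Fin.last l ∨ i.val ≠ 0)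
    (hb : b ≠ Fin.last l ∨ j.val ≠ 0) :
    (tracelessMatrix (l := l) k i * tracelessMatrix (l := l) k j) a b =
      (polyMatrix (n := l + 1) k i * polyMatrix (n := l + 1) k j) a b := by
  rw [Matrix.mul_apply, Matrix.mul_apply]
  refine Finset.sum_congr rfl fun c _ => ?_
  simp only [tracelessMatrix, polyMatrix, Matrix.of_apply]
  rw [if_neg (by tauto), if_neg (by tauto)]

lemma HasLead.det_sub_one {P n : Type*} [CommRing P] [Fintype n] [DecidableEq n] {d e : ℕ} {H : P}
    {M : Matrix n n (PowerSeries P)} (hde : d < 2 * e) (h : HasLead d (X ^ e * M.trace) H) :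
    HasLead d ((1 + (X ^ e : PowerSeries P) • M).det - 1) H := by
  have h1 := h.add (hasLead_zero_X_pow_mul hde
    (((1 + (Polynomial.X : Polynomial (PowerSeries P)) • M.map Polynomial.C).det.divX.divX).eval
      (X ^ e)))
  rw [add_zero] at h1
  convert h1 using 1
  rw [Matrix.det_one_add_smul, two_mul, pow_add]
  ring

lemma hasLead_trace {i : Fin N} (hi : i.val = 0) :
    HasLead (4 * (l + 1)) (X ^ (3 * (l + 1)) * (degenerateMatrix k l i).trace)
      (((l + 1 : ℕ) : MvPolynomial _ k) * MvPolynomial.X (i, Fin.last l, Fin.last l)) := by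
  have h2 : HasLead (4 * (l + 1)) (∑ a : Fin (l + 1),
      (X ^ (3 * (l + 1)) * scaledMatrix k l i a a + X ^ (3 * (l + 1)) * scalarPart k l i))
      (∑ a : Fin (l + 1), (0 + MvPolynomial.X (i, Fin.last l, Fin.last l))) := by
    refine HasLead.sum _ fun a _ => HasLead.add ?_ ?_
    · rw [scaledMatrix, scaleMatrix, Matrix.of_apply, ← mul_assoc, ← pow_add]
      exact hasLead_zero_X_pow_mul (by rw [hi]; simp only [scaleExp]; omega) _
    · rw [scalarPart, if_pos hi, ← mul_assoc, ← pow_add,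
        show 3 * (l + 1) + (l + 1) = 4 * (l + 1) by ring]
      exact hasLead_X_pow_mul_C _ _
  convert h2 using 1
  · rw [Matrix.trace, Finset.mul_sum]
    refine Finset.sum_congr rfl fun a _ => ?_
    rw [Matrix.diag_apply, degenerateMatrix, Matrix.add_apply, Matrix.smul_apply,
      Matrix.one_apply_eq, smul_eq_mul, mul_one, mul_add]
  · simp

lemma hasLead_degenerate_det (hN : 4 ≤ N) :
    HasLead (4 * (l + 1)) (degenerate k (by omega) l ((Xt N (l + 1) ⟨0, by omega⟩).det - 1))
      (genericForm k hN l (Fin.last l, Fin.last l)) := by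
  rw [map_sub, map_one, RingHom.map_det, RingHom.mapMatrix_apply, map_degenerate_Xt]
  refine HasLead.det_sub_one (by omega) ?_
  convert hasLead_trace (k := k) (l := l) (N := N) (i := ⟨0, by omega⟩) rfl using 1
  simp [genericForm, leadForm, polyMatrix]

/-- The degrees of the leading forms of the off-diagonal and the non-final diagonal equations. -/
def coarseDegree (l a b : ℕ) : ℕ := if a < b then 8 * (l + 1) + a - b else 8 * (l + 1) + b - a

lemma hasLead_scaledMatrix_of_four_le {i j : Fin N} (hi : 4 ≤ i.val) (hj : 4 ≤ j.val)
    (a b : Fin (l + 1)) : HasLead (coarseDegree l a.val b.val)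
      (X ^ (6 * (l + 1)) * (scaledMatrix k l i * scaledMatrix k l j) a b) 0 := by
  refine hasLead_mul_of_lt fun c => ?_
  have e : ∀ i, 4 ≤ i → ∀ a c, scaleExp l i a c = 2 * (l + 1) := by
    intro i hi a c
    obtain ⟨i, rfl⟩ := Nat.exists_eq_add_of_le' hi
    rfl
  rw [e _ hi, e _ hj]
  unfold coarseDegree
  split_ifs <;> omega

lemma hasLead_commutator_zero {i j : Fin N} (hi : i.val = 0) (hj : j.val = 1) (a b : Fin (l + 1))
    (hab : ¬ (a = Fin.last l ∧ b = Fin.last l)) :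
    HasLead (coarseDegree l a.val b.val) (X ^ (6 * (l + 1)) *
        ((scaledMatrix k l i * scaledMatrix k l j) a b -
          (scaledMatrix k l j * scaledMatrix k l i) a b))
      (if a < b then (polyMatrix (n := l + 1) k i * polyMatrix (n := l + 1) k j) a b else
        if b < a then 0 else (polyMatrix (n := l + 1) k i * polyMatrix (n := l + 1) k j) a b -
          (polyMatrix (n := l + 1) k j * polyMatrix (n := l + 1) k i) a b) := by
  have hj' : j.val ≠ 0 := by omega
  rw [mul_sub]
  rcases lt_trichotomy a b with h | rfl | h
  · rw [if_pos h, ← tracelessMatrix_mul_apply _ _ (Or.inl (h.trans_le (Fin.le_last b)).ne)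
      (Or.inr hj'), ← sub_zero ((tracelessMatrix (l := l) k i * tracelessMatrix (l := l) k j) a b)]
    have h' : a.val < b.val := h
    refine (hasLead_mul_of_eq fun c => ?_).sub (hasLead_mul_of_lt fun c => ?_) <;>
    · rw [hi, hj]
      simp only [scaleExp, coarseDegree, if_pos h']
      omega
  · have ha : a ≠ Fin.last l := by tauto
    rw [if_neg (lt_irrefl a), if_neg (lt_irrefl a),
      ← tracelessMatrix_mul_apply _ _ (Or.inl ha) (Or.inl ha),
      ← tracelessMatrix_mul_apply _ _ (Or.inl ha) (Or.inl ha)]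
    refine (hasLead_mul_of_eq fun c => ?_).sub (hasLead_mul_of_eq fun c => ?_) <;>
    · rw [hi, hj]
      simp only [scaleExp, coarseDegree, if_neg (lt_irrefl a.val)]
      omega
  · rw [if_neg h.not_gt, if_pos h, ← sub_zero (0 : MvPolynomial _ k)]
    have h' : b.val < a.val := h
    refine (hasLead_mul_of_lt fun c => ?_).sub (hasLead_mul_of_lt fun c => ?_) <;>
    · rw [hi, hj]
      simp only [scaleExp, coarseDegree, if_neg h'.not_gt]
      omega

lemma hasLead_commutator_one {i j : Fin N} (hi : i.val = 2) (hj : j.val = 3) (a b : Fin (l + 1)) :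
    HasLead (coarseDegree l a.val b.val) (X ^ (6 * (l + 1)) *
        ((scaledMatrix k l i * scaledMatrix k l j) a b -
          (scaledMatrix k l j * scaledMatrix k l i) a b))
      (if a < b then 0 else
        if b < a then (polyMatrix (n := l + 1) k i * polyMatrix (n := l + 1) k j) a b else
        (polyMatrix (n := l + 1) k i * polyMatrix (n := l + 1) k j) a b -
          (polyMatrix (n := l + 1) k j * polyMatrix (n := l + 1) k i) a b) := by
  have hi' : i.val ≠ 0 := by omega
  have hj' : j.val ≠ 0 := by omega
  rw [mul_sub]
  rcases lt_trichotomy a b with h | rfl | h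
  · rw [if_pos h, ← sub_zero (0 : MvPolynomial _ k)]
    have h' : a.val < b.val := h
    refine (hasLead_mul_of_lt fun c => ?_).sub (hasLead_mul_of_lt fun c => ?_) <;>
    · rw [hi, hj]
      simp only [scaleExp, coarseDegree, if_pos h']
      omega
  · rw [if_neg (lt_irrefl a), if_neg (lt_irrefl a),
      ← tracelessMatrix_mul_apply _ _ (Or.inr hi') (Or.inr hj'),
      ← tracelessMatrix_mul_apply _ _ (Or.inr hj') (Or.inr hi')]
    refine (hasLead_mul_of_eq fun c => ?_).sub (hasLead_mul_of_eq fun c => ?_) <;>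
    · rw [hi, hj]
      simp only [scaleExp, coarseDegree, if_neg (lt_irrefl a.val)]
      omega
  · rw [if_neg h.not_gt, if_pos h, ← tracelessMatrix_mul_apply _ _ (Or.inr hi') (Or.inr hj'),
      ← sub_zero ((tracelessMatrix (l := l) k i * tracelessMatrix (l := l) k j) a b)]
    have h' : b.val < a.val := h
    refine (hasLead_mul_of_eq fun c => ?_).sub (hasLead_mul_of_lt fun c => ?_) <;>
    · rw [hi, hj]
      simp only [scaleExp, coarseDegree, if_neg h'.not_gt]
      omega

end Degeneration

section SpecialFiber

open PowerSeries

variable {k : Type*} [Field k] {N l : ℕ}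

lemma degenerateMatrix_commutator (i j : Fin N) (a b : Fin (l + 1)) :
    (degenerateMatrix k l i * degenerateMatrix k l j -
      degenerateMatrix k l j * degenerateMatrix k l i) a b =
    (scaledMatrix k l i * scaledMatrix k l j) a b -
      (scaledMatrix k l j * scaledMatrix k l i) a b := by
  rw [degenerateMatrix, degenerateMatrix, commutator_add_smul_one, Matrix.sub_apply]

/-- The entries of the commutator of two of the matrices `scaledMatrix`. -/
def scaledCommutator (k : Type*) [Field k] (i j : Fin N) (a b : Fin (l + 1)) :
    PowerSeries (MvPolynomial (Fin N × Fin (l + 1) × Fin (l + 1)) k) :=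
  (scaledMatrix k l i * scaledMatrix k l j) a b - (scaledMatrix k l j * scaledMatrix k l i) a b

lemma degenerate_relMatrix {p s m : ℕ} [Fact p.Prime] [CharP k p] (hs : 3 ≤ p ^ s)
    (a b : Fin (l + 1)) : ∃ E,
    degenerate k (by omega) l ((relMatrix (p ^ s) m (l + 1) - 1 : Matrix _ _ _) a b) =
      ∑ i : Fin (m + 1), X ^ (6 * (l + 1)) *
        scaledCommutator k (⟨2 * i, by have := i.isLt; omega⟩ : Fin (2 * m + 2))
          ⟨2 * i + 1, by have := i.isLt; omega⟩ a b + X ^ (9 * (l + 1)) * E := by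
  have hP : CharP (PowerSeries (MvPolynomial (Fin (2 * m + 2) × Fin (l + 1) × Fin (l + 1)) k)) p :=
    charP_of_injective_ringHom (f := (C (R := MvPolynomial _ k)).comp MvPolynomial.C)
      ((PowerSeries.C_injective).comp (MvPolynomial.C_injective _ _)) p
  obtain ⟨E, hE⟩ := modCube_relMatrix (m := m) hs (degenerate k (by omega) l) _ _
    (map_degenerate_Xt (by omega))
  refine ⟨E a b, ?_⟩
  have := congrFun (congrFun hE a) b
  rw [Matrix.map_apply, Matrix.add_apply, Matrix.add_apply, Matrix.smul_apply, Matrix.smul_apply,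
    Matrix.sum_apply, ← pow_mul, ← pow_mul, smul_eq_mul, smul_eq_mul] at this
  simp only [degenerateMatrix_commutator] at this
  have h1 : degenerate k (by omega) l ((1 : Matrix (Fin (l + 1)) (Fin (l + 1))
      (MvPowerSeries (Fin (2 * m + 2) × Fin (l + 1) × Fin (l + 1)) k)) a b) =
      (1 : Matrix (Fin (l + 1)) (Fin (l + 1)) _) a b := by
    rw [Matrix.one_apply, Matrix.one_apply, apply_ite (degenerate k _ l), map_one, map_zero]
  rw [Matrix.sub_apply, map_sub, this, h1, ← Finset.mul_sum]
  simp only [scaledCommutator]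
  rw [show 6 * (l + 1) = 3 * (l + 1) * 2 by ring, show 9 * (l + 1) = 3 * (l + 1) * 3 by ring]
  ring

lemma leadForm_eq_add {R : Type*} [CommRing R] (X Y Z W : Matrix (Fin (l + 1)) (Fin (l + 1)) R)
    {a b : Fin (l + 1)} (hab : ¬ (a = Fin.last l ∧ b = Fin.last l)) :
    leadForm X Y Z W (a, b) =
      (if a < b then (X * Y) a b else if b < a then 0 else (X * Y) a b - (Y * X) a b) +
      (if a < b then 0 else if b < a then (Z * W) a b else (Z * W) a b - (W * Z) a b) := by
  simp only [leadForm]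
  by_cases h : a < b
  · simp only [if_pos h, add_zero]
  · by_cases h' : b < a
    · simp only [if_neg h, if_pos h', zero_add]
    · have e : a = b := le_antisymm (not_lt.1 h') (not_lt.1 h)
      subst e
      have ha : a ≠ Fin.last l := by tauto
      simp only [lt_irrefl, if_false, if_neg ha, Matrix.sub_apply, Matrix.add_apply]
      ring

lemma hasLead_sum_scaledCommutator {m : ℕ} (hm : 1 ≤ m) (hN : 4 ≤ 2 * m + 2) (a b : Fin (l + 1))
    (hab : ¬ (a = Fin.last l ∧ b = Fin.last l)) :
    HasLead (coarseDegree l a.val b.val) (∑ i : Fin (m + 1), X ^ (6 * (l + 1)) *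
        scaledCommutator k (⟨2 * i, by have := i.isLt; omega⟩ : Fin (2 * m + 2))
          ⟨2 * i + 1, by have := i.isLt; omega⟩ a b) (genericForm k hN l (a, b)) := by
  obtain ⟨m, rfl⟩ := Nat.exists_eq_add_of_le' hm
  have hrest (i : Fin m) : HasLead (coarseDegree l a.val b.val) (X ^ (6 * (l + 1)) *
      scaledCommutator k
        (⟨2 * i.succ.succ, by have := i.isLt; simp only [Fin.val_succ]; omega⟩ :
          Fin (2 * (m + 1) + 2))
        ⟨2 * i.succ.succ + 1, by have := i.isLt; simp only [Fin.val_succ]; omega⟩ a b) 0 := by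
    rw [scaledCommutator, mul_sub, ← sub_zero (0 : MvPolynomial _ k)]
    exact (hasLead_scaledMatrix_of_four_le (by simp; omega) (by simp; omega) a b).sub
      (hasLead_scaledMatrix_of_four_le (by simp; omega) (by simp; omega) a b)
  have h0 := hasLead_commutator_zero (k := k) (l := l)
    (i := (⟨0, by omega⟩ : Fin (2 * (m + 1) + 2))) (j := ⟨1, by omega⟩) rfl rfl a b hab
  have h2 := hasLead_commutator_one (k := k) (l := l)
    (i := (⟨2, by omega⟩ : Fin (2 * (m + 1) + 2))) (j := ⟨3, by omega⟩) rfl rfl a b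
  have h3 := h0.add (h2.add (HasLead.sum (Finset.univ : Finset (Fin m)) fun i _ => hrest i))
  rw [Finset.sum_const_zero, add_zero] at h3
  rw [Fin.sum_univ_succ, Fin.sum_univ_succ]
  rw [genericForm, leadForm_eq_add _ _ _ _ hab]
  exact h3

lemma hasLead_degenerate_relMatrix {p s m : ℕ} [Fact p.Prime] [CharP k p] (hs : 3 ≤ p ^ s)
    (hm : 1 ≤ m) (hN : 4 ≤ 2 * m + 2) (a b : Fin (l + 1))
    (hab : ¬ (a = Fin.last l ∧ b = Fin.last l)) :
    HasLead (coarseDegree l a.val b.val)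
      (degenerate k (by omega) l ((relMatrix (p ^ s) m (l + 1) - 1 : Matrix _ _ _) a b))
      (genericForm k hN l (a, b)) := by
  obtain ⟨E, hE⟩ := degenerate_relMatrix (k := k) (m := m) hs a b
  have hE' : HasLead (coarseDegree l a.val b.val) (X ^ (9 * (l + 1)) * E) 0 := by
    refine hasLead_zero_X_pow_mul ?_ _
    unfold coarseDegree
    split_ifs <;> omega
  rw [hE, ← add_zero (genericForm k hN l (a, b))]
  exact (hasLead_sum_scaledCommutator hm hN a b hab).add hE'

/-- The degrees of the leading forms of the equations `fixedDetEqn`. -/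
def eqnDegree (l : ℕ) (p : Fin (l + 1) × Fin (l + 1)) : ℕ :=
  if p.1 = Fin.last l ∧ p.2 = Fin.last l then 4 * (l + 1) else coarseDegree l p.1.val p.2.val

lemma hasInitial_shear_fixedDetEqn {p s m : ℕ} [Fact p.Prime] [CharP k p] (hs : 3 ≤ p ^ s)
    (hm : 1 ≤ m) (hN : 4 ≤ 2 * m + 2) (v : Fin (l + 1) × Fin (l + 1)) :
    Graded.HasInitial coarseWeight_ne_zero (eqnDegree l v)
      ((shear (by omega) l k ∘ fixedDetEqn (p ^ s) m l (1 : k)) v) (genericForm k hN l v) := by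
  change HasLead (eqnDegree l v) (degenerate k (by omega) l (fixedDetEqn (p ^ s) m l (1 : k) v)) _
  obtain ⟨a, b⟩ := v
  unfold fixedDetEqn eqnDegree
  split_ifs with h
  · obtain ⟨rfl, rfl⟩ := h
    rw [map_one]
    exact hasLead_degenerate_det hN
  · exact hasLead_degenerate_relMatrix hs hm hN a b h

theorem koszulExact_fixedDetEqn_one {p s m : ℕ} [Fact p.Prime] [CharP k p] (hs : 3 ≤ p ^ s)
    (hm : 1 ≤ m) (hl : ((l + 1 : ℕ) : k) ≠ 0) :
    KoszulExact (fixedDetEqn (p ^ s) m l (1 : k)) :=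
  KoszulExact.of_ringEquiv (shear (by omega) l k)
    (Graded.koszulExact_of_initial (hasInitial_shear_fixedDetEqn hs hm (by omega))
      (koszulExact_genericForm (by omega) hl))

theorem isPrime_span_fixedDetEqn_one {p s m : ℕ} [Fact p.Prime] [CharP k p] (hs : 3 ≤ p ^ s)
    (hm : 1 ≤ m) (hl : ((l + 1 : ℕ) : k) ≠ 0) :
    (Ideal.span (Set.range (fixedDetEqn (p ^ s) m l (1 : k)))).IsPrime :=
  isPrime_span_of_ringEquiv (shear (by omega) l k)
    (Graded.isPrime_of_initial (hasInitial_shear_fixedDetEqn hs hm (by omega))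
      (koszulExact_genericForm (by omega) hl) (isPrime_span_genericForm (by omega) hl))

end SpecialFiber

section AdicSums

/-- Every `t`-adic series converges. -/
def AdicSums {S : Type*} [CommRing S] (t : S) : Prop :=
  ∀ a : ℕ → S, ∃ s, ∀ n, t ^ n ∣ s - ∑ k ∈ Finset.range n, t ^ k * a k

lemma AdicSums.of_pow_eq_mul {S : Type*} [CommRing S] {t x v : S} {e : ℕ} (hx : AdicSums x)
    (htx : t ∣ x) (he : e ≠ 0) (hv : t ^ e = x * v) : AdicSums t := by
  intro a
  obtain ⟨s, hs⟩ := hx fun j => v ^ j * ∑ r ∈ Finset.range e, t ^ r * a (r + e * j)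
  refine ⟨s, fun n => ?_⟩
  have h1 : ∀ n, ∑ j ∈ Finset.range n,
      x ^ j * (v ^ j * ∑ r ∈ Finset.range e, t ^ r * a (r + e * j)) =
      ∑ k ∈ Finset.range (e * n), t ^ k * a k := by
    intro n
    induction n with
    | zero => simp
    | succ n ih =>
      rw [Finset.sum_range_succ, ih, mul_add, mul_one, Finset.sum_range_add, ← mul_assoc,
        ← mul_pow, ← hv, ← pow_mul, Finset.mul_sum]
      refine congrArg _ (Finset.sum_congr rfl fun r _ => ?_)
      rw [pow_add, mul_assoc, add_comm]
  have h2 := hs n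
  rw [h1] at h2
  have h3 : n ≤ e * n := Nat.le_mul_of_pos_left n (Nat.pos_of_ne_zero he)
  have h4 : t ^ n ∣ ∑ k ∈ Finset.range (e * n - n), t ^ (n + k) * a (n + k) :=
    Finset.dvd_sum fun k _ => Dvd.intro _ (by rw [pow_add, mul_assoc])
  have h5 := ((pow_dvd_pow_of_dvd htx n).trans h2).add h4
  obtain ⟨N, hN⟩ := Nat.exists_eq_add_of_le h3
  rw [hN, Nat.add_sub_cancel_left, Finset.sum_range_add] at h5
  convert h5 using 1
  ring

lemma PadicInt.adicSums (p : ℕ) [Fact p.Prime] : AdicSums (p : ℤ_[p]) := by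
  intro a
  have hI : ∀ n, (IsLocalRing.maximalIdeal ℤ_[p] ^ n • ⊤ : Ideal ℤ_[p]) =
      Ideal.span {(p : ℤ_[p]) ^ n} := by
    intro n
    rw [smul_eq_mul, Ideal.mul_top, PadicInt.maximalIdeal_eq_span_p, Ideal.span_singleton_pow]
  obtain ⟨s, hs⟩ := IsPrecomplete.prec
    (inferInstance : IsPrecomplete (IsLocalRing.maximalIdeal ℤ_[p]) ℤ_[p])
    (f := fun n => ∑ k ∈ Finset.range n, (p : ℤ_[p]) ^ k * a k) (by
      intro m n hmn
      rw [hI, SModEq.comm, SModEq.sub_mem, Ideal.mem_span_singleton]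
      obtain ⟨d, rfl⟩ := Nat.exists_eq_add_of_le hmn
      rw [Finset.sum_range_add, add_sub_cancel_left]
      exact Finset.dvd_sum fun k _ => Dvd.intro _ (by rw [pow_add, mul_assoc]))
  refine ⟨s, fun n => ?_⟩
  have := hs n
  rwa [hI, SModEq.comm, SModEq.sub_mem, Ideal.mem_span_singleton] at this

lemma AdicSums.of_basis {A B ι : Type*} [CommRing A] [CommRing B] [Algebra A B] [Fintype ι]
    (b : Module.Basis ι A B) {t : A} (ht : AdicSums t) : AdicSums (algebraMap A B t) := by
  intro a
  choose s hs using fun i => ht fun k => b.repr (a k) i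
  refine ⟨∑ i, s i • b i, fun n => ?_⟩
  have h1 : ∑ i, s i • b i - ∑ k ∈ Finset.range n, algebraMap A B t ^ k * a k =
      ∑ i, (s i - ∑ k ∈ Finset.range n, t ^ k * b.repr (a k) i) • b i := by
    simp only [sub_smul, Finset.sum_sub_distrib, Finset.sum_smul]
    rw [Finset.sum_comm]
    refine congrArg _ (Finset.sum_congr rfl fun k _ => ?_)
    simp only [mul_smul, ← Finset.smul_sum, b.sum_repr]
    rw [Algebra.smul_def, map_pow]
  rw [h1]
  refine Finset.dvd_sum fun i _ => ?_
  rw [Algebra.smul_def, ← map_pow]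
  exact ((map_dvd (algebraMap A B) (hs i n))).mul_right _

end AdicSums

lemma algebraMap_padicInt_injective {p : ℕ} [Fact p.Prime] {L : Type} [Field L] [Algebra ℚ_[p] L]
    [Algebra ℤ_[p] L] [IsScalarTower ℤ_[p] ℚ_[p] L] :
    Function.Injective (algebraMap ℤ_[p] L) := by
  rw [IsScalarTower.algebraMap_eq ℤ_[p] ℚ_[p] L]
  exact (algebraMap ℚ_[p] L).injective.comp (IsFractionRing.injective ℤ_[p] ℚ_[p])

lemma algebraMap_ringOfIntegers_injective {p : ℕ} [Fact p.Prime] {L : Type} [Field L]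
    [Algebra ℚ_[p] L] [Algebra ℤ_[p] L] [IsScalarTower ℤ_[p] ℚ_[p] L] :
    Function.Injective (algebraMap ℤ_[p] (RingOfIntegers p L)) := fun _ _ h =>
  algebraMap_padicInt_injective (L := L) (congrArg Subtype.val h)

section IntegerRing

variable (p : ℕ) [Fact p.Prime] (L : Type) [Field L] [Algebra ℚ_[p] L] [FiniteDimensional ℚ_[p] L]
  [Algebra ℤ_[p] L] [IsScalarTower ℤ_[p] ℚ_[p] L]

variable {p L} in
lemma isIntegral_iff_spectralNorm_le_one (x : L) :
    IsIntegral ℤ_[p] x ↔ spectralNorm ℚ_[p] L x ≤ 1 := by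
  have hx : IsIntegral ℚ_[p] x := Algebra.IsIntegral.isIntegral x
  rw [spectralNorm, spectralValue_le_one_iff (minpoly.monic hx)]
  constructor
  · intro h n
    rw [minpoly.isIntegrallyClosed_eq_field_fractions' ℚ_[p] h, Polynomial.coeff_map]
    exact PadicInt.norm_le_one _
  · intro h
    have hl : minpoly ℚ_[p] x ∈ Polynomial.lifts (algebraMap ℤ_[p] ℚ_[p]) :=
      (Polynomial.lifts_iff_coeff_lifts _).2 fun n => ⟨⟨_, h n⟩, rfl⟩
    obtain ⟨f, hf, -, hm⟩ := Polynomial.lifts_and_natDegree_eq_and_monic hl (minpoly.monic hx)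
    refine ⟨f, hm, ?_⟩
    rw [IsScalarTower.algebraMap_eq ℤ_[p] ℚ_[p] L, ← Polynomial.eval₂_map, hf]
    exact minpoly.aeval _ _

lemma isLocalRing_ringOfIntegers : IsLocalRing (RingOfIntegers p L) := by
  have key (x : RingOfIntegers p L) : x ∈ nonunits _ ↔ spectralNorm ℚ_[p] L (x : L) < 1 := by
    have hx := (isIntegral_iff_spectralNorm_le_one (x : L)).1 x.2
    have hmul := map_mul (spectralMulAlgNorm ℚ_[p] L)
    simp only [spectralMulAlgNorm_def] at hmul
    have h1 : spectralNorm ℚ_[p] L 1 = 1 := spectralNorm_one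
    constructor
    · intro h
      refine lt_of_le_of_ne hx fun h' => h ?_
      have hx0 : (x : L) ≠ 0 := by
        intro h0
        rw [h0, spectralNorm_zero] at h'
        exact zero_ne_one h'
      have hinv : spectralNorm ℚ_[p] L (x : L)⁻¹ = 1 := by
        have := hmul x (x : L)⁻¹
        rwa [mul_inv_cancel₀ hx0, h1, h', one_mul, eq_comm] at this
      exact IsUnit.of_mul_eq_one ⟨(x : L)⁻¹, (isIntegral_iff_spectralNorm_le_one _).2 hinv.le⟩
        (Subtype.ext (mul_inv_cancel₀ hx0))
    · rintro h ⟨u, rfl⟩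
      have hu := (isIntegral_iff_spectralNorm_le_one ((u⁻¹ : (RingOfIntegers p L)ˣ) : L)).1
        (u⁻¹ : (RingOfIntegers p L)ˣ).1.2
      have := hmul (u : RingOfIntegers p L) ((u⁻¹ : (RingOfIntegers p L)ˣ) : RingOfIntegers p L)
      rw [← MulMemClass.coe_mul, Units.mul_inv, OneMemClass.coe_one, h1] at this
      nlinarith [spectralNorm_nonneg (K := ℚ_[p]) (L := L) ((u : RingOfIntegers p L) : L)]
  refine IsLocalRing.of_nonunits_add fun a b ha hb => ?_
  rw [key] at *
  exact (isNonarchimedean_spectralNorm (a : L) (b : L)).trans_lt (max_lt ha hb)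

omit [FiniteDimensional ℚ_[p] L] in
lemma natCast_mem_nonunits_ringOfIntegers : (p : RingOfIntegers p L) ∈ nonunits _ := by
  intro h
  have : IsLocalHom (algebraMap ℤ_[p] (RingOfIntegers p L)) :=
    (algebraMap_isIntegral_iff.mpr inferInstance).isLocalHom algebraMap_ringOfIntegers_injective
  rw [← map_natCast (algebraMap ℤ_[p] (RingOfIntegers p L)), isUnit_map_iff] at h
  exact PadicInt.p_nonunit h

omit [FiniteDimensional ℚ_[p] L] in
lemma natCast_ringOfIntegers_ne_zero : (p : RingOfIntegers p L) ≠ 0 := by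
  rw [← map_natCast (algebraMap ℤ_[p] (RingOfIntegers p L)),
    map_ne_zero_iff _ algebraMap_ringOfIntegers_injective]
  exact_mod_cast (Fact.out : p.Prime).ne_zero

lemma isDiscreteValuationRing_ringOfIntegers : IsDiscreteValuationRing (RingOfIntegers p L) := by
  have := isLocalRing_ringOfIntegers p L
  have := integralClosure.isDedekindDomain ℤ_[p] ℚ_[p] L
  refine ((IsDiscreteValuationRing.TFAE (RingOfIntegers p L) fun h => ?_).out 0 2).2 this
  refine natCast_mem_nonunits_ringOfIntegers p L ?_
  obtain ⟨b, hb⟩ := h.mul_inv_cancel (natCast_ringOfIntegers_ne_zero p L)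
  exact IsUnit.of_mul_eq_one b hb

lemma exists_uniformizer : ∃ ϖ : RingOfIntegers p L, Prime ϖ ∧ (Ideal.span {ϖ}).IsMaximal ∧
    ϖ ∣ p ∧ (∃ e, (p : RingOfIntegers p L) ∣ ϖ ^ e) ∧ AdicSums ϖ ∧
    (∀ x, (∀ n, ϖ ^ n ∣ x) → x = 0) := by
  have := isDiscreteValuationRing_ringOfIntegers p L
  have hp0 : (p : RingOfIntegers p L) ≠ 0 := natCast_ringOfIntegers_ne_zero p L
  obtain ⟨ϖ, hϖ⟩ := IsDiscreteValuationRing.exists_irreducible (RingOfIntegers p L)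
  have hmax := hϖ.maximalIdeal_eq
  have hdvd : ϖ ∣ p := by
    rw [← Ideal.mem_span_singleton, ← hmax]
    exact natCast_mem_nonunits_ringOfIntegers p L
  obtain ⟨e, he⟩ := IsDiscreteValuationRing.associated_pow_irreducible hp0 hϖ
  obtain ⟨v, hv⟩ := he.dvd
  refine ⟨ϖ, hϖ.prime, hmax ▸ inferInstance, hdvd, ⟨e, he.dvd⟩, ?_, fun x hx => ?_⟩
  · have hfin : Module.Finite ℤ_[p] (RingOfIntegers p L) :=
      ⟨(IsIntegralClosure.isNoetherian ℤ_[p] ℚ_[p] L (RingOfIntegers p L)).noetherian ⊤⟩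
    have : FaithfulSMul ℤ_[p] L :=
      (faithfulSMul_iff_algebraMap_injective _ _).2 algebraMap_padicInt_injective
    have : Module.IsTorsionFree ℤ_[p] L := inferInstance
    have : Module.Free ℤ_[p] (RingOfIntegers p L) :=
      IsIntegralClosure.module_free ℤ_[p] ℚ_[p] L (RingOfIntegers p L)
    have h1 := (PadicInt.adicSums p).of_basis (Module.Free.chooseBasis ℤ_[p] (RingOfIntegers p L))
    rw [map_natCast] at h1
    refine h1.of_pow_eq_mul hdvd (e := e) ?_ hv
    rintro rfl
    rw [pow_zero] at he
    exact natCast_mem_nonunits_ringOfIntegers p L (he.symm.isUnit isUnit_one)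
  · have h1 := Ideal.iInf_pow_eq_bot_of_isLocalRing (IsLocalRing.maximalIdeal (RingOfIntegers p L))
      (IsLocalRing.maximalIdeal.isMaximal _).ne_top
    rw [← Ideal.mem_bot, ← h1, Ideal.mem_iInf]
    intro n
    rw [hmax, Ideal.span_singleton_pow, Ideal.mem_span_singleton]
    exact hx n

end IntegerRing

section Reduction

variable {A : Type*} [CommRing A]

lemma MvPowerSeries.C_dvd_iff {σ : Type*} (a : A) (x : MvPowerSeries σ A) :
    MvPowerSeries.C a ∣ x ↔ ∀ e, a ∣ MvPowerSeries.coeff e x := by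
  constructor
  · rintro ⟨y, rfl⟩ e
    rw [MvPowerSeries.coeff_C_mul]
    exact dvd_mul_right _ _
  · intro h
    choose y hy using h
    obtain ⟨z, hz⟩ : ∃ z : MvPowerSeries σ A, ∀ e, MvPowerSeries.coeff e z = y e :=
      ⟨y, fun _ => rfl⟩
    refine ⟨z, MvPowerSeries.ext fun e => ?_⟩
    rw [MvPowerSeries.coeff_C_mul, hz]
    exact hy e

lemma MvPowerSeries.isAdicReduction_map [IsDomain A] (σ : Type*) {t : A} (ht : t ≠ 0)
    (hc : AdicSums t) (hsep : ∀ x, (∀ n, t ^ n ∣ x) → x = 0) :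
    IsAdicReduction (MvPowerSeries.map (σ := σ) (Ideal.Quotient.mk (Ideal.span {t})))
      (MvPowerSeries.C t) where
  surj y := by
    choose x hx using fun e => Ideal.Quotient.mk_surjective (MvPowerSeries.coeff e y)
    exact ⟨fun e => x e, MvPowerSeries.ext fun e => hx e⟩
  ker x := by
    rw [MvPowerSeries.C_dvd_iff, MvPowerSeries.ext_iff]
    refine forall_congr' fun e => ?_
    rw [MvPowerSeries.coeff_map, map_zero, Ideal.Quotient.eq_zero_iff_dvd]
  reg x hx := by
    refine MvPowerSeries.ext fun e => ?_
    have := congrArg (MvPowerSeries.coeff e) hx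
    rw [MvPowerSeries.coeff_C_mul, map_zero] at this
    rw [map_zero]
    exact (mul_eq_zero.1 this).resolve_left ht
  sep x hx := by
    refine MvPowerSeries.ext fun e => hsep _ fun n => ?_
    have := hx n
    rw [← map_pow, MvPowerSeries.C_dvd_iff] at this
    exact this e
  complete a := by
    choose s hs using fun e => hc fun k => MvPowerSeries.coeff e (a k)
    obtain ⟨z, hz⟩ : ∃ z : MvPowerSeries σ A, ∀ e, MvPowerSeries.coeff e z = s e :=
      ⟨s, fun _ => rfl⟩
    refine ⟨z, fun n => ?_⟩
    rw [← map_pow, MvPowerSeries.C_dvd_iff]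
    intro e
    have := hs e n
    simp only [← map_pow, map_sub, map_sum, MvPowerSeries.coeff_C_mul, hz]
    exact this

lemma map_fixedDetEqn {B : Type*} [CommRing B] (f : A →+* B) (q m l : ℕ) (ζ : A) :
    MvPowerSeries.map f ∘ fixedDetEqn q m l ζ = fixedDetEqn q m l (f ζ) := by
  have hX (i : Fin (2 * m + 2)) : (Xt (A := A) (2 * m + 2) (l + 1) i).map (MvPowerSeries.map f) =
      Xt (A := B) (2 * m + 2) (l + 1) i := by
    rw [Xt, Xt, Matrix.map_add _ (map_add _), Matrix.map_one _ (map_zero _) (map_one _)]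
    refine congrArg _ (Matrix.ext fun a c => ?_)
    exact MvPowerSeries.map_X f _
  have hr : (relMatrix (A := A) q m (l + 1)).map (MvPowerSeries.map f) =
      relMatrix (A := B) q m (l + 1) := by
    rw [map_relMatrix, relMatrix]
    simp only [hX]
  funext v
  rw [Function.comp_apply, fixedDetEqn, fixedDetEqn, apply_ite (MvPowerSeries.map f), map_sub,
    RingHom.map_det, RingHom.mapMatrix_apply, hX, MvPowerSeries.map_C]
  refine congrArg _ ?_
  rw [← hr, Matrix.sub_apply, Matrix.sub_apply, map_sub, Matrix.map_apply, Matrix.one_apply,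
    Matrix.one_apply, apply_ite (MvPowerSeries.map f), map_one, map_zero]

end Reduction

section IntegralModel

variable {p : ℕ} [Fact p.Prime] {L : Type} [Field L] [Algebra ℚ_[p] L] [FiniteDimensional ℚ_[p] L]
  [Algebra ℤ_[p] L] [IsScalarTower ℤ_[p] ℚ_[p] L] {s m l : ℕ}

variable (p L) in
lemma exists_residueField : ∃ (ϖ : RingOfIntegers p L) (k : Type) (_ : Field k) (_ : CharP k p)
    (r : RingOfIntegers p L →+* k), (∀ (s : ℕ) (ζ : RingOfIntegers p L), ζ ^ p ^ s = 1 → r ζ = 1) ∧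
    (∃ e, (p : RingOfIntegers p L) ∣ ϖ ^ e) ∧
    ∀ σ : Type, IsAdicReduction (MvPowerSeries.map (σ := σ) r) (MvPowerSeries.C ϖ) := by
  obtain ⟨ϖ, hϖ, hmax, hdvd, he, hc, hsep⟩ := exists_uniformizer p L
  have hp : ((p : ℕ) : RingOfIntegers p L ⧸ Ideal.span {ϖ}) = 0 := by
    rw [← map_natCast (Ideal.Quotient.mk _), Ideal.Quotient.eq_zero_iff_dvd]
    exact hdvd
  let _ := Ideal.Quotient.field (Ideal.span {ϖ})
  have hchar : CharP (RingOfIntegers p L ⧸ Ideal.span {ϖ}) p :=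
    (CharP.charP_iff_prime_eq_zero Fact.out).2 hp
  refine ⟨ϖ, RingOfIntegers p L ⧸ Ideal.span {ϖ}, _, hchar, Ideal.Quotient.mk _,
    fun s ζ hζ => ?_, he, fun σ => MvPowerSeries.isAdicReduction_map σ hϖ.ne_zero hc hsep⟩
  have := congrArg (Ideal.Quotient.mk (Ideal.span {ϖ})) hζ
  rw [map_pow, map_one] at this
  rwa [← one_pow (p ^ s), ← sub_eq_zero, ← sub_pow_char_pow,
    pow_eq_zero_iff (by simp [(Fact.out : p.Prime).ne_zero]), sub_eq_zero] at this

lemma natCast_notMem_of_isAdicReduction {A S S₀ : Type*} [CommRing A] [CommRing S] [CommRing S₀]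
    {ρ : S →+* S₀} {g : A →+* S} {t : A} (hr : IsAdicReduction ρ (g t)) {p e : ℕ}
    (he : (p : A) ∣ t ^ e) {ι : Type*} [Fintype ι] {f : ι → S} (hK : KoszulExact (ρ ∘ f))
    (hP : (Ideal.span (Set.range (ρ ∘ f))).IsPrime) : (p : S) ∉ Ideal.span (Set.range f) := by
  intro h
  refine hr.notMem hK hP ((hr.isPrime hK hP).mem_of_pow_mem e ?_)
  obtain ⟨v, hv⟩ := he
  rw [← map_pow, hv, map_mul, map_natCast]
  exact Ideal.mul_mem_right _ _ h

theorem isPrime_span_fixedDetEqn (hs : 3 ≤ p ^ s) (hm : 1 ≤ m) (hl : l + 1 < p)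
    {ζ : RingOfIntegers p L} (hζ : ζ ^ p ^ s = 1) :
    (Ideal.span (Set.range (fixedDetEqn (p ^ s) m l ζ))).IsPrime ∧
      (p : MvPowerSeries _ (RingOfIntegers p L)) ∉
        Ideal.span (Set.range (fixedDetEqn (p ^ s) m l ζ)) := by
  obtain ⟨ϖ, k, _, _, r, hr1, ⟨e, he⟩, hr⟩ := exists_residueField p L
  have hmap : MvPowerSeries.map r ∘ fixedDetEqn (p ^ s) m l ζ = fixedDetEqn (p ^ s) m l 1 := by
    rw [map_fixedDetEqn, hr1 s ζ hζ]
  have hl' : ((l + 1 : ℕ) : k) ≠ 0 := by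
    rw [Ne, CharP.cast_eq_zero_iff _ p]
    exact fun h => (Nat.le_of_dvd (by omega) h).not_gt hl
  have hK := koszulExact_fixedDetEqn_one hs hm hl'
  have hP := isPrime_span_fixedDetEqn_one hs hm hl'
  rw [← hmap] at hK hP
  exact ⟨(hr _).isPrime hK hP, natCast_notMem_of_isAdicReduction (hr _) he hK hP⟩

theorem isPrime_span_one_add_X_sub {σ : Type} [Finite σ] (i : σ) {ζ : RingOfIntegers p L}
    (hζ : ζ ^ p ^ s = 1) :
    (Ideal.span {1 + MvPowerSeries.X i - MvPowerSeries.C ζ}).IsPrime ∧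
      (p : MvPowerSeries σ (RingOfIntegers p L)) ∉
        Ideal.span {1 + MvPowerSeries.X i - MvPowerSeries.C ζ} := by
  obtain ⟨ϖ, k, _, _, r, hr1, ⟨e, he⟩, hr⟩ := exists_residueField p L
  have hmap : MvPowerSeries.map r ∘ (fun _ : Unit => 1 + MvPowerSeries.X i - MvPowerSeries.C ζ) =
      fun _ : Unit => (MvPowerSeries.X i : MvPowerSeries σ k) := by
    funext
    simp [hr1 s ζ hζ]
  have hi (_ : Unit) : Graded.HasInitial (k := k) (w := fun _ : σ => 1) (fun _ => one_ne_zero) 1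
      (MvPowerSeries.X i) (MvPolynomial.X i) :=
    ⟨PowerSeries.C (MvPolynomial.X i), Graded.hom_X _ i, PowerSeries.constantCoeff_C _⟩
  have hprime : Prime (MvPolynomial.X i : MvPolynomial σ k) := MvPolynomial.X_prime
  have hK' : KoszulExact fun _ : Unit => (MvPolynomial.X i : MvPolynomial σ k) := by
    intro a ha
    refine ⟨fun _ _ => 0, fun j => ?_⟩
    rw [Fintype.sum_unique, mul_eq_zero] at ha
    simpa using ha.resolve_right hprime.ne_zero
  have hP' : (Ideal.span
      (Set.range fun _ : Unit => (MvPolynomial.X i : MvPolynomial σ k))).IsPrime := by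
    rw [Set.range_const, Ideal.span_singleton_prime hprime.ne_zero]
    exact hprime
  have hK := Graded.koszulExact_of_initial hi hK'
  have hP := Graded.isPrime_of_initial hi hK' hP'
  rw [← hmap] at hK hP
  have := And.intro ((hr _).isPrime hK hP) (natCast_notMem_of_isAdicReduction (hr _) he hK hP)
  rwa [Set.range_const] at this

end IntegralModel

section Components

variable {A ι : Type*} [CommRing A] {Z : Finset ι} {z : ι → A} {θ : A}

lemma exists_mem_of_prod_sub_eq_zero (h0 : ∏ i ∈ Z, (θ - z i) = 0) (P : Ideal A) [hP : P.IsPrime] :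
    ∃ i ∈ Z, Ideal.span {θ - z i} ≤ P := by
  have : ∏ i ∈ Z, (θ - z i) ∈ P := h0 ▸ P.zero_mem
  obtain ⟨i, hi, h⟩ := hP.prod_mem_iff.1 this
  exact ⟨i, hi, (Ideal.span_singleton_le_iff_mem _).2 h⟩

lemma eq_of_span_sub_le (hu : ∀ i ∈ Z, ∀ j ∈ Z, i ≠ j → IsUnit (z i - z j)) {P : Ideal A}
    (hP : P ≠ ⊤) {i j : ι} (hi : i ∈ Z) (hj : j ∈ Z) (hiP : Ideal.span {θ - z i} ≤ P)
    (hjP : Ideal.span {θ - z j} ≤ P) : i = j := by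
  by_contra h
  rw [Ideal.span_singleton_le_iff_mem] at hiP hjP
  refine hP (Ideal.eq_top_of_isUnit_mem _ ?_ (hu i hi j hj h))
  simpa using P.sub_mem hjP hiP

lemma mem_minimalPrimes_iff_of_prod_sub_eq_zero (h0 : ∏ i ∈ Z, (θ - z i) = 0)
    (hu : ∀ i ∈ Z, ∀ j ∈ Z, i ≠ j → IsUnit (z i - z j))
    (hp : ∀ i ∈ Z, (Ideal.span {θ - z i}).IsPrime) (P : Ideal A) :
    P ∈ minimalPrimes A ↔ ∃ i ∈ Z, Ideal.span {θ - z i} = P := by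
  constructor
  · intro hP
    have hP' : P.IsPrime := hP.1.1
    obtain ⟨i, hi, h⟩ := exists_mem_of_prod_sub_eq_zero h0 P
    exact ⟨i, hi, h.antisymm (hP.2 ⟨hp i hi, bot_le⟩ h)⟩
  · rintro ⟨i, hi, rfl⟩
    refine ⟨⟨hp i hi, bot_le⟩, fun Q hQ hQi => ?_⟩
    have hQ' : Q.IsPrime := hQ.1
    obtain ⟨j, hj, h⟩ := exists_mem_of_prod_sub_eq_zero h0 Q
    rwa [eq_of_span_sub_le hu (hp i hi).ne_top hi hj le_rfl (h.trans hQi)]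

theorem minimalPrimes_bijection_of_prod_sub_eq_zero {A₁ : Type*} [CommRing A₁] {z₁ : ι → A₁}
    {θ₁ : A₁} (δ : A₁ →+* A) (hθ : δ θ₁ = θ) (hz : ∀ i, δ (z₁ i) = z i)
    (h0 : ∏ i ∈ Z, (θ₁ - z₁ i) = 0) (hu : ∀ i ∈ Z, ∀ j ∈ Z, i ≠ j → IsUnit (z₁ i - z₁ j))
    (hp₁ : ∀ i ∈ Z, (Ideal.span {θ₁ - z₁ i}).IsPrime)
    (hp : ∀ i ∈ Z, (Ideal.span {θ - z i}).IsPrime) :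
    (∀ Q ∈ minimalPrimes A, ∃! P : Ideal A₁, P ∈ minimalPrimes A₁ ∧ P ≤ Ideal.comap δ Q) ∧
      ∃ Φ : {P : Ideal A // P ∈ minimalPrimes A} → {P : Ideal A₁ // P ∈ minimalPrimes A₁},
        (∀ Q, (Φ Q : Ideal A₁) ≤ Ideal.comap δ Q.1) ∧ Function.Bijective Φ := by
  have hδ (i : ι) : δ (θ₁ - z₁ i) = θ - z i := by rw [map_sub, hθ, hz]
  have h0' : ∏ i ∈ Z, (θ - z i) = 0 := by simp_rw [← hδ, ← map_prod, h0, map_zero]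
  have hu' : ∀ i ∈ Z, ∀ j ∈ Z, i ≠ j → IsUnit (z i - z j) := fun i hi j hj h => by
    simpa [hz] using (hu i hi j hj h).map δ
  have hm₁ := mem_minimalPrimes_iff_of_prod_sub_eq_zero h0 hu hp₁
  have hm := mem_minimalPrimes_iff_of_prod_sub_eq_zero h0' hu' hp
  have hle (i : ι) (Q : Ideal A) :
      Ideal.span {θ₁ - z₁ i} ≤ Ideal.comap δ Q ↔ Ideal.span {θ - z i} ≤ Q := by
    rw [Ideal.span_singleton_le_iff_mem, Ideal.mem_comap, hδ, Ideal.span_singleton_le_iff_mem]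
  have huniq : ∀ Q ∈ minimalPrimes A,
      ∃! P : Ideal A₁, P ∈ minimalPrimes A₁ ∧ P ≤ Ideal.comap δ Q := by
    intro Q hQ
    obtain ⟨i, hi, rfl⟩ := (hm Q).1 hQ
    refine ⟨Ideal.span {θ₁ - z₁ i}, ⟨(hm₁ _).2 ⟨i, hi, rfl⟩, (hle _ _).2 le_rfl⟩, ?_⟩
    rintro P ⟨hP, hPQ⟩
    obtain ⟨j, hj, rfl⟩ := (hm₁ P).1 hP
    rw [hle] at hPQ
    rw [eq_of_span_sub_le hu' (hp i hi).ne_top hj hi hPQ le_rfl]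
  choose f hf _ using fun Q : {P : Ideal A // P ∈ minimalPrimes A} => huniq Q.1 Q.2
  refine ⟨huniq, fun Q => ⟨f Q, (hf Q).1⟩, fun Q => (hf Q).2, ?_, ?_⟩
  · intro Q Q' h
    have h' : f Q = f Q' := congrArg Subtype.val h
    obtain ⟨k, hk, hfk⟩ := (hm₁ _).1 (hf Q).1
    have hQ := (hf Q).2
    have hQ' := (hf Q').2
    rw [← h'] at hQ'
    rw [← hfk, hle] at hQ hQ'
    have hkm : Ideal.span {θ - z k} ∈ minimalPrimes A := (hm _).2 ⟨k, hk, rfl⟩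
    exact Subtype.ext ((hQ.antisymm (Q.2.2 hkm.1 hQ)).symm.trans (hQ'.antisymm (Q'.2.2 hkm.1 hQ')))
  · rintro ⟨P, hP⟩
    obtain ⟨i, hi, rfl⟩ := (hm₁ P).1 hP
    have hQ : Ideal.span {θ - z i} ∈ minimalPrimes A := (hm _).2 ⟨i, hi, rfl⟩
    refine ⟨⟨_, hQ⟩, Subtype.ext ((huniq _ hQ).unique (hf ⟨_, hQ⟩) ⟨hP, (hle _ _).2 le_rfl⟩)⟩

end Components

section Localization

/-- If `I + (x)` is a prime ideal not containing `a`, then `x` generates a prime ideal of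
`(S / I)[1/a]`. -/
lemma isPrime_span_algebraMap_mk {S A : Type*} [CommRing S] [CommRing A] {I J : Ideal S} {a x : S}
    [Algebra (S ⧸ I) A] [IsLocalization.Away (Ideal.Quotient.mk I a) A]
    (hJ : J.IsPrime) (hIJ : I ⊔ Ideal.span {x} = J) (ha : a ∉ J) :
    (Ideal.span {algebraMap (S ⧸ I) A (Ideal.Quotient.mk I x)}).IsPrime := by
  have hIle : I ≤ J := hIJ ▸ le_sup_left
  have hmap : J.map (Ideal.Quotient.mk I) = Ideal.span {Ideal.Quotient.mk I x} := by
    rw [← hIJ, Ideal.map_sup, Ideal.map_quotient_self, bot_sup_eq, Ideal.map_span,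
      Set.image_singleton]
  have hprime : (J.map (Ideal.Quotient.mk I)).IsPrime :=
    Ideal.map_isPrime_of_surjective Ideal.Quotient.mk_surjective (by rwa [Ideal.mk_ker])
  have hcomap : (J.map (Ideal.Quotient.mk I)).comap (Ideal.Quotient.mk I) = J := by
    rw [Ideal.comap_map_of_surjective _ Ideal.Quotient.mk_surjective, ← RingHom.ker_eq_comap_bot,
      Ideal.mk_ker, sup_eq_left.2 hIle]
  have := IsLocalization.isPrime_of_isPrime_disjoint
    (Submonoid.powers (Ideal.Quotient.mk I a)) A _ hprime ?_
  · rwa [hmap, Ideal.map_span, Set.image_singleton] at this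
  · refine (Ideal.disjoint_powers_iff_notMem_of_isPrime _).2 fun h => ha ?_
    rw [← hcomap]
    exact h

end Localization

section RootsOfUnity

lemma exists_isPrimitiveRoot_of_le_card {F : Type*} [Field F] {p s : ℕ} (hp : p.Prime)
    (hs : 1 ≤ s) (h : p ^ s ≤ Nat.card {ζ : F // ∃ t : ℕ, ζ ^ p ^ t = 1}) :
    ∃ ζ : F, IsPrimitiveRoot ζ (p ^ s) := by
  by_contra! hno
  obtain ⟨s, rfl⟩ := Nat.exists_eq_add_of_le' hs
  have key (ζ : F) (hζ : ∃ t : ℕ, ζ ^ p ^ t = 1) : ζ ^ p ^ s = 1 := by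
    obtain ⟨t, ht⟩ := hζ
    obtain ⟨k, -, hk⟩ := (Nat.dvd_prime_pow hp).1 (orderOf_dvd_of_pow_eq_one ht)
    by_cases hks : k ≤ s
    · exact orderOf_dvd_iff_pow_eq_one.1 (hk ▸ pow_dvd_pow p hks)
    · refine (hno (ζ ^ p ^ (k - (s + 1))) ?_).elim
      have h1 : IsPrimitiveRoot ζ (p ^ k) := hk ▸ IsPrimitiveRoot.orderOf ζ
      refine h1.pow (pow_pos hp.pos _) ?_
      rw [← pow_add]
      exact congrArg _ (by omega)
  have hc : Nat.card {ζ : F // ∃ t : ℕ, ζ ^ p ^ t = 1} ≤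
      Nat.card (Polynomial.nthRootsFinset (p ^ s) (1 : F)) := by
    refine Nat.card_le_card_of_injective (fun ζ => ⟨ζ.1,
      (Polynomial.mem_nthRootsFinset (pow_pos hp.pos s) _).2 (key _ ζ.2)⟩) fun a b hab => ?_
    exact Subtype.ext (Subtype.mk.inj hab)
  rw [Nat.card_eq_fintype_card (α := Polynomial.nthRootsFinset (p ^ s) (1 : F)),
    Fintype.card_coe] at hc
  have h2 : (Polynomial.nthRootsFinset (p ^ s) (1 : F)).card ≤ p ^ s :=
    by classical exact (Polynomial.nthRootsFinset_def (p ^ s) (1 : F) ▸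
      (Multiset.toFinset_card_le _).trans (Polynomial.card_nthRoots _ _))
  have : p ^ s < p ^ (s + 1) := Nat.pow_lt_pow_right hp.one_lt (Nat.lt_succ_self s)
  omega

lemma sub_dvd_of_prod_eq_X_pow_sub_one {A : Type*} [CommRing A] {Z : Finset A} {q : ℕ}
    (hZ : ∏ z ∈ Z, (Polynomial.X - Polynomial.C z) = (Polynomial.X ^ q - 1 : Polynomial A))
    (h1 : ∀ z ∈ Z, z ^ q = 1) (hq : q ≠ 0) {x y : A} (hx : x ∈ Z) (hy : y ∈ Z) (hxy : x ≠ y) :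
    x - y ∣ (q : A) := by
  classical
  have hd := congrArg (fun f => (Polynomial.derivative f).eval x) hZ
  rw [← Finset.mul_prod_erase Z _ hx,
    ← Finset.mul_prod_erase (Z.erase x) _ (Finset.mem_erase.2 ⟨hxy.symm, hy⟩)] at hd
  simp only [Polynomial.derivative_mul, Polynomial.derivative_sub, Polynomial.derivative_X,
    Polynomial.derivative_C, sub_zero, one_mul, Polynomial.eval_add, Polynomial.eval_mul,
    Polynomial.eval_sub, Polynomial.eval_X, Polynomial.eval_C, sub_self, zero_mul, add_zero,
    Polynomial.derivative_X_pow, Polynomial.derivative_one, Polynomial.eval_pow]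
    at hd
  have hqx : (q : A) = x * (q * x ^ (q - 1)) := by
    rw [mul_left_comm, mul_pow_sub_one hq, h1 x hx, mul_one]
  rw [hqx, ← hd]
  exact (dvd_mul_right _ _).mul_left _

end RootsOfUnity

section IntegralModel

variable {p : ℕ} [Fact p.Prime] {L : Type} [Field L] [Algebra ℤ_[p] L] {s : ℕ}

lemma exists_roots_ringOfIntegers (hs : 1 ≤ s)
    (hL : p ^ s ≤ Nat.card {ζ : L // ∃ t : ℕ, ζ ^ p ^ t = 1}) :
    ∃ Z : Finset (RingOfIntegers p L), (∀ z ∈ Z, z ^ p ^ s = 1) ∧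
      ∏ z ∈ Z, (Polynomial.X - Polynomial.C z) =
        (Polynomial.X ^ p ^ s - 1 : Polynomial (RingOfIntegers p L)) := by
  have hp : p.Prime := Fact.out
  have hpos : 0 < p ^ s := pow_pos hp.pos s
  obtain ⟨ζ, hζ⟩ := exists_isPrimitiveRoot_of_le_card hp hs hL
  have hint : ζ ∈ RingOfIntegers p L :=
    IsIntegral.of_pow hpos (by rw [hζ.pow_eq_one]; exact isIntegral_one)
  have hζ' : IsPrimitiveRoot (⟨ζ, hint⟩ : RingOfIntegers p L) (p ^ s) :=
    IsPrimitiveRoot.of_map_of_injective (f := (RingOfIntegers p L).val) hζ Subtype.val_injective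
  exact ⟨Polynomial.nthRootsFinset (p ^ s) 1,
    fun z hz => (Polynomial.mem_nthRootsFinset hpos _).1 hz,
    (Polynomial.X_pow_sub_one_eq_prod hpos hζ').symm⟩

end IntegralModel

section DeterminantMap

variable {A : Type*} [CommRing A]

lemma Matrix.eq_one_of_det_eq_one {T : Type*} [CommRing T] {l : ℕ}
    {M : Matrix (Fin (l + 1)) (Fin (l + 1)) T}
    (h : ∀ a b, ¬ (a = Fin.last l ∧ b = Fin.last l) → M a b = (1 : Matrix _ _ T) a b)
    (hdet : M.det = 1) : M = 1 := by
  have hM : M = Matrix.diagonal fun i => M i i := by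
    ext a b
    rcases eq_or_ne a b with rfl | hab
    · rw [Matrix.diagonal_apply_eq]
    · rw [Matrix.diagonal_apply_ne _ hab, h a b (by rintro ⟨rfl, rfl⟩; exact hab rfl),
        Matrix.one_apply_ne hab]
  have hlast : M (Fin.last l) (Fin.last l) = 1 := by
    rw [hM, Matrix.det_diagonal, Fin.prod_univ_castSucc, Finset.prod_eq_one, one_mul] at hdet
    · exact hdet
    · intro i _
      rw [h _ _ fun hi => (Fin.castSucc_lt_last i).ne hi.1, Matrix.one_apply_eq]
  ext a b
  by_cases hab : a = Fin.last l ∧ b = Fin.last l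
  · rw [hab.1, hab.2, hlast, Matrix.one_apply_eq]
  · exact h a b hab

lemma map_relMatrix_eq_one {q m n : ℕ} {T : Type*} [CommRing T]
    (f : MvPowerSeries (Fin (2 * m + 2) × Fin n × Fin n) A →+* T)
    (hf : ∀ x ∈ relIdeal (A := A) q m n, f x = 0) : (relMatrix (A := A) q m n).map f = 1 := by
  ext a b
  have := hf ((relMatrix (A := A) q m n - 1) a b) (Ideal.subset_span ⟨(a, b), rfl⟩)
  rw [Matrix.sub_apply, map_sub, sub_eq_zero] at this
  rw [Matrix.map_apply, this, Matrix.one_apply, Matrix.one_apply, apply_ite f, map_one, map_zero]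

lemma det_Xt_zero_pow_sub_one_mem_relIdeal (q m n : ℕ) :
    (Xt (A := A) (2 * m + 2) n ⟨0, by omega⟩).det ^ q - 1 ∈ relIdeal (A := A) q m n := by
  rw [← Ideal.Quotient.eq, ← det_relMatrix, RingHom.map_det, RingHom.mapMatrix_apply,
    map_relMatrix_eq_one _ fun x hx => Ideal.Quotient.eq_zero_iff_mem.2 hx, Matrix.det_one,
    map_one]

lemma relIdeal_sup_span_det_sub (q m l : ℕ) {ζ : A} (hζ : ζ ^ q = 1) :
    relIdeal (A := A) q m (l + 1) ⊔
        Ideal.span {(Xt (2 * m + 2) (l + 1) ⟨0, by omega⟩).det - MvPowerSeries.C ζ} =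
      Ideal.span (Set.range (fixedDetEqn q m l ζ)) := by
  set J := Ideal.span (Set.range (fixedDetEqn q m l ζ))
  have hmem (v) : fixedDetEqn q m l ζ v ∈ J := Ideal.subset_span ⟨v, rfl⟩
  have hdet : (Xt (2 * m + 2) (l + 1) ⟨0, by omega⟩).det - MvPowerSeries.C ζ ∈ J := by
    have := hmem (Fin.last l, Fin.last l)
    rwa [fixedDetEqn, if_pos ⟨rfl, rfl⟩] at this
  refine le_antisymm (sup_le (Ideal.span_le.2 ?_) ?_) (Ideal.span_le.2 ?_)
  · rintro _ ⟨⟨a, b⟩, rfl⟩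
    have hone : (relMatrix (A := A) q m (l + 1)).map (Ideal.Quotient.mk J) = 1 := by
      refine Matrix.eq_one_of_det_eq_one (fun a b hab => ?_) ?_
      · have := Ideal.Quotient.eq_zero_iff_mem.2 (hmem (a, b))
        rw [fixedDetEqn, if_neg hab, Matrix.sub_apply, map_sub, sub_eq_zero] at this
        rw [Matrix.map_apply, this, Matrix.one_apply, Matrix.one_apply,
          apply_ite (Ideal.Quotient.mk J), map_one, map_zero]
      · rw [← RingHom.mapMatrix_apply, ← RingHom.map_det, det_relMatrix, map_pow,
          Ideal.Quotient.eq.2 hdet, ← map_pow, ← map_pow, hζ, map_one, map_one]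
    have := congrFun (congrFun hone a) b
    rw [Matrix.map_apply] at this
    refine Ideal.Quotient.eq_zero_iff_mem.1 ?_
    change Ideal.Quotient.mk J ((relMatrix (A := A) q m (l + 1) - 1) a b) = 0
    rw [Matrix.sub_apply, map_sub, this, Matrix.one_apply, Matrix.one_apply,
      apply_ite (Ideal.Quotient.mk J), map_one, map_zero, sub_self]
  · exact (Ideal.span_singleton_le_iff_mem _).2 hdet
  · rintro _ ⟨⟨a, b⟩, rfl⟩
    rw [fixedDetEqn]
    split_ifs
    · exact Ideal.mem_sup_right (Ideal.mem_span_singleton_self _)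
    · exact Ideal.mem_sup_left (Ideal.subset_span ⟨(a, b), rfl⟩)

lemma hasSubst_det_Xt_sub_one (N n : ℕ) :
    MvPowerSeries.HasSubst fun k : Fin N => (Xt (A := A) N n k).det - 1 := by
  refine MvPowerSeries.hasSubst_of_constantCoeff_zero fun k => ?_
  have : (MvPowerSeries.constantCoeff (R := A)).mapMatrix (Xt (A := A) N n k) = 1 := by
    ext a b
    rcases eq_or_ne a b with rfl | h
    · simp [Xt, varMatrix]
    · simp [Xt, varMatrix, h]
  rw [map_sub, map_one, RingHom.map_det, this, Matrix.det_one, sub_self]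

lemma det_one_add_map_varMatrix (q m n : ℕ) (k : Fin (2 * m + 2)) :
    (1 + (varMatrix (A := A) (2 * m + 2) n k).map
      (Ideal.Quotient.mk (relIdeal (A := A) q m n))).det =
    Ideal.Quotient.mk (relIdeal (A := A) q m n) (Xt (2 * m + 2) n k).det := by
  rw [RingHom.map_det, RingHom.mapMatrix_apply, Xt, Matrix.map_add _ (map_add _),
    Matrix.map_one _ (map_zero _) (map_one _)]

/-- The map `R₁ → R` induced by taking determinants of deformations. -/
lemma exists_detMap (q m n : ℕ) :
    ∃ δ : charDefRing A q m →ₐ[A] defRing (A := A) q m n, ∀ k : Fin (2 * m + 2),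
      δ (Ideal.Quotient.mk (charIdeal A q m) (MvPowerSeries.X k)) =
        Ideal.Quotient.mk (relIdeal (A := A) q m n) ((Xt (2 * m + 2) n k).det - 1) := by
  obtain ⟨φ, hφ⟩ : ∃ φ : MvPowerSeries (Fin (2 * m + 2)) A →ₐ[A]
      MvPowerSeries (Fin (2 * m + 2) × Fin n × Fin n) A,
      ∀ k, φ (MvPowerSeries.X k) = (Xt (2 * m + 2) n k).det - 1 :=
    ⟨MvPowerSeries.substAlgHom (hasSubst_det_Xt_sub_one (A := A) _ n),
      fun k => MvPowerSeries.substAlgHom_X _ k⟩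
  have hker : charIdeal A q m ≤ (relIdeal (A := A) q m n).comap φ := by
    refine (Ideal.span_singleton_le_iff_mem _).2 ?_
    rw [Ideal.mem_comap, map_sub, map_pow, map_add, map_one, hφ, add_sub_cancel]
    exact det_Xt_zero_pow_sub_one_mem_relIdeal q m n
  exact ⟨Ideal.quotientMapₐ _ φ hker, fun k =>
    congrArg (Ideal.Quotient.mk (relIdeal (A := A) q m n)) (hφ k)⟩

end DeterminantMap

section GenericFiber

instance (p : ℕ) (A : Type*) [CommRing A] (q m n : ℕ) :
    IsLocalization.Away (p : defRing (A := A) q m n) (genericFiberRing p A q m n) :=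
  Localization.isLocalization (M := Submonoid.powers _)

instance (p : ℕ) (A : Type*) [CommRing A] (q m : ℕ) :
    IsLocalization.Away (p : charDefRing A q m) (charGenericFiber p A q m) :=
  Localization.isLocalization (M := Submonoid.powers _)

lemma one_add_X_pow_sub_one_mem_charIdeal {A : Type*} [CommRing A] (q m : ℕ) :
    (1 + MvPowerSeries.X ⟨0, by omega⟩) ^ q - 1 ∈ charIdeal A q m :=
  Ideal.mem_span_singleton_self _

lemma charIdeal_sup_span_sub {A : Type*} [CommRing A] (q m : ℕ) {ζ : A} (hζ : ζ ^ q = 1) :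
    charIdeal A q m ⊔ Ideal.span {1 + MvPowerSeries.X ⟨0, by omega⟩ - MvPowerSeries.C ζ} =
      Ideal.span {1 + MvPowerSeries.X ⟨0, by omega⟩ - MvPowerSeries.C ζ} := by
  refine sup_eq_right.2 (Ideal.span_singleton_le_span_singleton.2 ?_)
  have : (1 : MvPowerSeries (Fin (2 * m + 2)) A) = MvPowerSeries.C ζ ^ q := by
    rw [← map_pow, hζ, map_one]
  nth_rewrite 3 [this]
  exact sub_dvd_pow_sub_pow _ _ q

lemma prod_sub_map_eq_pow_sub_one {A B : Type*} [CommRing A] [CommRing B] {Z : Finset A} {q : ℕ}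
    (hZ : ∏ z ∈ Z, (Polynomial.X - Polynomial.C z) = (Polynomial.X ^ q - 1 : Polynomial A))
    (f : A →+* B) (θ : B) : ∏ z ∈ Z, (θ - f z) = θ ^ q - 1 := by
  have := congrArg (Polynomial.eval₂RingHom f θ) hZ
  simpa [map_prod] using this

/-- A homomorphism `δ : S₁ / I₁ → S / I` carrying a `q`-th root of unity `t₁` to `t` induces a
bijection on the irreducible components of the generic fibers if the loci `t₁ = ζ` and `t = ζ` are
integral and flat for each `q`-th root of unity `ζ`. -/
theorem exists_bijection_minimalPrimes_localization {O S₁ S B₁ B : Type*} [CommRing O]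
    [CommRing S₁] [CommRing S] [CommRing B₁] [CommRing B] {I₁ : Ideal S₁} {I : Ideal S}
    [Algebra (S₁ ⧸ I₁) B₁] [Algebra (S ⧸ I) B] {p s : ℕ}
    [IsLocalization.Away (p : S₁ ⧸ I₁) B₁] [IsLocalization.Away (p : S ⧸ I) B] {Z : Finset O}
    (hq : p ^ s ≠ 0) (hZ1 : ∀ z ∈ Z, z ^ p ^ s = 1)
    (hZ : ∏ z ∈ Z, (Polynomial.X - Polynomial.C z) = (Polynomial.X ^ p ^ s - 1 : Polynomial O))
    (c₁ : O →+* S₁) (c : O →+* S) (t₁ : S₁) (t : S) (δ : S₁ ⧸ I₁ →+* S ⧸ I)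
    (hδc : ∀ z, δ (Ideal.Quotient.mk I₁ (c₁ z)) = Ideal.Quotient.mk I (c z))
    (hδt : δ (Ideal.Quotient.mk I₁ t₁) = Ideal.Quotient.mk I t) (ht₁ : t₁ ^ p ^ s - 1 ∈ I₁)
    (h₁ : ∀ z ∈ Z, (I₁ ⊔ Ideal.span {t₁ - c₁ z}).IsPrime ∧
      (p : S₁) ∉ I₁ ⊔ Ideal.span {t₁ - c₁ z})
    (h : ∀ z ∈ Z, (I ⊔ Ideal.span {t - c z}).IsPrime ∧ (p : S) ∉ I ⊔ Ideal.span {t - c z}) :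
    ∃ δp : B₁ →+* B, (∀ a, δp (algebraMap (S₁ ⧸ I₁) B₁ a) = algebraMap (S ⧸ I) B (δ a)) ∧
      (∀ Q ∈ minimalPrimes B, ∃! P : Ideal B₁, P ∈ minimalPrimes B₁ ∧ P ≤ Ideal.comap δp Q) ∧
      ∃ Φ : {P : Ideal B // P ∈ minimalPrimes B} → {P : Ideal B₁ // P ∈ minimalPrimes B₁},
        (∀ Q, (Φ Q : Ideal B₁) ≤ Ideal.comap δp Q.1) ∧ Function.Bijective Φ := by
  have hunit : IsUnit (((algebraMap (S ⧸ I) B).comp δ) (p : S₁ ⧸ I₁)) := by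
    rw [map_natCast, ← map_natCast (algebraMap (S ⧸ I) B)]
    exact IsLocalization.Away.algebraMap_isUnit _
  have hδp (a : S₁ ⧸ I₁) : IsLocalization.Away.lift (S := B₁) (p : S₁ ⧸ I₁) hunit
      (algebraMap _ _ a) = algebraMap _ _ (δ a) := IsLocalization.Away.lift_eq _ hunit a
  refine ⟨IsLocalization.Away.lift (p : S₁ ⧸ I₁) hunit, hδp, ?_⟩
  refine minimalPrimes_bijection_of_prod_sub_eq_zero (Z := Z)
    (z₁ := (algebraMap (S₁ ⧸ I₁) B₁).comp ((Ideal.Quotient.mk I₁).comp c₁))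
    (θ₁ := algebraMap _ _ (Ideal.Quotient.mk I₁ t₁))
    (z := (algebraMap (S ⧸ I) B).comp ((Ideal.Quotient.mk I).comp c))
    (θ := algebraMap _ _ (Ideal.Quotient.mk I t)) _ ?_ (fun z => ?_) ?_ ?_ ?_ ?_
  · rw [hδp, hδt]
  · exact (hδp _).trans (congrArg _ (hδc z))
  · rw [prod_sub_map_eq_pow_sub_one hZ, ← map_pow, ← map_pow,
      ← map_one (algebraMap (S₁ ⧸ I₁) B₁), ← map_one (Ideal.Quotient.mk I₁), ← map_sub,
      ← map_sub, Ideal.Quotient.eq_zero_iff_mem.2 ht₁, map_zero]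
  · intro x hx y hy hxy
    have hdvd := sub_dvd_of_prod_eq_X_pow_sub_one hZ hZ1 hq hx hy hxy
    rw [← map_sub]
    refine isUnit_of_dvd_unit (map_dvd _ hdvd) ?_
    rw [map_natCast, Nat.cast_pow, ← map_natCast (algebraMap (S₁ ⧸ I₁) B₁)]
    exact (IsLocalization.Away.algebraMap_isUnit _).pow s
  · intro z hz
    have hloc : IsLocalization.Away (Ideal.Quotient.mk I₁ (p : S₁)) B₁ := by
      rwa [map_natCast]
    have := isPrime_span_algebraMap_mk (A := B₁) (h₁ z hz).1 rfl (h₁ z hz).2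
    rwa [map_sub, map_sub] at this
  · intro z hz
    have hloc : IsLocalization.Away (Ideal.Quotient.mk I (p : S)) B := by
      rwa [map_natCast]
    have := isPrime_span_algebraMap_mk (A := B) (h z hz).1 rfl (h z hz).2
    rwa [map_sub, map_sub] at this

end GenericFiber

/-- The determinant map induces a bijection between the irreducible components of the
framed deformation space of `ρ̄` and those of the deformation space of `det ρ̄`. -/
theorem determinant_induces_bijection_on_components
    (p s q m n : ℕ) (hs : 1 ≤ s) (hq : q = p ^ s) (hq3 : 3 ≤ q)
    (hm : 1 ≤ m) (hn : 2 ≤ n) (hpn : n < p) [Fact p.Prime]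
    (L : Type) [Field L] [Algebra ℚ_[p] L] [FiniteDimensional ℚ_[p] L]
    [Algebra ℤ_[p] L] [IsScalarTower ℤ_[p] ℚ_[p] L]
    (K : Type) [Field K] [Algebra ℚ_[p] K] [FiniteDimensional ℚ_[p] K]
    (hd : Module.finrank ℚ_[p] K = 2 * m)
    (hK : Nat.card {ζ : K // ∃ t : ℕ, ζ ^ p ^ t = 1} = q)
    (hL : q ≤ Nat.card {ζ : L // ∃ t : ℕ, ζ ^ p ^ t = 1}) :
    -- (i) det(I + X̄₁)^q = 1 in R
    ((1 + (varMatrix (A := RingOfIntegers p L) (2 * m + 2) n ⟨0, by omega⟩).map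
        (Ideal.Quotient.mk (relIdeal (A := RingOfIntegers p L) q m n))).det ^ q = 1) ∧
    -- (ii) the determinant map δ : R₁ → R, and (iii) the induced bijection on components
    (∃ δ : charDefRing (RingOfIntegers p L) q m →ₐ[RingOfIntegers p L]
        defRing (A := RingOfIntegers p L) q m n,
      (∀ k : Fin (2 * m + 2),
        δ (Ideal.Quotient.mk (charIdeal (RingOfIntegers p L) q m) (MvPowerSeries.X k)) =
          (1 + (varMatrix (A := RingOfIntegers p L) (2 * m + 2) n k).map
            (Ideal.Quotient.mk (relIdeal (A := RingOfIntegers p L) q m n))).det - 1) ∧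
      ∃ δp : charGenericFiber p (RingOfIntegers p L) q m →+*
          genericFiberRing p (RingOfIntegers p L) q m n,
        (∀ a : charDefRing (RingOfIntegers p L) q m,
          δp (algebraMap (charDefRing (RingOfIntegers p L) q m)
              (charGenericFiber p (RingOfIntegers p L) q m) a) =
            algebraMap (defRing (A := RingOfIntegers p L) q m n)
              (genericFiberRing p (RingOfIntegers p L) q m n) (δ a)) ∧
        (∀ 𝔮 ∈ minimalPrimes (genericFiberRing p (RingOfIntegers p L) q m n),
          ∃! 𝔭 : Ideal (charGenericFiber p (RingOfIntegers p L) q m),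
            𝔭 ∈ minimalPrimes (charGenericFiber p (RingOfIntegers p L) q m) ∧
            𝔭 ≤ Ideal.comap δp 𝔮) ∧
        ∃ Φ : {P : Ideal (genericFiberRing p (RingOfIntegers p L) q m n) //
              P ∈ minimalPrimes (genericFiberRing p (RingOfIntegers p L) q m n)} →
            {P : Ideal (charGenericFiber p (RingOfIntegers p L) q m) //
              P ∈ minimalPrimes (charGenericFiber p (RingOfIntegers p L) q m)},
          (∀ 𝔮, (Φ 𝔮 : Ideal (charGenericFiber p (RingOfIntegers p L) q m)) ≤
            Ideal.comap δp 𝔮.1) ∧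
          Function.Bijective Φ) := by
  obtain ⟨l, rfl⟩ : ∃ l, n = l + 1 := Nat.exists_eq_add_of_le' (by omega)
  subst hq
  obtain ⟨Z, hZ1, hZ⟩ := exists_roots_ringOfIntegers hs hL
  obtain ⟨δ, hδ⟩ := exists_detMap (A := RingOfIntegers p L) (p ^ s) m (l + 1)
  have hδC (z : RingOfIntegers p L) :
      δ (Ideal.Quotient.mk (charIdeal (RingOfIntegers p L) (p ^ s) m) (MvPowerSeries.C z)) =
        Ideal.Quotient.mk (relIdeal (p ^ s) m (l + 1)) (MvPowerSeries.C z) := δ.commutes z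
  have hmem := one_add_X_pow_sub_one_mem_charIdeal (A := RingOfIntegers p L) (p ^ s) m
  refine ⟨?_, δ, fun k => ?_, exists_bijection_minimalPrimes_localization
    (pow_pos (Fact.out : p.Prime).pos s).ne' hZ1 hZ MvPowerSeries.C MvPowerSeries.C
    _ (Xt (2 * m + 2) (l + 1) ⟨0, by omega⟩).det δ.toRingHom
    hδC ?_ hmem (fun z hz => ?_) fun z hz => ?_⟩
  · rw [det_one_add_map_varMatrix, ← map_pow, ← sub_eq_zero, ← map_one (Ideal.Quotient.mk _),
      ← map_sub]
    exact Ideal.Quotient.eq_zero_iff_mem.2 (det_Xt_zero_pow_sub_one_mem_relIdeal _ _ _)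
  · rw [hδ, det_one_add_map_varMatrix, map_sub, map_one]
  · rw [map_add, map_one, map_add, map_one]
    refine (congrArg _ (hδ _)).trans ?_
    rw [map_sub, map_one, add_sub_cancel]
  · rw [charIdeal_sup_span_sub _ m (hZ1 z hz)]
    exact isPrime_span_one_add_X_sub _ (hZ1 z hz)
  · rw [relIdeal_sup_span_det_sub _ m l (hZ1 z hz)]
    exact isPrime_span_fixedDetEqn hq3 hm hpn (hZ1 z hz)
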